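/- Boundedness of the boundary vorticity (Lemma 2.2): Define ω := (v¹ − v²)·∂_α z, where v²(α,t) := u²(z(α,t),t). Then sup_{(α,t)∈ℝ×[0,T]} |ω(α,t)| ≤ C for a constant C depending only on A, T, σ, g, ρ¹, ρ². -/

import Mathlib

noncomputable section
open Set MeasureTheory Filter

/-- The plane `ℝ²` with the Euclidean norm. -/
abbrev E2 : Type := EuclideanSpace ℝ (Fin 2)

/-- The real inner product on `ℝ²`. -/
def rinner (x y : E2) : ℝ := inner ℝ x y

/-- The vector `(1,0)`. -/
def xvec : E2 := (EuclideanSpace.equiv (Fin 2) ℝ).symm ![1, 0]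

/-- The vector `(0,1)`. -/
def e2vec : E2 := (EuclideanSpace.equiv (Fin 2) ℝ).symm ![0, 1]

/-- The period vector `(2π, 0)`. -/
def transl : E2 := (EuclideanSpace.equiv (Fin 2) ℝ).symm ![2 * Real.pi, 0]

/-- The rotation of a vector by `π/2`: `(x,y)^⊥ = (-y,x)`. -/
def perpv (w : E2) : E2 := (EuclideanSpace.equiv (Fin 2) ℝ).symm ![-(w 1), w 0]

/-- The chord-arc function `F(z)` of a time-dependent curve. -/
def chordArcT (z : ℝ → ℝ → E2) (α β t : ℝ) : ℝ :=
  if α = β then ‖deriv (fun a => z a t) α‖ else ‖z α t - z β t‖ / |α - β|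

/-- The two-fluid interface system on the time interval `[0,T]`, in the `2π`-periodic setting,
with densities `ρ1, ρ2`, surface tension coefficient `σ`, gravity constant `grav`, and
quantitative bounds measured by the constant `A`. -/
structure TwoFluid (ρ1 ρ2 σ grav T A : ℝ) where
  /-- the parametrization of the interface -/
  z : ℝ → ℝ → E2
  /-- the domain of the first fluid -/
  Ω1 : ℝ → Set E2
  /-- the domain of the second fluid -/
  Ω2 : ℝ → Set E2
  /-- the velocity field of the first fluid -/
  u1 : E2 → ℝ → E2
  /-- the velocity field of the second fluid -/
  u2 : E2 → ℝ → E2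
  /-- the pressure of the first fluid -/
  P1 : E2 → ℝ → ℝ
  /-- the pressure of the second fluid -/
  P2 : E2 → ℝ → ℝ
  hΩ1_open : ∀ t ∈ Icc (0:ℝ) T, IsOpen (Ω1 t)
  hΩ2_open : ∀ t ∈ Icc (0:ℝ) T, IsOpen (Ω2 t)
  hΩ1_conn : ∀ t ∈ Icc (0:ℝ) T, IsConnected (Ω1 t)
  hΩ2_conn : ∀ t ∈ Icc (0:ℝ) T, IsConnected (Ω2 t)
  hΩ1_sc : ∀ t ∈ Icc (0:ℝ) T, SimplyConnectedSpace (Ω1 t)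
  hΩ2_sc : ∀ t ∈ Icc (0:ℝ) T, SimplyConnectedSpace (Ω2 t)
  /-- `ℝ²` is the disjoint union of `Ω1 t`, `Ω2 t` and the interface `Γ_t` -/
  hUnion : ∀ t ∈ Icc (0:ℝ) T, Ω1 t ∪ Ω2 t ∪ range (fun α => z α t) = univ
  hDisj12 : ∀ t ∈ Icc (0:ℝ) T, Disjoint (Ω1 t) (Ω2 t)
  hDisj1Γ : ∀ t ∈ Icc (0:ℝ) T, Disjoint (Ω1 t) (range (fun α => z α t))
  hDisj2Γ : ∀ t ∈ Icc (0:ℝ) T, Disjoint (Ω2 t) (range (fun α => z α t))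
  hFront1 : ∀ t ∈ Icc (0:ℝ) T, frontier (Ω1 t) = range (fun α => z α t)
  hFront2 : ∀ t ∈ Icc (0:ℝ) T, frontier (Ω2 t) = range (fun α => z α t)
  /-- `Ω1` contains a lower half-plane and `Ω2` an upper half-plane -/
  hStrip : ∃ a : ℝ, 1 ≤ a ∧ ∀ t ∈ Icc (0:ℝ) T,
      {x : E2 | x 1 ≤ -a} ⊆ Ω1 t ∧ {x : E2 | a ≤ x 1} ⊆ Ω2 t
  /-- `u1(·,t)` is `C³` on the closure of `Ω1 t` -/
  hu1_reg : ∀ t ∈ Icc (0:ℝ) T, ContDiffOn ℝ 3 (fun x => u1 x t) (closure (Ω1 t))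
  hu2_reg : ∀ t ∈ Icc (0:ℝ) T, ContDiffOn ℝ 3 (fun x => u2 x t) (closure (Ω2 t))
  hP1_reg : ∀ t ∈ Icc (0:ℝ) T, ContDiffOn ℝ 1 (fun x => P1 x t) (closure (Ω1 t))
  hP2_reg : ∀ t ∈ Icc (0:ℝ) T, ContDiffOn ℝ 1 (fun x => P2 x t) (closure (Ω2 t))
  /-- Euler's equation in `Ω1 t` -/
  hEuler1 : ∀ t ∈ Icc (0:ℝ) T, ∀ x ∈ Ω1 t,
      ρ1 • (deriv (fun s => u1 x s) t + fderiv ℝ (fun y => u1 y t) x (u1 x t)) =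
        -gradient (fun y => P1 y t) x - (grav * ρ1) • e2vec
  /-- Euler's equation in `Ω2 t` -/
  hEuler2 : ∀ t ∈ Icc (0:ℝ) T, ∀ x ∈ Ω2 t,
      ρ2 • (deriv (fun s => u2 x s) t + fderiv ℝ (fun y => u2 y t) x (u2 x t)) =
        -gradient (fun y => P2 y t) x - (grav * ρ2) • e2vec
  /-- incompressibility of the first fluid -/
  hdiv1 : ∀ t ∈ Icc (0:ℝ) T, ∀ x ∈ Ω1 t,
      fderiv ℝ (fun y => u1 y t) x (EuclideanSpace.single 0 1) 0 +
        fderiv ℝ (fun y => u1 y t) x (EuclideanSpace.single 1 1) 1 = 0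
  hdiv2 : ∀ t ∈ Icc (0:ℝ) T, ∀ x ∈ Ω2 t,
      fderiv ℝ (fun y => u2 y t) x (EuclideanSpace.single 0 1) 0 +
        fderiv ℝ (fun y => u2 y t) x (EuclideanSpace.single 1 1) 1 = 0
  /-- irrotationality of the first fluid -/
  hcurl1 : ∀ t ∈ Icc (0:ℝ) T, ∀ x ∈ Ω1 t,
      fderiv ℝ (fun y => u1 y t) x (EuclideanSpace.single 0 1) 1 -
        fderiv ℝ (fun y => u1 y t) x (EuclideanSpace.single 1 1) 0 = 0
  hcurl2 : ∀ t ∈ Icc (0:ℝ) T, ∀ x ∈ Ω2 t,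
      fderiv ℝ (fun y => u2 y t) x (EuclideanSpace.single 0 1) 1 -
        fderiv ℝ (fun y => u2 y t) x (EuclideanSpace.single 1 1) 0 = 0
  /-- kinematic boundary condition for the first fluid -/
  hkin1 : ∀ t ∈ Icc (0:ℝ) T, ∀ α : ℝ,
      rinner (deriv (fun s => z α s) t - u1 (z α t) t) (perpv (deriv (fun a => z a t) α)) = 0
  hkin2 : ∀ t ∈ Icc (0:ℝ) T, ∀ α : ℝ,
      rinner (deriv (fun s => z α s) t - u2 (z α t) t) (perpv (deriv (fun a => z a t) α)) = 0
  /-- the pressure jump at the interface is given by the surface tension times the curvature -/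
  hjump : ∀ t ∈ Icc (0:ℝ) T, ∀ α : ℝ,
      P2 (z α t) t - P1 (z α t) t =
        -σ * (deriv (fun a => z a t) α 0 * deriv (fun a => deriv (fun b => z b t) a) α 1 -
              deriv (fun a => z a t) α 1 * deriv (fun a => deriv (fun b => z b t) a) α 0) /
          ((deriv (fun a => z a t) α 0) ^ 2 + (deriv (fun a => z a t) α 1) ^ 2) ^ ((3:ℝ)/2)
  /-- `2π`-periodicity -/
  hper_z : ∀ t ∈ Icc (0:ℝ) T, ∀ α : ℝ, z (α + 2 * Real.pi) t = z α t + transl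
  hper_Ω1 : ∀ t ∈ Icc (0:ℝ) T, (fun x => x + transl) '' Ω1 t = Ω1 t
  hper_Ω2 : ∀ t ∈ Icc (0:ℝ) T, (fun x => x + transl) '' Ω2 t = Ω2 t
  hper_u1 : ∀ t ∈ Icc (0:ℝ) T, ∀ x ∈ Ω1 t, u1 (x + transl) t = u1 x t
  hper_u2 : ∀ t ∈ Icc (0:ℝ) T, ∀ x ∈ Ω2 t, u2 (x + transl) t = u2 x t
  /-- finite kinetic energy in a period -/
  hL2_1 : ∀ t ∈ Icc (0:ℝ) T,
      IntegrableOn (fun x => ‖u1 x t‖ ^ 2) (Ω1 t ∩ {x : E2 | x 0 ∈ Icc 0 (2 * Real.pi)})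
  hL2_2 : ∀ t ∈ Icc (0:ℝ) T,
      IntegrableOn (fun x => ‖u2 x t‖ ^ 2) (Ω2 t ∩ {x : E2 | x 0 ∈ Icc 0 (2 * Real.pi)})
  /-- `z(α,t) - (α,0)` is `C⁴` with all derivatives of order `≤ 4` bounded by `A` -/
  hz_smooth : ContDiffOn ℝ 4 (fun p : ℝ × ℝ => z p.1 p.2 - p.1 • xvec) (univ ×ˢ Icc (0:ℝ) T)
  hz_bound : ∀ p ∈ (univ ×ˢ Icc (0:ℝ) T : Set (ℝ × ℝ)), ∀ i : ℕ, i ≤ 4 →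
      ‖iteratedFDerivWithin ℝ i (fun p : ℝ × ℝ => z p.1 p.2 - p.1 • xvec)
          (univ ×ˢ Icc (0:ℝ) T) p‖ ≤ A
  /-- the parametrization is regular -/
  hz_lower : ∀ t ∈ Icc (0:ℝ) T, ∀ α : ℝ, A⁻¹ ≤ ‖deriv (fun a => z a t) α‖
  /-- `v¹(α,t) = u¹(z(α,t),t)` is `C³` with all derivatives of order `≤ 3` bounded by `A` -/
  hv1_smooth : ContDiffOn ℝ 3 (fun p : ℝ × ℝ => u1 (z p.1 p.2) p.2) (univ ×ˢ Icc (0:ℝ) T)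
  hv1_bound : ∀ p ∈ (univ ×ˢ Icc (0:ℝ) T : Set (ℝ × ℝ)), ∀ i : ℕ, i ≤ 3 →
      ‖iteratedFDerivWithin ℝ i (fun p : ℝ × ℝ => u1 (z p.1 p.2) p.2)
          (univ ×ˢ Icc (0:ℝ) T) p‖ ≤ A
  /-- the chord-arc condition at time `0` -/
  hchord0 : ∀ α β : ℝ, A⁻¹ ≤ chordArcT z α β 0
  /-- `u²` is bounded by `A` on the interface at time `0` -/
  hu2_init : ∀ α : ℝ, ‖u2 (z α 0) 0‖ ≤ A

section
open Topology Metric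

def DscC : Type := ℂ
instance : TopologicalSpace DscC := ⊥
instance : DiscreteTopology DscC := ⟨rfl⟩

/-- holomorphic functions on simply connected open sets have primitives -/
theorem exists_primitive {U : Set ℂ} (hU : IsOpen U) (hsc : SimplyConnectedSpace U) {f : ℂ → ℂ}
    (hf : DifferentiableOn ℂ f U) : ∃ G : ℂ → ℂ, ∀ x ∈ U, HasDerivAt G (f x) x := by
  have h1 : ∀ i : U, ∃ r > 0, ball (i:ℂ) r ⊆ U := fun i => Metric.isOpen_iff.1 hU i i.2
  choose r hr hrU using h1
  have h2 : ∀ i : U, ∃ g : ℂ → ℂ, ∀ x ∈ ball (i:ℂ) (r i), HasDerivAt g (f x) x :=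
    fun i => DifferentiableOn.isExactOn_ball (hf.mono (hrU i))
  choose g hg using h2
  have hconst : ∀ i j : U, ∃ c : ℂ, ∀ x ∈ ball (i:ℂ) (r i) ∩ ball (j:ℂ) (r j), g i x - g j x = c := by
    intro i j
    have := IsOpen.exists_is_const_of_fderiv_eq_zero (𝕜 := ℂ) (s := ball (i:ℂ) (r i) ∩ ball (j:ℂ) (r j))
      (f := fun x => g i x - g j x)
      (isOpen_ball.inter isOpen_ball) ((convex_ball (i:ℂ) (r i)).inter (convex_ball (j:ℂ) (r j))).isPreconnected
      (fun x hx => ((hg i x hx.1).sub (hg j x hx.2)).differentiableAt.differentiableWithinAt)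
      (fun x hx => by
        have h := (hg i x hx.1).sub (hg j x hx.2)
        rw [sub_self] at h
        have h' := h.hasFDerivAt.fderiv
        have h3 : (fun x => g i x - g j x) = g i - g j := rfl
        rw [h3]; simpa using h')
    exact this
  choose c hc using hconst
  let Zc : FiberBundleCore U U DscC :=
    { baseSet := fun i => {x : U | (x:ℂ) ∈ ball (i:ℂ) (r i)}
      isOpen_baseSet := fun i => isOpen_ball.preimage continuous_subtype_val
      indexAt := id
      mem_baseSet_at := fun x => mem_ball_self (hr x)
      coordChange := fun i j x v => ((show ℂ from v) + (g i x - g j x) : ℂ)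
      coordChange_self := fun i x _ v => by
        show ((show ℂ from v) + (g i x - g i x) : ℂ) = v
        rw [sub_self, add_zero]
      continuousOn_coordChange := fun i j => by
        have h : @Continuous (U × DscC) DscC _ _ (fun p : U × DscC => ((show ℂ from p.2) + c i j : ℂ)) :=
          (continuous_of_discreteTopology (α := DscC) (β := DscC) (f := fun v : DscC => ((show ℂ from v) + c i j : ℂ))).comp
            continuous_snd
        refine h.continuousOn.congr ?_
        rintro ⟨x, v⟩ ⟨hx, -⟩
        show ((show ℂ from v) + (g i x - g j x) : ℂ) = (show ℂ from v) + c i j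
        rw [hc i j x hx]
      coordChange_comp := fun i j k x _ v => by
        show ((show ℂ from v) + (g i x - g j x) + (g j x - g k x) : ℂ) = (show ℂ from v) + (g i x - g k x)
        ring }
  have hcov : IsCoveringMap (Bundle.TotalSpace.proj : Zc.TotalSpace → U) := FiberBundle.isCoveringMap (F := DscC) (E := Zc.Fiber)
  have : LocallyPathConnectedSpace U := hU.locallyPathConnectedSpace
  obtain ⟨x0⟩ : Nonempty U := PathConnectedSpace.nonempty
  obtain ⟨S, ⟨-, hS⟩, -⟩ := hcov.existsUnique_continuousMap_lifts (ContinuousMap.id U) x0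
    (⟨x0, (0:ℂ)⟩ : Zc.TotalSpace) rfl
  have hS1 : ∀ x, (S x).1 = x := fun x => congrFun hS x
  classical
  let v : U → ℂ := fun x => (show ℂ from (S x).2)
  let G : ℂ → ℂ := fun x => if hx : x ∈ U then v ⟨x, hx⟩ + g ⟨x, hx⟩ x else 0
  refine ⟨G, fun x hx => ?_⟩
  set i : U := ⟨x, hx⟩
  have hcont : ContinuousAt (fun y : U => ((Zc.localTrivAt i) (S y)).2) i := by
    have h3 : ContinuousAt (Zc.localTrivAt i) (S i) := by
      apply (Zc.localTrivAt i).continuousAt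
      rw [FiberBundleCore.mem_localTrivAt_source, hS1]
      exact Zc.mem_localTrivAt_baseSet i
    exact (continuous_snd.continuousAt.comp h3).comp S.continuous.continuousAt
  have hloc : ∀ᶠ y : U in 𝓝 i, ((Zc.localTrivAt i) (S y)).2 = ((Zc.localTrivAt i) (S i)).2 := by
    have := hcont (IsOpen.mem_nhds (isOpen_discrete {((Zc.localTrivAt i) (S i)).2}) rfl)
    exact this
  have hval : ∀ y : U, (show ℂ from ((Zc.localTrivAt i) (S y)).2) = v y + (g y y - g i y) := by
    intro y
    rw [Zc.localTrivAt_snd]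
    show v y + (g (S y).1 (S y).1 - g i (S y).1) = _
    rw [hS1]
  have hev : ∀ᶠ y in 𝓝 x, G y = v i + g i x - g i x + g i y := by
    have h4 : ∀ᶠ y : U in 𝓝 i, G y = v i + g i x - g i x + g i y := by
      filter_upwards [hloc] with y hy
      have h5 : v y + (g y y - g i y) = v i + (g i i - g i i) := by rw [← hval y, ← hval i]; exact hy
      have h6 : G y = v y + g y y := by simp [G]
      rw [h6]; linear_combination h5
    rw [show (𝓝 x) = Filter.map (Subtype.val : U → ℂ) (𝓝 i) from (map_nhds_subtype_coe_eq_nhds hx (hU.mem_nhds hx)).symm]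
    exact h4
  exact ((hg i x (mem_ball_self (hr i))).const_add _).congr_of_eventuallyEq hev
end

section
open Topology Complex

theorem norm_ieps (s ε : ℝ) : ‖(I * ε - s : ℂ)‖ ^ 2 = ε ^ 2 + s ^ 2 := by
  rw [← Complex.normSq_eq_norm_sq, Complex.normSq_apply]; simp; ring

theorem norm_ieps_le (s ε : ℝ) : ‖(I * ε - s : ℂ)‖ ≤ |s| + |ε| := by
  calc ‖(I * ε - s : ℂ)‖ ≤ ‖(I * ε : ℂ)‖ + ‖(s:ℂ)‖ := norm_sub_le _ _
    _ = _ := by simp [add_comm]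

theorem norm_ieps_ge (s ε : ℝ) : (|s| + |ε|) / 2 ≤ ‖(I * ε - s : ℂ)‖ := by
  apply le_of_sq_le_sq _ (norm_nonneg _)
  rw [norm_ieps, ← sq_abs s, ← sq_abs ε]; nlinarith [sq_nonneg (|s| - |ε|), abs_nonneg s, abs_nonneg ε]

/-- core separation and kernel estimate -/
theorem kerA (m P M c : ℝ) (hm : 0 < m) (hP : 0 < P) (hM : 0 < M) (hc : 0 < c) :
    ∃ C > 0, ∃ c0 > 0, ∃ ε0 > 0, ∀ (p D E : ℂ) (s ε : ℝ), m ≤ ‖p‖ → ‖p‖ ≤ P →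
      ‖D - s * p‖ ≤ M * s ^ 2 → c * |s| ≤ ‖D‖ → ‖E‖ ≤ M * ε ^ 2 → |ε| ≤ ε0 →
      c0 * (|s| + |ε|) ≤ ‖I * ε * p + E - D‖ ∧
        ‖p / (I * ε * p + E - D) - 1 / (I * ε - s)‖ ≤ C := by
  set δ := m / (4 * M) with hδ
  have hδ0 : 0 < δ := by positivity
  set c1 := min (m / 4) (c / 4) with hc1
  have hc1p : 0 < c1 := by positivity
  refine ⟨2 * M / c1, by positivity, c1 / 2, by positivity, min δ (min (c * δ / (4 * P)) (c1 / (2 * M))), by positivity, ?_⟩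
  intro p D E s ε h1 h2 h3 h4 h5 h6
  have e1 : |ε| ≤ δ := h6.trans (min_le_left _ _)
  have e2 : |ε| ≤ c * δ / (4 * P) := h6.trans ((min_le_right _ _).trans (min_le_left _ _))
  have e3 : |ε| ≤ c1 / (2 * M) := h6.trans ((min_le_right _ _).trans (min_le_right _ _))
  have as := abs_nonneg s
  have ae := abs_nonneg ε
  have key : c1 * (|s| + |ε|) ≤ ‖I * ε * p - D‖ := by
    rcases le_total |s| δ with hs | hs
    · have k1 : ‖p * (I * ε - s)‖ - ‖D - s * p‖ ≤ ‖I * ε * p - D‖ := by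
        have : I * ε * p - D = p * (I * ε - s) - (D - s * p) := by ring
        rw [this]; exact norm_sub_norm_le _ _
      have k2 : m * ((|s| + |ε|) / 2) ≤ ‖p * (I * ε - s)‖ := by
        rw [norm_mul]; exact mul_le_mul h1 (norm_ieps_ge s ε) (by positivity) (norm_nonneg _)
      have k3 : M * s ^ 2 ≤ m / 4 * |s| := by
        rw [← sq_abs, sq, ← mul_assoc]
        refine mul_le_mul_of_nonneg_right ?_ as
        calc M * |s| ≤ M * δ := by gcongr
          _ = m / 4 := by rw [hδ]; field_simp
      have : c1 * (|s| + |ε|) ≤ m / 4 * (|s| + |ε|) := mul_le_mul_of_nonneg_right (min_le_left _ _) (by positivity)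
      nlinarith
    · have k1 : ‖D‖ - ‖I * ε * p‖ ≤ ‖I * ε * p - D‖ := by
        rw [← norm_sub_rev D]; exact norm_sub_norm_le _ _
      have k2 : ‖I * ε * p‖ ≤ c * |s| / 4 := by
        simp only [norm_mul, norm_I, one_mul, norm_real, Real.norm_eq_abs]
        calc |ε| * ‖p‖ ≤ c * δ / (4 * P) * P := by gcongr
          _ = c * δ / 4 := by field_simp
          _ ≤ _ := by gcongr
      have : c1 * (|s| + |ε|) ≤ c / 4 * (|s| + |ε|) := mul_le_mul_of_nonneg_right (min_le_right _ _) (by positivity)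
      nlinarith
  have hE : ‖E‖ ≤ c1 / 2 * |ε| := by
    refine h5.trans ?_
    rw [← sq_abs, sq, ← mul_assoc]
    refine mul_le_mul_of_nonneg_right ?_ ae
    calc M * |ε| ≤ M * (c1 / (2 * M)) := by gcongr
      _ = c1 / 2 := by field_simp
  have sep : c1 / 2 * (|s| + |ε|) ≤ ‖I * ε * p + E - D‖ := by
    have : ‖I * ε * p - D‖ - ‖E‖ ≤ ‖I * ε * p + E - D‖ := by
      have : I * ε * p + E - D = (I * ε * p - D) - (-E) := by ring
      rw [this, ← norm_neg E]; exact norm_sub_norm_le _ _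
    nlinarith
  refine ⟨sep, ?_⟩
  by_cases h0 : (I * ε - s : ℂ) = 0
  · have := norm_ieps s ε
    rw [h0, norm_zero] at this
    have hs : s = 0 := by nlinarith [sq_nonneg s, sq_nonneg ε]
    have he : ε = 0 := by nlinarith [sq_nonneg s, sq_nonneg ε]
    subst hs he
    have hD : D = 0 := by simpa using h3
    have hE0 : E = 0 := by simpa using h5
    simp [hD, hE0]; positivity
  · have hn : 0 < ‖(I * ε - s : ℂ)‖ := norm_pos_iff.2 h0
    have hpos : 0 < |s| + |ε| := lt_of_lt_of_le hn (norm_ieps_le s ε)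
    have hd : 0 < ‖I * ε * p + E - D‖ := lt_of_lt_of_le (by positivity) sep
    have hd0 := norm_pos_iff.1 hd
    have : p / (I * ε * p + E - D) - 1 / (I * ε - s) =
        -(E - (D - s * p)) / ((I * ε * p + E - D) * (I * ε - s)) := by
      rw [div_sub_div _ _ hd0 h0]; congr 1; ring
    rw [this, norm_div, norm_neg, norm_mul, div_le_iff₀ (by positivity)]
    have k1 : ‖E - (D - s * p)‖ ≤ M * (ε ^ 2 + s ^ 2) := (norm_sub_le _ _).trans (by linarith)
    have k2 : ε ^ 2 + s ^ 2 ≤ (|s| + |ε|) * ‖(I * ε - s : ℂ)‖ := by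
      rw [← norm_ieps, sq]; exact mul_le_mul_of_nonneg_right (norm_ieps_le s ε) hn.le
    calc _ ≤ M * ((|s| + |ε|) * ‖(I * ε - s : ℂ)‖) := k1.trans (by gcongr)
      _ = 2 * M / c1 * (c1 / 2 * (|s| + |ε|) * ‖(I * ε - s : ℂ)‖) := by field_simp
      _ ≤ _ := by gcongr

/-- Poisson kernel limit -/
theorem poissonLim {a b : ℝ} (ha : 0 < a) (hb : 0 < b) {y : ℝ → ℂ} (hy : Continuous y) :
    Tendsto (fun ε : ℝ => ∫ s in (-a)..b, y s * ((ε / (ε ^ 2 + s ^ 2) : ℝ) : ℂ)) (𝓝[>] 0) (𝓝 (Real.pi * y 0)) := by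
  obtain ⟨B, hB⟩ := isCompact_Icc.exists_bound_of_continuousOn (hy.continuousOn (s := Icc (-a) b))
  have hB0 : 0 ≤ B := (norm_nonneg _).trans (hB 0 ⟨by linarith, by linarith⟩)
  have key : ∀ᶠ ε : ℝ in 𝓝[>] 0, ∫ r, (Ioc (-a / ε) (b / ε)).indicator (fun r => y (ε * r) * (((1 + r ^ 2)⁻¹ : ℝ) : ℂ)) r
      = ∫ s in (-a)..b, y s * ((ε / (ε ^ 2 + s ^ 2) : ℝ) : ℂ) := by
    filter_upwards [self_mem_nhdsWithin] with ε (hε : 0 < ε)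
    have h1 := intervalIntegral.integral_comp_mul_left (a := -a / ε) (b := b / ε)
      (fun s => y s * ((ε / (ε ^ 2 + s ^ 2) : ℝ) : ℂ)) hε.ne'
    rw [show ε * (-a / ε) = -a by field_simp, show ε * (b / ε) = b by field_simp] at h1
    have h2 : ∫ s in (-a)..b, y s * ((ε / (ε ^ 2 + s ^ 2) : ℝ) : ℂ) = ε • ∫ r in (-a / ε)..(b / ε), y (ε * r) * ((ε / (ε ^ 2 + (ε * r) ^ 2) : ℝ) : ℂ) := by
      rw [h1, smul_smul, mul_inv_cancel₀ hε.ne', one_smul]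
    rw [h2, ← intervalIntegral.integral_smul, intervalIntegral.integral_of_le (by rw [div_le_div_iff_of_pos_right hε]; linarith),
      integral_indicator measurableSet_Ioc]
    congr 1; ext r
    rw [real_smul, show ε ^ 2 + (ε * r) ^ 2 = ε ^ 2 * (1 + r ^ 2) by ring]
    have h3 : (1 + r ^ 2) ≠ 0 := by positivity
    have h4 : ε / (ε ^ 2 * (1 + r ^ 2)) = ε⁻¹ * (1 + r ^ 2)⁻¹ := by field_simp
    rw [h4]; push_cast
    have : (ε : ℂ) ≠ 0 := by exact_mod_cast hε.ne'
    field_simp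
  refine Tendsto.congr' key ?_
  have hlim : ∫ r : ℝ, y 0 * (((1 + r ^ 2)⁻¹ : ℝ) : ℂ) = Real.pi * y 0 := by
    rw [integral_const_mul, integral_complex_ofReal, integral_univ_inv_one_add_sq, mul_comm]
  rw [← hlim]
  refine tendsto_integral_filter_of_dominated_convergence (fun r => B * (1 + r ^ 2)⁻¹) ?_ ?_ ?_ ?_
  · refine Eventually.of_forall fun ε => ?_
    refine AEStronglyMeasurable.indicator ?_ measurableSet_Ioc
    have : Continuous fun r : ℝ => y (ε * r) * (((1 + r ^ 2)⁻¹ : ℝ) : ℂ) :=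
      (hy.comp (by fun_prop)).mul (continuous_ofReal.comp (Continuous.inv₀ (by fun_prop) fun r => by positivity))
    exact this.aestronglyMeasurable
  · filter_upwards [self_mem_nhdsWithin] with ε (hε : 0 < ε)
    refine Eventually.of_forall fun r => ?_
    have hp : 0 ≤ (1 + r ^ 2)⁻¹ := by positivity
    by_cases hr : r ∈ Ioc (-a / ε) (b / ε)
    · rw [indicator_of_mem hr, norm_mul, norm_real, Real.norm_of_nonneg hp]
      refine mul_le_mul_of_nonneg_right (hB _ ⟨?_, ?_⟩) hp
      · have := (div_lt_iff₀ hε).1 hr.1; linarith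
      · have := (le_div_iff₀ hε).1 hr.2; linarith
    · rw [indicator_of_notMem hr, norm_zero]; positivity
  · exact integrable_inv_one_add_sq.const_mul B
  · refine Eventually.of_forall fun r => ?_
    have h1 : Tendsto (fun ε : ℝ => y (ε * r) * (((1 + r ^ 2)⁻¹ : ℝ) : ℂ)) (𝓝[>] 0) (𝓝 (y 0 * (((1 + r ^ 2)⁻¹ : ℝ) : ℂ))) := by
      refine Tendsto.mul_const _ ?_
      have : Tendsto (fun ε : ℝ => ε * r) (𝓝[>] 0) (𝓝 0) := by
        have h : Tendsto (fun ε : ℝ => ε * r) (𝓝 0) (𝓝 (0 * r)) := (continuous_id.mul continuous_const).tendsto 0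
        rw [zero_mul] at h; exact h.mono_left nhdsWithin_le_nhds
      exact (hy.tendsto 0).comp this
    refine h1.congr' ?_
    have h2 : ∀ᶠ ε : ℝ in 𝓝[>] 0, |r| * ε < min a b := by
      have h : Tendsto (fun ε : ℝ => |r| * ε) (𝓝 0) (𝓝 (|r| * 0)) := (continuous_const.mul continuous_id).tendsto 0
      rw [mul_zero] at h
      exact (h.mono_left nhdsWithin_le_nhds).eventually_lt_const (by positivity)
    filter_upwards [self_mem_nhdsWithin, h2] with ε (hε : 0 < ε) hr
    rw [indicator_of_mem]
    have h3 := abs_le.1 (le_refl |r|)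
    have h4 := lt_min_iff.1 hr
    constructor
    · rw [div_lt_iff₀ hε]; nlinarith [neg_abs_le r]
    · rw [le_div_iff₀ hε]; nlinarith [le_abs_self r]
end

section
open Topology Complex

/-- differentiation under the integral sign, continuous version -/
theorem hasDerivAt_param {𝕜 : Type*} [RCLike 𝕜] [NormedSpace 𝕜 ℂ] {a b : ℝ} {U : Set 𝕜}
    (hU : IsOpen U) {F F' : 𝕜 → ℝ → ℂ}
    (hd : ∀ w ∈ U, ∀ s ∈ uIcc a b, HasDerivAt (fun w => F w s) (F' w s) w)
    (hF : ContinuousOn (fun q : 𝕜 × ℝ => F q.1 q.2) (U ×ˢ uIcc a b))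
    (hF' : ContinuousOn (fun q : 𝕜 × ℝ => F' q.1 q.2) (U ×ˢ uIcc a b)) {x : 𝕜} (hx : x ∈ U) :
    HasDerivAt (fun w => ∫ s in a..b, F w s) (∫ s in a..b, F' x s) x := by
  obtain ⟨r, hr, hrU⟩ := Metric.isOpen_iff.1 hU x hx
  have hK : IsCompact (Metric.closedBall x (r / 2) ×ˢ uIcc a b) := (isCompact_closedBall x (r / 2)).prod isCompact_uIcc
  have hsub : Metric.closedBall x (r / 2) ⊆ U :=
    (Metric.closedBall_subset_ball (by linarith)).trans hrU
  obtain ⟨B, hB⟩ := hK.exists_bound_of_continuousOn (hF'.mono (prod_mono hsub le_rfl))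
  have slice : ∀ {G : 𝕜 → ℝ → ℂ}, ContinuousOn (fun q : 𝕜 × ℝ => G q.1 q.2) (U ×ˢ uIcc a b) →
      ∀ w ∈ U, ContinuousOn (G w) (uIcc a b) := by
    intro G hG w hw
    exact hG.comp (f := fun s => (w, s)) (by fun_prop) (fun s hs => ⟨hw, hs⟩)
  have meas : ∀ {G : 𝕜 → ℝ → ℂ}, ContinuousOn (fun q : 𝕜 × ℝ => G q.1 q.2) (U ×ˢ uIcc a b) →
      ∀ w ∈ U, AEStronglyMeasurable (G w) (volume.restrict (uIoc a b)) := by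
    intro G hG w hw
    exact ((slice hG w hw).mono uIoc_subset_uIcc).aestronglyMeasurable measurableSet_uIoc
  refine (intervalIntegral.hasDerivAt_integral_of_dominated_loc_of_deriv_le
    (s := Metric.ball x (r / 2)) (bound := fun _ => B) (Metric.ball_mem_nhds x (by positivity)) ?_ ?_ ?_ ?_ ?_ ?_).2
  · filter_upwards [hU.mem_nhds hx] with w hw using meas hF w hw
  · exact (slice hF x hx).intervalIntegrable
  · exact meas hF' x hx
  · exact Eventually.of_forall fun s hs w hw =>
      hB (w, s) ⟨Metric.ball_subset_closedBall hw, uIoc_subset_uIcc hs⟩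
  · exact intervalIntegrable_const
  · exact Eventually.of_forall fun s hs w hw =>
      hd w (hsub (Metric.ball_subset_closedBall hw)) s (uIoc_subset_uIcc hs)

theorem chordExists {K : Set ℝ} (hK : IsCompact K) {D : ℝ → ℝ → ℂ} (hD : Continuous fun q : ℝ × ℝ => D q.1 q.2)
    {p : ℝ → ℂ} {m M L : ℝ} (hm : 0 < m) (hM : 0 < M) (hp : ∀ α, m ≤ ‖p α‖)
    (hT : ∀ α s, ‖D α s - s * p α‖ ≤ M * s ^ 2) (hne : ∀ α s, s ≠ 0 → |s| ≤ L → D α s ≠ 0) :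
    ∃ c > 0, ∀ α ∈ K, ∀ s, |s| ≤ L → c * |s| ≤ ‖D α s‖ := by
  set δ := m / (2 * M)
  have hδ : 0 < δ := by positivity
  have hK2 : IsCompact (K ×ˢ (Icc (-|L|) |L| ∩ {s | δ ≤ |s|})) :=
    hK.prod (isCompact_Icc.inter_right (isClosed_le continuous_const continuous_abs))
  have near : ∀ α s, |s| ≤ δ → m / 2 * |s| ≤ ‖D α s‖ := by
    intro α s hs
    have h1 : ‖s * p α‖ - ‖D α s - s * p α‖ ≤ ‖D α s‖ := by
      have := norm_sub_norm_le (s * p α) (-(D α s - s * p α))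
      rw [norm_neg] at this; simpa using this
    have h2 : m * |s| ≤ ‖s * p α‖ := by
      rw [norm_mul, norm_real, Real.norm_eq_abs, mul_comm]; exact mul_le_mul_of_nonneg_left (hp α) (abs_nonneg s)
    have h3 : M * s ^ 2 ≤ m / 2 * |s| := by
      rw [← sq_abs, sq, ← mul_assoc]
      refine mul_le_mul_of_nonneg_right ?_ (abs_nonneg s)
      calc M * |s| ≤ M * δ := by gcongr
        _ = m / 2 := by simp only [δ]; field_simp
    linarith [hT α s]
  rcases (K ×ˢ (Icc (-|L|) |L| ∩ {s | δ ≤ |s|})).eq_empty_or_nonempty with he | hne'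
  · refine ⟨m / 2, by positivity, fun α hα s hs => near α s ?_⟩
    by_contra hc
    have : (α, s) ∈ (K ×ˢ (Icc (-|L|) |L| ∩ {s | δ ≤ |s|})) :=
      ⟨hα, abs_le.1 (hs.trans (le_abs_self L)), (not_le.1 hc).le⟩
    rw [he] at this; exact this
  · obtain ⟨q, hq, hmin⟩ := hK2.exists_isMinOn hne' (f := fun q => ‖D q.1 q.2‖) hD.norm.continuousOn
    by_cases hqL : |q.2| ≤ L
    · have hL : 0 ≤ L := (abs_nonneg _).trans hqL
      have hpos : 0 < ‖D q.1 q.2‖ := by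
        refine norm_pos_iff.2 (hne _ _ ?_ hqL)
        intro h0; have := hq.2.2; simp [h0] at this; linarith
      refine ⟨min (m / 2) (‖D q.1 q.2‖ / (L + 1)), by positivity, fun α hα s hs => ?_⟩
      rcases le_total |s| δ with h | h
      · exact (mul_le_mul_of_nonneg_right (min_le_left _ _) (abs_nonneg s)).trans (near α s h)
      · calc _ ≤ ‖D q.1 q.2‖ / (L + 1) * (L + 1) :=
              mul_le_mul (min_le_right _ _) (by linarith) (abs_nonneg s) (by positivity)
          _ = ‖D q.1 q.2‖ := by field_simp
          _ ≤ _ := hmin (show (α, s) ∈ _ from ⟨hα, abs_le.1 (hs.trans (le_abs_self L)), h⟩)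
    · refine ⟨m / 2, by positivity, fun α hα s hs => near α s ?_⟩
      exfalso
      apply hqL
      have h1 := abs_le.2 hq.2.1
      have h2 : 0 ≤ L := (abs_nonneg _).trans hs
      rwa [abs_of_nonneg h2] at h1

/-- remainder kernel -/
def Rker (p : ℂ) (D : ℝ → ℂ) (E : ℝ → ℂ) (ε s : ℝ) : ℂ := p / (I * ε * p + E ε - D s) - 1 / (I * ε - s)

theorem kerLim {a b : ℝ} {p : ℂ} {D E y : ℝ → ℂ} {c0 C ε0 : ℝ} (hc0 : 0 < c0) (hε0 : 0 < ε0)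
    (hD : Continuous D) (hE : ContinuousAt E 0) (hy : Continuous y) (hab : -a ≤ b)
    (hb : ∀ ε s, |ε| ≤ ε0 → s ∈ Icc (-a) b → c0 * (|s| + |ε|) ≤ ‖I * ε * p + E ε - D s‖ ∧ ‖Rker p D E ε s‖ ≤ C) :
    Tendsto (fun ε => ∫ s in (-a)..b, y s * Rker p D E ε s) (𝓝[≠] 0) (𝓝 (∫ s in (-a)..b, y s * Rker p D E 0 s)) := by
  obtain ⟨B, hB⟩ := isCompact_Icc.exists_bound_of_continuousOn (hy.continuousOn (s := Icc (-a) b))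
  have hev : ∀ᶠ ε : ℝ in 𝓝[≠] 0, |ε| ≤ ε0 ∧ ε ≠ 0 := by
    have h1 : ∀ᶠ ε : ℝ in 𝓝 0, |ε| ≤ ε0 := by
      filter_upwards [Metric.closedBall_mem_nhds (0:ℝ) hε0] with ε h; simpa using h
    filter_upwards [h1.filter_mono nhdsWithin_le_nhds, self_mem_nhdsWithin] with ε h2 h3 using ⟨h2, h3⟩
  refine intervalIntegral.tendsto_integral_filter_of_dominated_convergence (fun _ => B * C) ?_ ?_ ?_ ?_
  · filter_upwards [hev] with ε ⟨h1, h2⟩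
    rw [uIoc_of_le hab]
    refine ContinuousOn.aestronglyMeasurable ?_ measurableSet_Ioc
    refine hy.continuousOn.mul (ContinuousOn.sub ?_ ?_)
    · refine ContinuousOn.div continuousOn_const (by fun_prop) fun s hs => ?_
      refine norm_pos_iff.1 (lt_of_lt_of_le ?_ (hb ε s h1 (Ioc_subset_Icc_self hs)).1)
      have := abs_pos.2 h2; positivity
    · refine ContinuousOn.div continuousOn_const (by fun_prop) fun s hs => ?_
      refine norm_pos_iff.1 (lt_of_lt_of_le ?_ (norm_ieps_ge s ε))
      have := abs_pos.2 h2; positivity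
  · filter_upwards [hev] with ε ⟨h1, h2⟩
    refine Eventually.of_forall fun s hs => ?_
    rw [uIoc_of_le hab] at hs
    rw [norm_mul]
    exact mul_le_mul (hB s (Ioc_subset_Icc_self hs)) (hb ε s h1 (Ioc_subset_Icc_self hs)).2 (norm_nonneg _)
      ((norm_nonneg _).trans (hB s (Ioc_subset_Icc_self hs)))
  · exact intervalIntegrable_const
  · have h0 : ∀ᵐ s : ℝ, s ≠ 0 := by
      rw [ae_iff]; simp
    filter_upwards [h0] with s hs0 hs
    rw [uIoc_of_le hab] at hs
    refine Tendsto.const_mul _ ?_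
    have : ContinuousAt (fun ε : ℝ => Rker p D E ε s) 0 := by
      have hs' := abs_pos.2 hs0
      refine ContinuousAt.sub (ContinuousAt.div continuousAt_const ?_ ?_) (ContinuousAt.div continuousAt_const (by fun_prop) ?_)
      · exact ((by fun_prop : ContinuousAt (fun ε : ℝ => I * ε * p) 0).add hE).sub continuousAt_const
      · refine norm_pos_iff.1 (lt_of_lt_of_le ?_ (hb 0 s (by simpa using hε0.le) (Ioc_subset_Icc_self hs)).1)
        have := abs_pos.2 hs0; positivity
      · simpa using hs0
    exact this.tendsto.mono_left nhdsWithin_le_nhds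

theorem tendsto_neg_gt : Tendsto (fun ε : ℝ => -ε) (𝓝[>] 0) (𝓝[≠] 0) := by
  have : Tendsto (fun ε : ℝ => -ε) (𝓝[>] 0) (𝓝[<] 0) := by
    simpa using tendsto_neg_nhdsGT (a := (0:ℝ))
  exact this.mono_right (nhdsWithin_mono _ fun _ hx => ne_of_lt hx)

theorem tendsto_id_gt : Tendsto (fun ε : ℝ => ε) (𝓝[>] 0) (𝓝[≠] 0) :=
  tendsto_id.mono_right (nhdsWithin_mono _ fun _ hx => ne_of_gt hx)

/-- the jump -/
theorem jumpLim {a b : ℝ} {p : ℂ} {D E y : ℝ → ℂ} {c0 C ε0 : ℝ} (hc0 : 0 < c0) (hε0 : 0 < ε0)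
    (hD : Continuous D) (hE : ContinuousAt E 0) (hy : Continuous y) (ha : 0 < a) (hb' : 0 < b)
    (hb : ∀ ε s, |ε| ≤ ε0 → s ∈ Icc (-a) b → c0 * (|s| + |ε|) ≤ ‖I * ε * p + E ε - D s‖ ∧ ‖Rker p D E ε s‖ ≤ C) :
    Tendsto (fun ε : ℝ => ∫ s in (-a)..b, y s * (p / (I * ε * p + E ε - D s) - p / (I * (-ε : ℝ) * p + E (-ε) - D s)))
      (𝓝[>] 0) (𝓝 (-(2 * Real.pi * I * y 0))) := by
  have hab : -a ≤ b := by linarith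
  have h1 := kerLim hc0 hε0 hD hE hy hab hb
  have h2 := ((h1.comp tendsto_id_gt).sub (h1.comp tendsto_neg_gt)).add
    ((poissonLim ha hb' hy).const_mul (-(2 * I)))
  have hval : (∫ s in (-a)..b, y s * Rker p D E 0 s) - (∫ s in (-a)..b, y s * Rker p D E 0 s) + -(2 * I) * (Real.pi * y 0)
      = -(2 * Real.pi * I * y 0) := by ring
  rw [hval] at h2
  refine h2.congr' ?_
  have hev : ∀ᶠ ε : ℝ in 𝓝[>] 0, |ε| ≤ ε0 := by
    have h1 : ∀ᶠ ε : ℝ in 𝓝 0, |ε| ≤ ε0 := by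
      filter_upwards [Metric.closedBall_mem_nhds (0:ℝ) hε0] with ε h; simpa using h
    exact h1.filter_mono nhdsWithin_le_nhds
  filter_upwards [hev, self_mem_nhdsWithin] with ε h1 (h2 : 0 < ε)
  have hne : ∀ e : ℝ, e ≠ 0 → |e| ≤ ε0 → ∀ s ∈ Icc (-a) b, I * e * p + E e - D s ≠ 0 := by
    intro e he he' s hs
    refine norm_pos_iff.1 (lt_of_lt_of_le ?_ (hb e s he' hs).1)
    have := abs_pos.2 he; positivity
  have hne2 : ∀ e : ℝ, e ≠ 0 → ∀ s : ℝ, (I * e - s : ℂ) ≠ 0 := by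
    intro e he s
    refine norm_pos_iff.1 (lt_of_lt_of_le ?_ (norm_ieps_ge s e))
    have := abs_pos.2 he; positivity
  have hint : ∀ e : ℝ, e ≠ 0 → |e| ≤ ε0 → IntervalIntegrable (fun s => y s * Rker p D E e s) volume (-a) b := by
    intro e he he'
    refine ContinuousOn.intervalIntegrable ?_
    rw [uIcc_of_le hab]
    exact hy.continuousOn.mul ((ContinuousOn.div continuousOn_const (by fun_prop) (hne e he he')).sub
      (ContinuousOn.div continuousOn_const (by fun_prop) fun s _ => hne2 e he s))
  have hint2 : IntervalIntegrable (fun s => y s * ((ε / (ε ^ 2 + s ^ 2) : ℝ) : ℂ)) volume (-a) b := by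
    refine Continuous.intervalIntegrable ?_ _ _
    refine hy.mul (continuous_ofReal.comp (Continuous.div continuous_const (by fun_prop) fun s => ?_))
    positivity
  simp only [Function.comp]
  rw [← intervalIntegral.integral_sub (hint ε h2.ne' h1) (hint (-ε) (neg_ne_zero.2 h2.ne') (by rwa [abs_neg])),
    ← intervalIntegral.integral_const_mul, ← intervalIntegral.integral_add
      ((hint ε h2.ne' h1).sub (hint (-ε) (neg_ne_zero.2 h2.ne') (by rwa [abs_neg]))) (hint2.const_mul _)]
  refine intervalIntegral.integral_congr fun s hs => ?_
  have e1 := hne2 ε h2.ne' s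
  have e2 := hne2 (-ε) (neg_ne_zero.2 h2.ne') s
  have e3 : (ε ^ 2 + s ^ 2 : ℂ) ≠ 0 := by
    have : (ε ^ 2 + s ^ 2 : ℝ) ≠ 0 := by positivity
    exact_mod_cast this
  have e4 : 1 / (I * ε - s : ℂ) - 1 / (I * (-ε : ℝ) - s) = -(2 * I) * (ε / (ε ^ 2 + s ^ 2)) := by
    rw [div_sub_div _ _ e1 e2, mul_div_assoc', div_eq_div_iff (mul_ne_zero e1 e2) e3]
    push_cast
    linear_combination (-2 * I * ε^3) * (I_sq)
  simp only [Rker]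
  push_cast at e4 ⊢
  linear_combination y s * (-e4)
end

section
open Topology Complex

structure Crv (z z1 z2 : ℝ → ℂ) : Prop where
  d0 : ∀ α, HasDerivAt z (z1 α) α
  d1 : ∀ α, HasDerivAt z1 (z2 α) α
  c2 : Continuous z2
  per : ∀ α, z (α + 2 * Real.pi) = z α + 2 * Real.pi
  ne : ∀ α, z1 α ≠ 0

structure Dom (z : ℝ → ℂ) (Ω1 Ω2 : Set ℂ) : Prop where
  o1 : IsOpen Ω1
  o2 : IsOpen Ω2
  pc1 : IsPreconnected Ω1
  pc2 : IsPreconnected Ω2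
  sc1 : SimplyConnectedSpace Ω1
  sc2 : SimplyConnectedSpace Ω2
  un : Ω1 ∪ Ω2 ∪ range z = univ
  dj12 : Disjoint Ω1 Ω2
  dj1 : Disjoint Ω1 (range z)
  dj2 : Disjoint Ω2 (range z)
  fr1 : frontier Ω1 = range z
  fr2 : frontier Ω2 = range z
  str : ∃ a : ℝ, (∀ x : ℂ, x.im ≤ -a → x ∈ Ω1) ∧ ∀ x : ℂ, a ≤ x.im → x ∈ Ω2
  p1 : ∀ x : ℂ, x + 2 * Real.pi ∈ Ω1 ↔ x ∈ Ω1
  p2 : ∀ x : ℂ, x + 2 * Real.pi ∈ Ω2 ↔ x ∈ Ω2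

theorem taylor2 {γ γ1 γ2 : ℝ → ℂ} (h0 : ∀ α, HasDerivAt γ (γ1 α) α) (h1 : ∀ α, HasDerivAt γ1 (γ2 α) α) {M : ℝ}
    (hM : ∀ α, ‖γ2 α‖ ≤ M) (α s : ℝ) : ‖γ (α + s) - γ α - s * γ1 α‖ ≤ M * s ^ 2 := by
  have b1 : ∀ r, ‖γ1 (α + r) - γ1 α‖ ≤ M * |r| := by
    intro r
    have := Convex.norm_image_sub_le_of_norm_hasDerivWithin_le (s := univ) (fun x _ => (h1 x).hasDerivWithinAt)
      (fun x _ => hM x) convex_univ (mem_univ α) (mem_univ (α + r))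
    simpa using this
  have hd : ∀ r ∈ uIcc 0 s, HasDerivWithinAt (fun r : ℝ => γ (α + r) - r * γ1 α) (γ1 (α + r) - γ1 α) (uIcc 0 s) r := by
    intro r _
    have e1 : HasDerivAt (fun r : ℝ => γ (α + r)) (γ1 (α + r)) r := by
      exact HasDerivAt.comp_const_add (f := γ) α r (h0 (α + r))
    have e2 : HasDerivAt (fun r : ℝ => (r : ℂ) * γ1 α) (γ1 α) r := by
      simpa using (Complex.ofRealCLM.hasDerivAt (x := r)).mul_const (γ1 α)
    exact (e1.sub e2).hasDerivWithinAt
  have := Convex.norm_image_sub_le_of_norm_hasDerivWithin_le (C := M * |s|) hd (fun r hr => (b1 r).trans ?_)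
    (convex_uIcc 0 s) left_mem_uIcc right_mem_uIcc
  · have e : ‖γ (α + s) - s * γ1 α - γ α‖ ≤ M * |s| * |s| := by simpa using this
    rw [← sq_abs, sq, ← mul_assoc]
    convert e using 2; ring
  · refine mul_le_mul_of_nonneg_left ?_ ((norm_nonneg _).trans (hM 0))
    have h := abs_sub_left_of_mem_uIcc hr
    simpa using h

theorem per_bound {f : ℝ → ℂ} (hf : Continuous f) (hp : ∀ α, f (α + 2 * Real.pi) = f α) : ∃ M > 0, ∀ α, ‖f α‖ ≤ M := by
  obtain ⟨M, hM⟩ := (Function.Periodic.isBounded_of_continuous (f := f) (c := 2 * Real.pi) hp Real.two_pi_pos.ne' hf).exists_norm_le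
  exact ⟨|M| + 1, by positivity, fun α => (hM _ ⟨α, rfl⟩).trans (by linarith [le_abs_self M])⟩

namespace Crv
variable {z z1 z2 : ℝ → ℂ} (h : Crv z z1 z2)
include h
theorem cz : Continuous z := continuous_iff_continuousAt.2 fun α => (h.d0 α).continuousAt
theorem c1 : Continuous z1 := continuous_iff_continuousAt.2 fun α => (h.d1 α).continuousAt
theorem per1 (α : ℝ) : z1 (α + 2 * Real.pi) = z1 α := by
  have e1 : HasDerivAt (fun a => z (a + 2 * Real.pi)) (z1 (α + 2 * Real.pi)) α := (h.d0 _).comp_add_const α _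
  have e2 : HasDerivAt (fun a => z (a + 2 * Real.pi)) (z1 α) α := by
    rw [show (fun a => z (a + 2 * Real.pi)) = fun a => z a + 2 * Real.pi from funext h.per]
    exact (h.d0 α).add_const _
  exact e1.unique e2
theorem per2 (α : ℝ) : z2 (α + 2 * Real.pi) = z2 α := by
  have e1 : HasDerivAt (fun a => z1 (a + 2 * Real.pi)) (z2 (α + 2 * Real.pi)) α := (h.d1 _).comp_add_const α _
  have e2 : HasDerivAt (fun a => z1 (a + 2 * Real.pi)) (z2 α) α := by
    rw [show (fun a => z1 (a + 2 * Real.pi)) = z1 from funext h.per1]; exact h.d1 α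
  exact e1.unique e2
theorem lower : ∃ m > 0, ∀ α, m ≤ ‖z1 α‖ := by
  obtain ⟨M, hM, hb⟩ := per_bound (f := fun α => (z1 α)⁻¹) (h.c1.inv₀ h.ne) (fun α => by simp only [h.per1])
  refine ⟨M⁻¹, by positivity, fun α => ?_⟩
  have := hb α
  rw [norm_inv] at this
  exact inv_le_of_inv_le₀ (norm_pos_iff.2 (h.ne α)) this
theorem perInt (n : ℤ) (α : ℝ) : z (α + n * (2 * Real.pi)) = z α + n * (2 * Real.pi) := by
  have : ∀ α, (fun a => z a - a) (α + 2 * Real.pi) = (fun a => z a - a) α := by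
    intro α; simp only [h.per]; push_cast; ring
  have h2 := (Function.Periodic.int_mul (f := fun a : ℝ => z a - a) this n) α
  simp only at h2; push_cast at h2; linear_combination h2
end Crv

theorem embed {z z1 z2 : ℝ → ℂ} (h : Crv z z1 z2) {Ω1 Ω2 : Set ℂ} (d : Dom z Ω1 Ω2) : Function.Injective z := by
  by_contra hinj
  obtain ⟨m, hm, hml⟩ := h.lower
  obtain ⟨P, hP, hPu⟩ := per_bound h.c1 h.per1
  obtain ⟨M, hM, hMu⟩ := per_bound h.c2 h.per2
  have hT := fun α s => taylor2 h.d0 h.d1 hMu α s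
  have hpi := Real.two_pi_pos
  -- local injectivity
  have hloc : ∀ α s, 0 < s → z (α + s) = z α → m / M ≤ s := by
    intro α s hs he
    have := hT α s
    rw [he, sub_self, zero_sub, norm_neg, norm_mul, norm_real, Real.norm_of_nonneg hs.le] at this
    rw [div_le_iff₀ hM]
    have h2 : s * m ≤ s * (s * M) := (mul_le_mul_of_nonneg_left (hml α) hs.le).trans (this.trans (by nlinarith))
    exact le_of_mul_le_mul_left h2 hs
  obtain ⟨S, a1, hS, haS⟩ : ∃ S a1, 0 < S ∧ z (a1 + S) = z a1 := by
    simp only [Function.Injective, not_forall] at hinj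
    obtain ⟨a, b, hab, hne⟩ := hinj
    rcases lt_or_gt_of_ne hne with hl | hl
    · exact ⟨b - a, a, by linarith, by simp [hab]⟩
    · exact ⟨a - b, b, by linarith, by simp [hab]⟩
  have shift : ∀ α s, z (α + s) = z α → ∃ α' ∈ Icc 0 (2 * Real.pi), z (α' + s) = z α' := by
    intro α s he
    obtain ⟨n, hn, -⟩ := existsUnique_add_zsmul_mem_Ico hpi α 0
    refine ⟨α + n • (2 * Real.pi), ⟨hn.1, by simpa using hn.2.le⟩, ?_⟩
    rw [zsmul_eq_mul, add_right_comm, h.perInt, h.perInt, he]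
  have hKc : IsCompact ((Icc 0 (2 * Real.pi) ×ˢ Icc (m / M) S) ∩ {q : ℝ × ℝ | z (q.1 + q.2) = z q.1}) :=
    (isCompact_Icc.prod isCompact_Icc).inter_right (isClosed_eq (h.cz.comp (by fun_prop)) (h.cz.comp (by fun_prop)))
  have hKne : ((Icc 0 (2 * Real.pi) ×ˢ Icc (m / M) S) ∩ {q : ℝ × ℝ | z (q.1 + q.2) = z q.1}).Nonempty := by
    obtain ⟨α', hα', he⟩ := shift a1 S haS
    exact ⟨(α', S), ⟨hα', hloc _ _ hS haS, le_rfl⟩, he⟩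
  obtain ⟨⟨a0, s0⟩, hq, hmin⟩ := hKc.exists_isMinOn hKne (f := fun q : ℝ × ℝ => q.2) continuous_snd.continuousOn
  have hs0 : 0 < s0 := lt_of_lt_of_le (by positivity) hq.1.2.1
  have hminS : ∀ α s, 0 < s → z (α + s) = z α → s0 ≤ s := by
    intro α s hs he
    by_cases hsS : s ≤ S
    · obtain ⟨α', hα', he'⟩ := shift α s he
      exact hmin (show (α', s) ∈ _ from ⟨⟨hα', hloc _ _ hs he, hsS⟩, he'⟩)
    · exact hq.1.2.2.trans (not_le.1 hsS).le
  set L := s0 / 2 with hL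
  set μ := a0 + L with hμ
  have hL0 : 0 < L := by positivity
  set γ : ℝ → ℂ := fun s => z (μ + s) with hγ
  have hγc : Continuous γ := h.cz.comp (by fun_prop)
  have hclose : γ (-L) = γ L := by
    simp only [hγ, hμ]
    rw [show a0 + L + -L = a0 by ring, show a0 + L + L = a0 + s0 by rw [hL]; ring]
    exact hq.2.symm
  set D : ℝ → ℂ := fun s => γ s - z μ with hDdef
  have hDne : ∀ s, s ≠ 0 → |s| ≤ L → D s ≠ 0 := by
    intro s hs hsL h0
    have h1 : z (μ + s) = z μ := sub_eq_zero.1 h0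
    rcases lt_or_gt_of_ne hs with hl | hl
    · have := hminS (μ + s) (-s) (by linarith) (by rw [h1]; congr 1; ring)
      rw [abs_of_neg hl] at hsL; linarith
    · have := hminS μ s hl h1
      rw [abs_of_pos hl] at hsL; linarith
  have hDc : Continuous D := hγc.sub continuous_const
  obtain ⟨c, hc, hcD⟩ := chordExists (K := {0}) isCompact_singleton (D := fun _ s => D s) (p := fun _ => z1 μ) (L := L)
    (hDc.comp continuous_snd) hm hM (fun _ => hml μ) (fun _ s => hT μ s) (fun _ s => hDne s)
  obtain ⟨C, hC, c0, hc0, ε0, hε0, hker⟩ := kerA m P M c hm hP hM hc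
  have hb : ∀ ε s : ℝ, |ε| ≤ ε0 → s ∈ Icc (-L) L → c0 * (|s| + |ε|) ≤ ‖I * ε * z1 μ + (fun _ => 0) ε - D s‖ ∧
      ‖Rker (z1 μ) D (fun _ => 0) ε s‖ ≤ C := fun ε s he hs =>
    hker (z1 μ) (D s) 0 s ε (hml μ) (hPu μ) (hT μ s) (hcD 0 rfl s (abs_le.2 hs)) (by simp; positivity) he
  -- the loop integral
  set y : ℝ → ℂ := fun s => z1 (μ + s) with hy
  have hyc : Continuous y := h.c1.comp (by fun_prop)
  set N : Set ℂ := (γ '' Icc (-L) L)ᶜ with hN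
  have hNo : IsOpen N := (isCompact_Icc.image hγc).isClosed.isOpen_compl
  have hLL : uIcc (-L) L = Icc (-L) L := uIcc_of_le (by linarith)
  set W : ℂ → ℂ := fun x => ∫ s in (-L)..L, y s / (x - γ s) with hW
  have hxne : ∀ x ∈ N, ∀ s ∈ Icc (-L) L, x - γ s ≠ 0 := by
    intro x hx s hs h0
    exact hx ⟨s, hs, (sub_eq_zero.1 h0).symm⟩
  have hWd : ∀ x ∈ N, HasDerivAt W 0 x := by
    intro x hx
    have h1 : HasDerivAt W (∫ s in (-L)..L, -(y s) / (x - γ s) ^ 2) x := by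
      refine hasDerivAt_param (F := fun x s => y s / (x - γ s)) (F' := fun x s => -(y s) / (x - γ s) ^ 2) hNo ?_ ?_ ?_ hx
      · intro w hw s hs
        rw [hLL] at hs
        have := (hasDerivAt_const w (y s)).fun_div ((hasDerivAt_id w).sub_const (γ s)) (hxne w hw s hs)
        simpa using this
      · refine ContinuousOn.div (by fun_prop) (by fun_prop) fun q hq => ?_
        exact hxne _ hq.1 _ (hLL ▸ hq.2)
      · refine ContinuousOn.div (by fun_prop) (by fun_prop) fun q hq => ?_
        exact pow_ne_zero _ (hxne _ hq.1 _ (hLL ▸ hq.2))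
    have h2 : ∫ s in (-L)..L, -(y s) / (x - γ s) ^ 2 = (-(1 / (x - γ L))) - (-(1 / (x - γ (-L)))) := by
      refine intervalIntegral.integral_eq_sub_of_hasDerivAt (f := fun s => -(1 / (x - γ s))) ?_ ?_
      · intro s hs
        rw [hLL] at hs
        have h3 : HasDerivAt γ (y s) s := HasDerivAt.comp_const_add (f := z) μ s (h.d0 (μ + s))
        have := ((hasDerivAt_const s (1:ℂ)).fun_div (h3.const_sub x) (hxne x hx s hs)).fun_neg
        refine this.congr_deriv ?_
        ring
      · refine ContinuousOn.intervalIntegrable ?_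
        refine ContinuousOn.div (by fun_prop) (by fun_prop) fun s hs => pow_ne_zero _ (hxne x hx s (hLL ▸ hs))
    rw [h2, hclose, sub_self] at h1
    exact h1
  obtain ⟨B, hB⟩ := (isCompact_Icc (a := -L) (b := L)).exists_bound_of_continuousOn hγc.continuousOn
  have hfar : ∀ x : ℂ, B + 1 ≤ ‖x‖ → ‖W x‖ ≤ P / (‖x‖ - B) * |L - (-L)| := by
    intro x hx
    refine intervalIntegral.norm_integral_le_of_norm_le_const fun s hs => ?_
    rw [uIoc_of_le (by linarith)] at hs
    rw [norm_div]
    have := hB s (Ioc_subset_Icc_self hs)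
    refine div_le_div₀ hP.le (hPu _) (by linarith) ?_
    linarith [norm_sub_norm_le x (γ s)]
  have hlim : ∀ σ : ℝ, (σ = 1 ∨ σ = -1) → Tendsto (fun R : ℝ => W (σ * R * I)) atTop (𝓝 0) := by
    intro σ hσ
    have h1 : Tendsto (fun R : ℝ => P / (R - B) * |L - (-L)|) atTop (𝓝 0) := by
      have : Tendsto (fun R : ℝ => P / (R - B)) atTop (𝓝 0) :=
        tendsto_const_nhds.div_atTop (tendsto_atTop_add_const_right _ (-B) tendsto_id)
      simpa using this.mul_const |L - (-L)|
    refine squeeze_zero_norm' ?_ h1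
    filter_upwards [eventually_ge_atTop (B + 1), eventually_ge_atTop 0] with R hR hR0
    have hn : ‖(σ * R * I : ℂ)‖ = R := by
      rcases hσ with rfl | rfl <;> simp [abs_of_nonneg hR0]
    have := hfar (σ * R * I) (by rw [hn]; exact hR)
    rwa [hn] at this
  have hzero : ∀ (Ω : Set ℂ) (σ : ℝ), (σ = 1 ∨ σ = -1) → IsOpen Ω → IsPreconnected Ω → Ω ⊆ N →
      (∀ᶠ R : ℝ in atTop, (σ * R * I : ℂ) ∈ Ω) → ∀ x ∈ Ω, W x = 0 := by
    intro Ω σ hσ ho hp hsub hev x hx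
    obtain ⟨k, hk⟩ := IsOpen.exists_is_const_of_fderiv_eq_zero (𝕜 := ℂ) (f := W) ho hp
      (fun x hx => (hWd x (hsub hx)).differentiableAt.differentiableWithinAt)
      (fun x hx => by simpa using (hWd x (hsub hx)).hasFDerivAt.fderiv)
    rw [hk x hx]
    refine tendsto_nhds_unique (tendsto_const_nhds.congr' ?_) (hlim σ hσ)
    filter_upwards [hev] with R hR using (hk _ hR).symm
  obtain ⟨a, ha1, ha2⟩ := d.str
  have hsub : range γ ⊆ range z := by rintro _ ⟨s, rfl⟩; exact ⟨μ + s, rfl⟩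
  have hsub1 : ∀ Ω, Disjoint Ω (range z) → Ω ⊆ N := fun Ω hd x hx hx' =>
    Set.disjoint_left.1 hd hx (hsub (image_subset_range _ _ hx'))
  have hz1 : ∀ x ∈ Ω1, W x = 0 := hzero Ω1 (-1) (Or.inr rfl) d.o1 d.pc1 (hsub1 _ d.dj1) (by
    filter_upwards [eventually_ge_atTop a] with R hR
    exact ha1 _ (by simpa using hR))
  have hz2 : ∀ x ∈ Ω2, W x = 0 := hzero Ω2 1 (Or.inl rfl) d.o2 d.pc2 (hsub1 _ d.dj2) (by
    filter_upwards [eventually_ge_atTop a] with R hR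
    exact ha2 _ (by simpa using hR))
  have hdense : Dense (Ω1 ∪ Ω2) := by
    have h1 : (Ω1 ∪ Ω2)ᶜ ⊆ range z := fun x hx => by
      have := d.un ▸ mem_univ x
      exact this.resolve_left hx
    rw [← compl_compl (Ω1 ∪ Ω2), ← interior_eq_empty_iff_dense_compl, ← subset_empty_iff]
    refine (interior_mono h1).trans ?_
    rw [← d.fr1, ← frontier_compl, interior_frontier d.o1.isClosed_compl]
  have hWN : ∀ x ∈ N, W x = 0 := by
    intro x hx
    have hfr := mem_closure_iff_frequently.1 (hdense x)
    have := IsClosed.mem_of_frequently_of_tendsto (isClosed_singleton (x := (0:ℂ)))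
      (hfr.mono fun y hy => (show W y ∈ ({0} : Set ℂ) from hy.elim (hz1 y) (hz2 y))) (hWd x hx).continuousAt.tendsto
    exact this
  -- contradiction with the jump
  have hjump := jumpLim hc0 hε0 hDc continuousAt_const hyc hL0 hL0 hb
  have hxe : ∀ ε : ℝ, ε ≠ 0 → |ε| ≤ ε0 → z μ + I * ε * z1 μ ∈ N := by
    rintro ε he hle ⟨s, hs, hs'⟩
    have h1 := (hb ε s hle hs).1
    have h2 : I * ε * z1 μ + (fun _ => 0) ε - D s = 0 := by
      simp only [hDdef, hs']; ring
    rw [h2, norm_zero] at h1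
    have := abs_pos.2 he
    have h3 : 0 < c0 * (|s| + |ε|) := by positivity
    linarith
  have hz : ∀ᶠ ε : ℝ in 𝓝[>] 0, (∫ s in (-L)..L, y s * (z1 μ / (I * ε * z1 μ + (fun _ => 0) ε - D s) -
      z1 μ / (I * (-ε : ℝ) * z1 μ + (fun _ => 0) (-ε) - D s))) = 0 := by
    have hev : ∀ᶠ ε : ℝ in 𝓝[>] 0, |ε| ≤ ε0 := by
      have h1 : ∀ᶠ ε : ℝ in 𝓝 0, |ε| ≤ ε0 := by
        filter_upwards [Metric.closedBall_mem_nhds (0:ℝ) hε0] with ε h; simpa using h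
      exact h1.filter_mono nhdsWithin_le_nhds
    filter_upwards [hev, self_mem_nhdsWithin] with ε h1 (h2 : 0 < ε)
    have e1 := hxe ε h2.ne' h1
    have e2 := hxe (-ε) (neg_ne_zero.2 h2.ne') (by rwa [abs_neg])
    have hi : ∀ x ∈ N, IntervalIntegrable (fun s => y s / (x - γ s)) volume (-L) L := fun x hx => by
      refine ContinuousOn.intervalIntegrable (ContinuousOn.div (by fun_prop) (by fun_prop) fun s hs => hxne x hx s (hLL ▸ hs))
    have e3 : z1 μ * (W (z μ + I * ε * z1 μ) - W (z μ + I * (-ε : ℝ) * z1 μ)) = 0 := by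
      rw [hWN _ e1, hWN _ e2]; simp
    refine Eq.trans ?_ e3
    simp only [hW]
    rw [← intervalIntegral.integral_sub (hi _ e1) (hi _ e2), ← intervalIntegral.integral_const_mul]
    refine intervalIntegral.integral_congr fun s _ => ?_
    have r1 : ∀ e : ℝ, z μ + I * e * z1 μ - γ s = I * e * z1 μ + 0 - (γ s - z μ) := fun e => by ring
    simp only [hDdef, r1]
    ring
  have := tendsto_nhds_unique (tendsto_const_nhds.congr' (hz.mono fun ε h => h.symm)) hjump
  have hy0 : y 0 ≠ 0 := h.ne _
  have : (2 * Real.pi * I * y 0 : ℂ) = 0 := by rw [← neg_eq_zero]; exact this.symm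
  simp [hy0, Real.pi_ne_zero] at this
end

section
open Topology Complex

def eI (x : ℂ) : ℂ := cexp (I * x)
def kap (x w : ℂ) : ℂ := (eI x + eI w) / (eI x - eI w)
def Cint (z y : ℝ → ℂ) (x : ℂ) : ℂ := (1 / (4 * Real.pi)) * ∫ β in (0:ℝ)..(2 * Real.pi), y β * kap x (z β)
def xe (z z1 : ℝ → ℂ) (ε α : ℝ) : ℂ := z α + I * ε * z1 α

theorem eI_ne (x : ℂ) : eI x ≠ 0 := exp_ne_zero _
theorem eI_cont : Continuous eI := by unfold eI; fun_prop
theorem eI_per (x : ℂ) : eI (x + 2 * Real.pi) = eI x := by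
  unfold eI; rw [mul_add, show I * (2 * (Real.pi:ℂ)) = 2 * Real.pi * I by ring, exp_periodic]
theorem eI_deriv (x : ℂ) : HasDerivAt eI (I * eI x) x := by
  have := ((hasDerivAt_id x).const_mul I).cexp
  refine (this.congr_deriv ?_ : HasDerivAt (fun x => cexp (I * x)) _ x)
  simp [eI, mul_comm]
theorem norm_eI (x : ℂ) : ‖eI x‖ = Real.exp (-x.im) := by simp [eI, norm_exp]
theorem eI_eq_iff {x w : ℂ} : eI x = eI w ↔ ∃ n : ℤ, x = w + n * (2 * Real.pi) := by
  unfold eI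
  rw [exp_eq_exp_iff_exists_int]
  refine exists_congr fun n => ?_
  rw [show I * w + n * (2 * Real.pi * I) = I * (w + n * (2 * Real.pi)) by ring]
  exact mul_right_inj' I_ne_zero
theorem kap_eq {x w : ℂ} (h : eI x - eI w ≠ 0) : kap x w = 2 * eI x / (eI x - eI w) - 1 := by
  unfold kap; field_simp; ring
theorem kap_per_left (x w : ℂ) : kap (x + 2 * Real.pi) w = kap x w := by simp [kap, eI_per]
theorem kap_per_right (x w : ℂ) : kap x (w + 2 * Real.pi) = kap x w := by simp [kap, eI_per]

theorem int_shift {f : ℝ → ℂ} (hp : ∀ α, f (α + 2 * Real.pi) = f α) (α : ℝ) :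
    ∫ β in (0:ℝ)..(2 * Real.pi), f β = ∫ s in (-Real.pi)..Real.pi, f (α + s) := by
  have h1 := Function.Periodic.intervalIntegral_add_eq (f := f) (T := 2 * Real.pi) hp 0 (α - Real.pi)
  rw [zero_add] at h1
  rw [h1, intervalIntegral.integral_comp_add_left]
  congr 1 <;> ring

theorem per_lower {f : ℝ → ℂ} (hf : Continuous f) (hp : ∀ α, f (α + 2 * Real.pi) = f α) (hne : ∀ α, f α ≠ 0) :
    ∃ m > 0, ∀ α, m ≤ ‖f α‖ := by
  obtain ⟨M, hM, hb⟩ := per_bound (f := fun α => (f α)⁻¹) (hf.inv₀ hne) (fun α => by simp only [hp])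
  refine ⟨M⁻¹, by positivity, fun α => ?_⟩
  have := hb α
  rw [norm_inv] at this
  exact inv_le_of_inv_le₀ (norm_pos_iff.2 (hne α)) this

/-- periodic reduction -/
theorem red (α : ℝ) : ∃ n : ℤ, α + n * (2 * Real.pi) ∈ Icc 0 (2 * Real.pi) := by
  obtain ⟨n, hn, -⟩ := existsUnique_add_zsmul_mem_Ico Real.two_pi_pos α 0
  exact ⟨n, by simpa using hn.1, by simpa using hn.2.le⟩

/-- the uniform kernel estimate -/
structure Geo (z z1 z2 : ℝ → ℂ) (c0 C ε0 : ℝ) : Prop extends Crv z z1 z2 where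
  c0p : 0 < c0
  Cp : 0 < C
  ep : 0 < ε0
  inj : ∀ α s, |s| < 2 * Real.pi → s ≠ 0 → eI (z (α + s)) ≠ eI (z α)
  low : ∀ α s ε, |s| ≤ Real.pi → |ε| ≤ ε0 → c0 * (|s| + |ε|) ≤ ‖eI (xe z z1 ε α) - eI (z (α + s))‖
  ker : ∀ α s ε, |s| ≤ Real.pi → |ε| ≤ ε0 → ‖z1 α * kap (xe z z1 ε α) (z (α + s)) + 2 * I / (I * ε - s)‖ ≤ C

theorem inj_of_embed {z z1 z2 : ℝ → ℂ} (h : Crv z z1 z2) (hi : Function.Injective z) :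
    ∀ α s, |s| < 2 * Real.pi → s ≠ 0 → eI (z (α + s)) ≠ eI (z α) := by
  intro α s hs h0 he
  obtain ⟨n, hn⟩ := eI_eq_iff.1 he
  rw [← h.perInt] at hn
  have := hi hn
  have h1 : s = n * (2 * Real.pi) := by linarith
  rw [h1, abs_mul, abs_of_pos Real.two_pi_pos] at hs
  have h2 : |(n:ℝ)| < 1 := by
    by_contra h3; push Not at h3; nlinarith [Real.two_pi_pos]
  have h3 : n = 0 := by
    have : |n| < 1 := by exact_mod_cast h2
    exact Int.abs_lt_one_iff.1 this
  simp [h3] at h1; exact h0 h1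

theorem geo {z z1 z2 : ℝ → ℂ} (h : Crv z z1 z2) (hi : Function.Injective z) :
    ∃ c0 C ε0, Geo z z1 z2 c0 C ε0 := by
  have hinj := inj_of_embed h hi
  have hpi := Real.pi_pos
  set Z : ℝ → ℂ := fun α => eI (z α) with hZ
  set Z1 : ℝ → ℂ := fun α => I * z1 α * Z α with hZ1
  set Z2 : ℝ → ℂ := fun α => I * z2 α * Z α + I * z1 α * Z1 α with hZ2
  have hZc : Continuous Z := eI_cont.comp h.cz
  have hZp : ∀ α, Z (α + 2 * Real.pi) = Z α := fun α => by simp only [hZ, h.per, eI_per]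
  have d0 : ∀ α, HasDerivAt Z (Z1 α) α := fun α => by
    have := (eI_deriv (z α)).comp α (h.d0 α)
    refine this.congr_deriv ?_
    simp only [hZ1, hZ]; ring
  have d1 : ∀ α, HasDerivAt Z1 (Z2 α) α := fun α => ((h.d1 α).const_mul I).mul (d0 α)
  have c1 : Continuous Z1 := (continuous_const.mul h.c1).mul hZc
  have c2 : Continuous Z2 := ((continuous_const.mul h.c2).mul hZc).add ((continuous_const.mul h.c1).mul c1)
  have p1 : ∀ α, Z1 (α + 2 * Real.pi) = Z1 α := fun α => by simp only [hZ1, h.per1, hZp]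
  have p2 : ∀ α, Z2 (α + 2 * Real.pi) = Z2 α := fun α => by simp only [hZ2, h.per1, h.per2, hZp, p1]
  obtain ⟨m, hm, hml⟩ := per_lower c1 p1 fun α => mul_ne_zero (mul_ne_zero I_ne_zero (h.ne α)) (eI_ne _)
  obtain ⟨P, hP, hPu⟩ := per_bound c1 p1
  obtain ⟨M, hM, hMu⟩ := per_bound c2 p2
  obtain ⟨Q, hQ, hQu⟩ := per_bound hZc hZp
  obtain ⟨R, hR, hRu⟩ := per_bound h.c1 h.per1
  have hT := fun α s => taylor2 d0 d1 hMu α s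
  obtain ⟨c, hc, hcD⟩ := chordExists (K := Icc 0 (2 * Real.pi)) isCompact_Icc (D := fun α s => Z (α + s) - Z α)
    (p := Z1) (L := Real.pi) (by fun_prop) hm hM hml hT
    (fun α s hs hsL => sub_ne_zero.2 (hinj α s (by linarith) hs))
  have hcD' : ∀ α s, |s| ≤ Real.pi → c * |s| ≤ ‖Z (α + s) - Z α‖ := by
    intro α s hs
    obtain ⟨n, hn⟩ := red α
    have := hcD _ hn s hs
    have e : ∀ a, Z (a + n * (2 * Real.pi)) = Z a := fun a =>
      (Function.Periodic.int_mul (f := Z) hZp n) a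
    rwa [e, add_right_comm, e] at this
  obtain ⟨C, hC, c0, hc0, ε1, hε1, hker⟩ := kerA m P (max M (Q * R ^ 2)) c hm hP (by positivity) hc
  set ε0 := min ε1 (1 / R) with hε0
  have key : ∀ α s ε, |s| ≤ Real.pi → |ε| ≤ ε0 → _ := fun α s ε hs he =>
    hker (Z1 α) (Z (α + s) - Z α) (eI (xe z z1 ε α) - Z α - I * ε * Z1 α) s ε (hml α) (hPu α)
      ((hT α s).trans (by gcongr; exact le_max_left _ _)) (hcD' α s hs) (by
        have e : eI (xe z z1 ε α) - Z α - I * ε * Z1 α = Z α * (cexp (-(ε * z1 α)) - 1 - (-(ε * z1 α))) := by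
          have : eI (xe z z1 ε α) = Z α * cexp (-(ε * z1 α)) := by
            simp only [hZ, eI, xe, ← exp_add]; congr 1; linear_combination (ε * z1 α) * I_mul_I
          rw [this]; simp only [hZ1]; linear_combination (-ε * z1 α * Z α) * I_mul_I
        have hle : ‖-(ε * z1 α : ℂ)‖ ≤ |ε| * R := by
          rw [norm_neg, norm_mul, norm_real, Real.norm_eq_abs]; gcongr; exact hRu α
        have h1 : |ε| * R ≤ 1 := by
          have : |ε| ≤ 1 / R := he.trans (min_le_right _ _)
          rwa [le_div_iff₀ hR] at this
        rw [e, norm_mul]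
        calc _ ≤ Q * (|ε| * R) ^ 2 := by
              gcongr
              · exact hQu α
              · exact (norm_exp_sub_one_sub_id_le (hle.trans h1)).trans (by gcongr)
          _ = (Q * R ^ 2) * ε ^ 2 := by rw [mul_pow, sq_abs]; ring
          _ ≤ _ := by gcongr; exact le_max_right _ _) (he.trans (min_le_left _ _))
  have hXZ : ∀ α ε, |ε| ≤ ε0 → ‖eI (xe z z1 ε α) - Z α‖ ≤ 2 * Q * R * |ε| := by
    intro α ε he
    have e : eI (xe z z1 ε α) - Z α = Z α * (cexp (-(ε * z1 α)) - 1) := by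
      have : eI (xe z z1 ε α) = Z α * cexp (-(ε * z1 α)) := by
        simp only [hZ, eI, xe, ← exp_add]; congr 1; linear_combination (ε * z1 α) * I_mul_I
      rw [this]; ring
    have hle : ‖-(ε * z1 α : ℂ)‖ ≤ |ε| * R := by
      rw [norm_neg, norm_mul, norm_real, Real.norm_eq_abs]; gcongr; exact hRu α
    have h1 : |ε| * R ≤ 1 := by
      have : |ε| ≤ 1 / R := he.trans (min_le_right _ _)
      rwa [le_div_iff₀ hR] at this
    rw [e, norm_mul]
    calc _ ≤ Q * (2 * (|ε| * R)) := by
          gcongr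
          · exact hQu α
          · exact (norm_exp_sub_one_le (hle.trans h1)).trans (by gcongr)
      _ = _ := by ring
  refine ⟨c0, R + 2 * C + 2 * (R * (2 * Q * R / c0)), ε0, ⟨h, hc0, by positivity, by positivity, hinj, ?_, ?_⟩⟩
  · intro α s ε hs he
    have := (key α s ε hs he).1
    convert this using 2
    ring
  · intro α s ε hs he
    obtain ⟨k1, k2⟩ := key α s ε hs he
    set X := eI (xe z z1 ε α) with hX
    rw [show I * ε * Z1 α + (X - Z α - I * ε * Z1 α) - (Z (α + s) - Z α) = X - Z (α + s) by ring] at k1 k2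
    by_cases h0 : s = 0 ∧ ε = 0
    · obtain ⟨rfl, rfl⟩ := h0
      have : X = Z α := by simp [hX, xe, hZ]
      simp only [kap, ← hX]
      rw [show eI (z (α + 0)) = X by rw [this, add_zero]]
      simp
      positivity
    have hpos : 0 < |s| + |ε| := by
      rcases not_and_or.1 h0 with h0 | h0
      · have := abs_pos.2 h0; positivity
      · have := abs_pos.2 h0; positivity
    have hne : X - Z (α + s) ≠ 0 := by
      rw [← norm_pos_iff]; exact lt_of_lt_of_le (by positivity) k1
    have hsum : z1 α * kap (xe z z1 ε α) (z (α + s)) + 2 * I / (I * ε - s) =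
        -z1 α - 2 * I * (Z1 α / (X - Z (α + s)) - 1 / (I * ε - s)) + 2 * (z1 α * ((X - Z α) / (X - Z (α + s)))) := by
      rw [kap_eq hne, ← hX]
      change z1 α * (2 * X / (X - Z (α + s)) - 1) + _ = _
      have : 2 * I * (Z1 α / (X - Z (α + s))) = - 2 * z1 α * Z α / (X - Z (α + s)) := by
        simp only [hZ1]; field_simp; rw [I_sq]; ring
      rw [mul_sub (2 * I), this]
      ring
    rw [hsum]
    have b1 : ‖(X - Z α) / (X - Z (α + s))‖ ≤ 2 * Q * R / c0 := by
      rw [norm_div, div_le_div_iff₀ (norm_pos_iff.2 hne) hc0]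
      have := hXZ α ε he
      calc _ ≤ 2 * Q * R * |ε| * c0 := by gcongr
        _ ≤ 2 * Q * R * (c0 * (|s| + |ε|)) := by
          rw [mul_assoc (2 * Q * R)]
          have : |ε| * c0 ≤ c0 * (|s| + |ε|) := by nlinarith [mul_nonneg hc0.le (abs_nonneg s)]
          gcongr
        _ ≤ _ := by gcongr
    refine (norm_add_le _ _).trans (add_le_add ((norm_sub_le _ _).trans (add_le_add ?_ ?_)) ?_)
    · rw [norm_neg]; exact hRu α
    · rw [norm_mul]; simp only [norm_mul, norm_I, Complex.norm_ofNat, mul_one]; gcongr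
    · rw [norm_mul, norm_mul, Complex.norm_ofNat]; gcongr; exact hRu α
end

section
open Topology Complex

theorem red2 (α β : ℝ) : ∃ (n : ℤ) (s : ℝ), |s| ≤ Real.pi ∧ β = α + s + n * (2 * Real.pi) := by
  obtain ⟨n, hn⟩ := red (β - α + Real.pi)
  refine ⟨-n, β - α + n * (2 * Real.pi), abs_le.2 ⟨by linarith [hn.1], by linarith [hn.2]⟩, by push_cast; ring⟩

theorem off_iff {z z1 z2 : ℝ → ℂ} (h : Crv z z1 z2) {x : ℂ} (hx : x ∉ range z) (β : ℝ) : eI x ≠ eI (z β) := by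
  intro he
  obtain ⟨n, hn⟩ := eI_eq_iff.1 he
  exact hx ⟨β + n * (2 * Real.pi), by rw [h.perInt, hn]⟩

def kapx (x w : ℂ) : ℂ := -2 * I * eI x * eI w / (eI x - eI w) ^ 2

theorem kap_dx {x w : ℂ} (h : eI x ≠ eI w) : HasDerivAt (fun x => kap x w) (kapx x w) x := by
  have h' := sub_ne_zero.2 h
  have := ((eI_deriv x).add_const (eI w)).fun_div ((eI_deriv x).sub_const (eI w)) h'
  refine this.congr_deriv ?_
  unfold kapx; field_simp; ring
theorem kap_dw {x w : ℂ} (h : eI x ≠ eI w) : HasDerivAt (fun w => kap x w) (-kapx x w) w := by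
  have h' := sub_ne_zero.2 h
  have := ((eI_deriv w).const_add (eI x)).fun_div ((eI_deriv w).const_sub (eI x)) h'
  refine this.congr_deriv ?_
  unfold kapx; field_simp; ring
theorem kap_cont {ι : Type*} [TopologicalSpace ι] {f g : ι → ℂ} {S : Set ι} (hf : ContinuousOn f S) (hg : ContinuousOn g S)
    (hne : ∀ q ∈ S, eI (f q) ≠ eI (g q)) : ContinuousOn (fun q => kap (f q) (g q)) S := by
  have h1 := eI_cont.comp_continuousOn hf
  have h2 := eI_cont.comp_continuousOn hg
  exact (h1.add h2).div (h1.sub h2) fun q hq => sub_ne_zero.2 (hne q hq)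
theorem kapx_cont {ι : Type*} [TopologicalSpace ι] {f g : ι → ℂ} {S : Set ι} (hf : ContinuousOn f S) (hg : ContinuousOn g S)
    (hne : ∀ q ∈ S, eI (f q) ≠ eI (g q)) : ContinuousOn (fun q => kapx (f q) (g q)) S := by
  have h1 := eI_cont.comp_continuousOn hf
  have h2 := eI_cont.comp_continuousOn hg
  exact ((continuousOn_const.mul h1).mul h2).div ((h1.sub h2).pow 2) fun q hq => pow_ne_zero _ (sub_ne_zero.2 (hne q hq))

theorem kap_far {s : ℝ} (hs : s = 1 ∨ s = -1) {x w : ℂ} (h : 0 < s * (x.im - w.im)) :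
    eI x ≠ eI w ∧ ‖kap x w + s‖ ≤ 2 / (Real.exp (s * (x.im - w.im)) - 1) := by
  have hX := norm_eI x
  have hW := norm_eI w
  have hne : eI x - eI w ≠ 0 := by
    intro h0
    have := congrArg norm (sub_eq_zero.1 h0)
    rw [hX, hW, Real.exp_eq_exp] at this
    have h1 : x.im - w.im = 0 := by linarith
    rw [h1] at h; simp at h
  refine ⟨sub_ne_zero.1 hne, ?_⟩
  have hgt : 0 < Real.exp (s * (x.im - w.im)) - 1 := by
    have := Real.add_one_lt_exp h.ne'; linarith
  rcases hs with rfl | rfl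
  · have e : kap x w + (1:ℝ) = 2 * eI x / (eI x - eI w) := by rw [kap_eq hne]; simp
    rw [e, norm_div, div_le_div_iff₀ (norm_pos_iff.2 hne) hgt, norm_mul, Complex.norm_ofNat, mul_assoc]
    gcongr
    have h1 := norm_sub_norm_le (eI w) (eI x)
    rw [norm_sub_rev] at h1
    refine le_trans (le_of_eq ?_) h1
    rw [hX, hW, mul_sub, ← Real.exp_add]; ring_nf
  · have e : kap x w + (-1:ℝ) = 2 * eI w / (eI x - eI w) := by rw [kap_eq hne]; field_simp; push_cast; ring
    rw [e, norm_div, div_le_div_iff₀ (norm_pos_iff.2 hne) hgt, norm_mul, Complex.norm_ofNat, mul_assoc]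
    gcongr
    have h1 := norm_sub_norm_le (eI x) (eI w)
    refine le_trans (le_of_eq ?_) h1
    rw [hX, hW, mul_sub, ← Real.exp_add]; ring_nf

section
variable {z z1 z2 : ℝ → ℂ} (h : Crv z z1 z2)
include h

theorem z_im_bdd : ∃ H > 0, ∀ β, |(z β).im| ≤ H := by
  obtain ⟨M, hM, hb⟩ := per_bound (f := fun a => z a - a) (by have := h.cz; fun_prop) (fun α => by rw [h.per]; push_cast; ring)
  refine ⟨M, hM, fun β => ?_⟩
  have := (abs_im_le_norm _).trans (hb β)
  simpa using this

theorem Cint_shift {y : ℝ → ℂ} (hp : ∀ α, y (α + 2 * Real.pi) = y α) (x : ℂ) (α : ℝ) :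
    Cint z y x = (1 / (4 * Real.pi)) * ∫ s in (-Real.pi)..Real.pi, y (α + s) * kap x (z (α + s)) := by
  unfold Cint
  rw [int_shift (f := fun β => y β * kap x (z β)) (fun α => by simp only [hp, h.per, kap_per_right]) α]

theorem Cint_deriv {y : ℝ → ℂ} (hy : Continuous y) {x : ℂ} (hx : x ∉ range z) (hcl : IsClosed (range z)) :
    HasDerivAt (Cint z y) ((1 / (4 * Real.pi)) * ∫ β in (0:ℝ)..(2 * Real.pi), y β * kapx x (z β)) x := by
  refine HasDerivAt.const_mul _ ?_
  have hz := h.cz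
  refine hasDerivAt_param (F := fun x β => y β * kap x (z β)) (F' := fun x β => y β * kapx x (z β)) hcl.isOpen_compl ?_ ?_ ?_ hx
  · intro w hw s _
    exact (kap_dx (off_iff h hw s)).const_mul _
  · exact ContinuousOn.mul (by fun_prop) (kap_cont (by fun_prop) (by fun_prop) fun q hq => off_iff h hq.1 _)
  · exact ContinuousOn.mul (by fun_prop) (kapx_cont (by fun_prop) (by fun_prop) fun q hq => off_iff h hq.1 _)

theorem Cint_one_deriv {x : ℂ} (hx : x ∉ range z) (hcl : IsClosed (range z)) :
    HasDerivAt (Cint z z1) 0 x := by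
  have h1 := Cint_deriv h h.c1 hx hcl
  have h2 : ∫ β in (0:ℝ)..(2 * Real.pi), z1 β * kapx x (z β) = -kap x (z (2 * Real.pi)) - -kap x (z 0) := by
    refine intervalIntegral.integral_eq_sub_of_hasDerivAt (f := fun β => -kap x (z β)) ?_ ?_
    · intro s _
      have := ((kap_dw (off_iff h hx s)).comp s (h.d0 s)).fun_neg
      refine this.congr_deriv (by ring)
    · refine Continuous.intervalIntegrable ?_ _ _
      rw [← continuousOn_univ]
      exact h.c1.continuousOn.mul (kapx_cont continuousOn_const h.cz.continuousOn fun q _ => off_iff h hx q)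
  rw [h2, show z (2 * Real.pi) = z 0 + 2 * Real.pi by rw [← h.per]; simp, kap_per_right] at h1
  simpa using h1

theorem Cint_inf {y : ℝ → ℂ} (hy : Continuous y) {s : ℝ} (hs : s = 1 ∨ s = -1) {δ : ℝ} (hδ : 0 < δ) :
    ∃ R, ∀ x : ℂ, R ≤ s * x.im → ‖Cint z y x + s * ((1 / (4 * Real.pi)) * ∫ β in (0:ℝ)..(2 * Real.pi), y β)‖ ≤ δ := by
  obtain ⟨H, hH, hHb⟩ := z_im_bdd h
  obtain ⟨B, hB⟩ := isCompact_Icc.exists_bound_of_continuousOn (hy.continuousOn (s := Icc 0 (2 * Real.pi)))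
  have hpi := Real.pi_pos
  have hB0 : 0 ≤ B := (norm_nonneg _).trans (hB 0 ⟨le_rfl, by positivity⟩)
  have ht : Tendsto (fun R : ℝ => B * (2 / (Real.exp (R - H) - 1))) atTop (𝓝 0) := by
    have h1 : Tendsto (fun R : ℝ => Real.exp (R - H) - 1) atTop atTop :=
      tendsto_atTop_add_const_right _ (-1) (Real.tendsto_exp_atTop.comp (tendsto_atTop_add_const_right _ (-H) tendsto_id))
    simpa using (tendsto_const_nhds.div_atTop h1).const_mul B
  obtain ⟨R0, hR0⟩ := eventually_atTop.1 (ht.eventually (ge_mem_nhds hδ))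
  refine ⟨max R0 (H + 1), fun x hx => ?_⟩
  have hx1 : H + 1 ≤ s * x.im := (le_max_right _ _).trans hx
  have hx2 := hR0 _ ((le_max_left _ _).trans hx)
  have hd : ∀ β, s * x.im - H ≤ s * (x.im - (z β).im) := by
    intro β
    have := abs_le.1 (hHb β)
    rcases hs with rfl | rfl <;> linarith
  have hne : ∀ β, eI x ≠ eI (z β) := fun β => (kap_far hs (by linarith [hd β])).1
  have hi : IntervalIntegrable (fun β => y β * kap x (z β)) volume 0 (2 * Real.pi) := by
    refine Continuous.intervalIntegrable ?_ _ _
    rw [← continuousOn_univ]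
    exact hy.continuousOn.mul (kap_cont continuousOn_const h.cz.continuousOn fun q _ => hne q)
  have e : Cint z y x + s * ((1 / (4 * Real.pi)) * ∫ β in (0:ℝ)..(2 * Real.pi), y β) =
      (1 / (4 * Real.pi)) * ∫ β in (0:ℝ)..(2 * Real.pi), y β * (kap x (z β) + s) := by
    have hi2 : IntervalIntegrable (fun β => y β * (s:ℂ)) volume 0 (2 * Real.pi) :=
      (hy.mul (continuous_const (y := (s:ℂ)))).intervalIntegrable _ _
    simp only [mul_add]
    rw [intervalIntegral.integral_add hi hi2, intervalIntegral.integral_mul_const]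
    unfold Cint; ring
  rw [e]
  have hI : ‖∫ β in (0:ℝ)..(2 * Real.pi), y β * (kap x (z β) + s)‖ ≤ B * (2 / (Real.exp (s * x.im - H) - 1)) * |2 * Real.pi - 0| := by
    refine intervalIntegral.norm_integral_le_of_norm_le_const fun β hβ => ?_
    rw [uIoc_of_le (by positivity)] at hβ
    rw [norm_mul]
    refine mul_le_mul (hB β (Ioc_subset_Icc_self hβ)) ((kap_far hs (by linarith [hd β])).2.trans ?_) (norm_nonneg _) hB0
    have : 0 < Real.exp (s * x.im - H) - 1 := by have := Real.add_one_le_exp (s * x.im - H); linarith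
    gcongr
    exact hd β
  rw [norm_mul]
  have hn : ‖(1 / (4 * Real.pi) : ℂ)‖ = 1 / (4 * Real.pi) := by
    rw [norm_div, norm_mul]; simp [abs_of_pos hpi]
  rw [hn]
  rw [sub_zero, abs_of_pos (by positivity)] at hI
  calc _ ≤ 1 / (4 * Real.pi) * (δ * (2 * Real.pi)) := by gcongr; exact hI.trans (by gcongr)
    _ ≤ δ := by field_simp; linarith
end

theorem poisson_bd {ε : ℝ} (hε : 0 < ε) : ∫ s in (-Real.pi)..Real.pi, ε / (ε ^ 2 + s ^ 2) ≤ Real.pi := by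
  have : ∫ s in (-Real.pi)..Real.pi, ε / (ε ^ 2 + s ^ 2) = Real.arctan (Real.pi / ε) - Real.arctan (-Real.pi / ε) := by
    refine intervalIntegral.integral_eq_sub_of_hasDerivAt (f := fun s => Real.arctan (s / ε)) ?_ ?_
    · intro s _
      have := ((hasDerivAt_id s).div_const ε).arctan
      refine this.congr_deriv ?_
      simp; field_simp
    · refine Continuous.intervalIntegrable (continuous_const.div (by fun_prop) fun s => by positivity) _ _
  rw [this]
  linarith [Real.arctan_lt_pi_div_two (Real.pi / ε), Real.neg_pi_div_two_lt_arctan (-Real.pi / ε)]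

theorem sqrt_int : IntervalIntegrable (fun s : ℝ => 1 / Real.sqrt |s|) volume (-Real.pi) Real.pi := by
  have h1 : IntervalIntegrable (fun s : ℝ => 1 / Real.sqrt |s|) volume 0 Real.pi := by
    refine (intervalIntegral.intervalIntegrable_rpow' (r := -(1/2)) (a := 0) (b := Real.pi) (by norm_num)).congr ?_
    rw [uIoc_of_le Real.pi_pos.le]
    intro s hs
    simp only
    rw [abs_of_pos hs.1, Real.rpow_neg hs.1.le, Real.sqrt_eq_rpow, one_div, one_div]
  have h2 := (IntervalIntegrable.iff_comp_neg (by simp)).1 h1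
  simp only [abs_neg, neg_zero] at h2
  exact h2.symm.trans h1
end

section
open Topology Complex

def Bk (z z1 : ℝ → ℂ) (α ε s : ℝ) : ℂ := z1 α * kap (xe z z1 ε α) (z (α + s)) + 2 * I / (I * ε - s)
def Kop (z z1 : ℝ → ℂ) (y : ℝ → ℝ) (α : ℝ) : ℝ :=
  (1 / (4 * Real.pi)) * ∫ s in (-Real.pi)..Real.pi, y (α + s) * (z1 α * kap (z α) (z (α + s))).re

theorem ieps_inv (ε s : ℝ) : 2 * I / (I * ε - s) = ((2 * (ε / (ε ^ 2 + s ^ 2)) : ℝ) : ℂ) - I * ((2 * s / (ε ^ 2 + s ^ 2) : ℝ) : ℂ) := by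
  by_cases h : ε = 0 ∧ s = 0
  · simp [h.1, h.2]
  have h1 : (ε ^ 2 + s ^ 2 : ℝ) ≠ 0 := by
    rcases not_and_or.1 h with h | h <;> positivity
  have h2 : (I * ε - s : ℂ) ≠ 0 := by
    intro h0
    have e1 := congrArg re h0
    have e2 := congrArg im h0
    simp at e1 e2
    exact h ⟨e2, e1⟩
  have h3 : ((ε:ℂ) ^ 2 + (s:ℂ) ^ 2) ≠ 0 := by exact_mod_cast h1
  push_cast
  field_simp
  linear_combination ((ε:ℂ) * s) * I_sq

theorem xe_per {z z1 z2 : ℝ → ℂ} (h : Crv z z1 z2) (ε α : ℝ) : xe z z1 ε (α + 2 * Real.pi) = xe z z1 ε α + 2 * Real.pi := by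
  simp only [xe, h.per, h.per1]; ring

namespace Geo
variable {z z1 z2 : ℝ → ℂ} {c0 C ε0 : ℝ} (g : Geo z z1 z2 c0 C ε0)
include g

theorem off {ε : ℝ} (he : ε ≠ 0) (hle : |ε| ≤ ε0) (α β : ℝ) : eI (xe z z1 ε α) ≠ eI (z β) := by
  obtain ⟨n, s, hs, rfl⟩ := red2 α β
  have h1 := g.low α s ε hs hle
  have h2 : eI (z (α + s + n * (2 * Real.pi))) = eI (z (α + s)) := eI_eq_iff.2 ⟨n, g.toCrv.perInt n _⟩
  rw [h2]
  intro h3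
  rw [h3, sub_self, norm_zero] at h1
  have := abs_pos.2 he
  have := g.c0p
  have : 0 < c0 * (|s| + |ε|) := by positivity
  linarith

theorem bkc {α ε : ℝ} (he : ε ≠ 0) (hle : |ε| ≤ ε0) : Continuous (Bk z z1 α ε) := by
  have hz := g.toCrv.cz
  unfold Bk
  refine Continuous.add (continuous_const.mul ?_) ?_
  · rw [← continuousOn_univ]
    exact kap_cont continuousOn_const (by fun_prop) fun q _ => g.off he hle _ _
  · refine continuous_const.div (by fun_prop) fun s h0 => he ?_
    have := congrArg im h0; simpa using this

theorem bk0 (α : ℝ) {s : ℝ} (hs : s ≠ 0) (hsp : |s| ≤ Real.pi) :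
    Tendsto (fun ε => Bk z z1 α ε s) (𝓝[≠] 0) (𝓝 (Bk z z1 α 0 s)) := by
  refine tendsto_nhdsWithin_of_tendsto_nhds ?_
  change ContinuousAt (fun ε => Bk z z1 α ε s) 0
  unfold Bk
  refine ContinuousAt.add (continuousAt_const.mul ?_) ?_
  · unfold kap
    have h1 : ContinuousAt (fun ε => eI (xe z z1 ε α)) 0 := (eI_cont.comp (by unfold xe; fun_prop)).continuousAt
    refine (h1.add continuousAt_const).div (h1.sub continuousAt_const) (sub_ne_zero.2 ?_)
    simp only [xe, ofReal_zero, mul_zero, zero_mul, add_zero]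
    exact (g.inj α s (by linarith [Real.pi_pos]) hs).symm
  · refine continuousAt_const.div (by fun_prop) fun h0 => hs ?_
    simpa using h0

theorem evle : ∀ᶠ ε : ℝ in 𝓝[≠] 0, |ε| ≤ ε0 ∧ ε ≠ 0 := by
  have h1 : ∀ᶠ ε : ℝ in 𝓝 0, |ε| ≤ ε0 := by
    filter_upwards [Metric.closedBall_mem_nhds (0:ℝ) g.ep] with ε h; simpa using h
  exact (h1.filter_mono nhdsWithin_le_nhds).and self_mem_nhdsWithin

theorem lim_reg {y : ℝ → ℂ} (hy : Continuous y) (α : ℝ) :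
    Tendsto (fun ε => ∫ s in (-Real.pi)..Real.pi, y (α + s) * Bk z z1 α ε s) (𝓝[≠] 0)
      (𝓝 (∫ s in (-Real.pi)..Real.pi, y (α + s) * Bk z z1 α 0 s)) := by
  have hpi := Real.pi_pos
  obtain ⟨B, hB⟩ := (isCompact_Icc (a := -Real.pi) (b := Real.pi)).exists_bound_of_continuousOn
    ((hy.comp (continuous_const.add continuous_id) : Continuous fun s => y (α + s)).continuousOn)
  refine intervalIntegral.tendsto_integral_filter_of_dominated_convergence (fun _ => B * C) ?_ ?_ (by simp) ?_
  · filter_upwards [g.evle] with ε he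
    exact ((hy.comp (continuous_const.add continuous_id)).mul (g.bkc he.2 he.1)).aestronglyMeasurable
  · filter_upwards [g.evle] with ε he
    refine Eventually.of_forall fun s hs => ?_
    rw [uIoc_of_le (by linarith)] at hs
    have hs' := Ioc_subset_Icc_self hs
    rw [norm_mul]
    exact mul_le_mul (hB s hs') (g.ker α s ε (abs_le.2 hs') he.1) (norm_nonneg _) ((norm_nonneg _).trans (hB s hs'))
  · have h0 : ∀ᵐ s : ℝ, s ≠ 0 := by simp [ae_iff]
    filter_upwards [h0] with s hs hsm
    rw [uIoc_of_le (by linarith)] at hsm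
    exact (g.bk0 α hs (abs_le.2 (Ioc_subset_Icc_self hsm))).const_mul _

theorem decomp {y : ℝ → ℂ} (hy : Continuous y) (hp : ∀ α, y (α + 2 * Real.pi) = y α) (α : ℝ) {ε : ℝ} (he : ε ≠ 0) (hle : |ε| ≤ ε0) :
    4 * Real.pi * (z1 α * Cint z y (xe z z1 ε α)) = (∫ s in (-Real.pi)..Real.pi, y (α + s) * Bk z z1 α ε s)
      - 2 * (∫ s in (-Real.pi)..Real.pi, y (α + s) * ((ε / (ε ^ 2 + s ^ 2) : ℝ) : ℂ))
      + 2 * I * (∫ s in (-Real.pi)..Real.pi, y (α + s) * ((s / (ε ^ 2 + s ^ 2) : ℝ) : ℂ)) := by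
  have hy' : Continuous fun s => y (α + s) := hy.comp (continuous_const.add continuous_id)
  have hq : ∀ s : ℝ, ε ^ 2 + s ^ 2 ≠ 0 := fun s => by positivity
  have i1 : IntervalIntegrable (fun s => y (α + s) * Bk z z1 α ε s) volume (-Real.pi) Real.pi :=
    (hy'.mul (g.bkc he hle)).intervalIntegrable _ _
  have i2 : IntervalIntegrable (fun s => 2 * (y (α + s) * ((ε / (ε ^ 2 + s ^ 2) : ℝ) : ℂ))) volume (-Real.pi) Real.pi :=
    (continuous_const.mul (hy'.mul (continuous_ofReal.comp (continuous_const.div (by fun_prop) hq)))).intervalIntegrable _ _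
  have i3 : IntervalIntegrable (fun s => 2 * I * (y (α + s) * ((s / (ε ^ 2 + s ^ 2) : ℝ) : ℂ))) volume (-Real.pi) Real.pi :=
    (continuous_const.mul (hy'.mul (continuous_ofReal.comp (continuous_id.div (by fun_prop) hq)))).intervalIntegrable _ _
  rw [Cint_shift g.toCrv hp _ α, ← intervalIntegral.integral_const_mul (2:ℂ), ← intervalIntegral.integral_const_mul (2 * I),
    ← intervalIntegral.integral_sub i1 i2, ← intervalIntegral.integral_add (i1.sub i2) i3]
  have : (4 * Real.pi : ℂ) ≠ 0 := by simp [Real.pi_ne_zero]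
  rw [show ∀ w : ℂ, 4 * Real.pi * (z1 α * (1 / (4 * Real.pi) * w)) = z1 α * w by intro w; field_simp,
    ← intervalIntegral.integral_const_mul]
  refine intervalIntegral.integral_congr fun s _ => ?_
  simp only [Bk, ieps_inv]
  push_cast
  ring

theorem lim_side {y : ℝ → ℝ} (hy : Continuous y) (hp : ∀ α, y (α + 2 * Real.pi) = y α) (α : ℝ) {σ : ℝ} (hσ : σ = 1 ∨ σ = -1) :
    Tendsto (fun ε : ℝ => (z1 α * Cint z (fun β => (y β : ℂ)) (xe z z1 (σ * ε) α)).re) (𝓝[>] 0)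
      (𝓝 (-σ / 2 * y α + Kop z z1 y α)) := by
  have hpi := Real.pi_pos
  have hyc : Continuous fun β => (y β : ℂ) := continuous_ofReal.comp hy
  have hypc : ∀ α, (y (α + 2 * Real.pi) : ℂ) = y α := fun α => by rw [hp]
  have ht : Tendsto (fun ε : ℝ => σ * ε) (𝓝[>] 0) (𝓝[≠] 0) := by
    rcases hσ with rfl | rfl
    · simpa using tendsto_id_gt
    · simpa using tendsto_neg_gt
  have h1 := (g.lim_reg hyc α).comp ht
  have h2 := poissonLim hpi hpi (y := fun s => (y (α + s) : ℂ)) (hyc.comp (continuous_const.add continuous_id))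
  have h3 := (Complex.continuous_re.tendsto _).comp ((h1.sub (h2.const_mul (2 * σ : ℂ))).const_mul (1 / (4 * Real.pi) : ℂ))
  have e3 : (1 / (4 * Real.pi) * ((∫ s in (-Real.pi)..Real.pi, (y (α + s) : ℂ) * Bk z z1 α 0 s) - 2 * σ * (Real.pi * (y (α + 0) : ℂ)))).re
      = -σ / 2 * y α + Kop z z1 y α := by
    have e4 : ∫ s in (-Real.pi)..Real.pi, (y (α + s) : ℂ) * Bk z z1 α 0 s =
        ∫ s in (-Real.pi)..Real.pi, (y (α + s) : ℂ) * Bk z z1 α 0 s := rfl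
    have e5 : (∫ s in (-Real.pi)..Real.pi, (y (α + s) : ℂ) * Bk z z1 α 0 s).re =
        ∫ s in (-Real.pi)..Real.pi, y (α + s) * (z1 α * kap (z α) (z (α + s))).re := by
      have hi : IntervalIntegrable (fun s => (y (α + s) : ℂ) * Bk z z1 α 0 s) volume (-Real.pi) Real.pi := by
        obtain ⟨B, hB⟩ := (isCompact_Icc (a := -Real.pi) (b := Real.pi)).exists_bound_of_continuousOn
          ((hyc.comp (continuous_const.add continuous_id) : Continuous fun s => (y (α + s) : ℂ)).continuousOn)
        have hm : AEStronglyMeasurable (fun s => (y (α + s) : ℂ) * Bk z z1 α 0 s) (volume.restrict (uIoc (-Real.pi) Real.pi)) := by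
          have hz := g.toCrv.cz
          refine AEStronglyMeasurable.mul (hyc.comp (continuous_const.add continuous_id)).aestronglyMeasurable ?_
          refine Measurable.aestronglyMeasurable ?_
          unfold Bk kap
          have := eI_cont.measurable.comp (hz.comp (continuous_const.add continuous_id) : Continuous fun s => z (α + s)).measurable
          have h' : Measurable fun s => eI (z (α + s)) := this
          fun_prop
        refine intervalIntegrable_const (c := B * C) |>.mono_fun hm ?_
        filter_upwards [ae_restrict_mem measurableSet_uIoc] with s hs
        rw [uIoc_of_le (by linarith)] at hs
        have hs' := Ioc_subset_Icc_self hs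
        rw [norm_mul]
        refine (mul_le_mul (hB s hs') (g.ker α s 0 (abs_le.2 hs') (by simpa using g.ep.le)) (norm_nonneg _) ((norm_nonneg _).trans (hB s hs'))).trans (le_abs_self _)
      have := (Complex.reCLM.intervalIntegral_comp_comm hi)
      refine Eq.trans this.symm ?_
      refine intervalIntegral.integral_congr fun s _ => ?_
      change ((y (α + s) : ℂ) * Bk z z1 α 0 s).re = _
      rw [re_ofReal_mul, Bk, ieps_inv]
      have hx0 : xe z z1 0 α = z α := by simp [xe]
      rw [hx0, add_re, sub_re, show ∀ r : ℝ, (I * (r:ℂ)).re = 0 by intro r; simp, ofReal_re]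
      simp
    rw [show (1 / (4 * Real.pi) : ℂ) = ((1 / (4 * Real.pi) : ℝ) : ℂ) by push_cast; ring, re_ofReal_mul, sub_re, e5,
      show (2 * σ * (Real.pi * (y (α + 0) : ℂ))) = ((2 * σ * (Real.pi * y α) : ℝ) : ℂ) by push_cast; simp, ofReal_re, mul_sub]
    unfold Kop
    field_simp
    ring
  rw [e3] at h3
  refine h3.congr' ?_
  filter_upwards [ht.eventually g.evle, self_mem_nhdsWithin] with ε he (hε : 0 < ε)
  have hd := g.decomp hyc hypc α he.2 he.1
  have hp4 : (4 * Real.pi : ℂ) ≠ 0 := by simp [Real.pi_ne_zero]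
  have hσ2 : σ ^ 2 = 1 := by rcases hσ with rfl | rfl <;> norm_num
  replace hd := (eq_div_iff hp4).2 ((mul_comm _ _).trans hd)
  rw [hd]
  simp only [Function.comp]
  have r1 : ∀ s : ℝ, (y (α + s) : ℂ) * ((σ * ε / ((σ * ε) ^ 2 + s ^ 2) : ℝ) : ℂ) = σ * ((y (α + s) : ℂ) * ((ε / (ε ^ 2 + s ^ 2) : ℝ) : ℂ)) := by
    intro s; rw [mul_pow, hσ2]; push_cast; ring
  simp only [r1]
  rw [intervalIntegral.integral_const_mul]
  have r2 : (∫ s in (-Real.pi)..Real.pi, (y (α + s) : ℂ) * ((s / ((σ * ε) ^ 2 + s ^ 2) : ℝ) : ℂ)) =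
      ((∫ s in (-Real.pi)..Real.pi, y (α + s) * (s / ((σ * ε) ^ 2 + s ^ 2)) : ℝ) : ℂ) := by
    rw [← intervalIntegral.integral_ofReal]; simp only [ofReal_mul]
  rw [r2]
  set J := ∫ s in (-Real.pi)..Real.pi, y (α + s) * (s / ((σ * ε) ^ 2 + s ^ 2))
  rw [show ∀ a b : ℂ, (a - 2 * (σ * b) + 2 * I * (J:ℂ)) / (4 * Real.pi) =
    1 / (4 * Real.pi) * (a - 2 * σ * b) + I * ((2 * J / (4 * Real.pi) : ℝ) : ℂ) by intro a b; push_cast; ring]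
  rw [add_re, show ∀ r : ℝ, (I * (r:ℂ)).re = 0 by intro r; simp, add_zero]

theorem jump {y : ℝ → ℂ} (hy : Continuous y) (hp : ∀ α, y (α + 2 * Real.pi) = y α) (α : ℝ) :
    Tendsto (fun ε : ℝ => z1 α * (Cint z y (xe z z1 ε α) - Cint z y (xe z z1 (-ε) α))) (𝓝[>] 0) (𝓝 (-y α)) := by
  have hpi := Real.pi_pos
  have h1 := g.lim_reg hy α
  have h2 := poissonLim hpi hpi (y := fun s => y (α + s)) (hy.comp (continuous_const.add continuous_id))
  have h3 := (((h1.comp tendsto_id_gt).sub (h1.comp tendsto_neg_gt)).sub (h2.const_mul 4)).const_mul (1 / (4 * Real.pi) : ℂ)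
  rw [sub_self, add_zero, show (1 / (4 * Real.pi) * (0 - 4 * (Real.pi * y α)) : ℂ) = - y α by field_simp; ring] at h3
  refine h3.congr' ?_
  filter_upwards [tendsto_id_gt.eventually g.evle, tendsto_neg_gt.eventually g.evle] with ε he hn
  have e1 := g.decomp hy hp α he.2 he.1
  have e2 := g.decomp hy hp α hn.2 hn.1
  simp only [neg_sq, neg_div] at e2
  have e3 : (∫ s in (-Real.pi)..Real.pi, y (α + s) * ((-(ε / (ε ^ 2 + s ^ 2)) : ℝ) : ℂ)) =
    - ∫ s in (-Real.pi)..Real.pi, y (α + s) * ((ε / (ε ^ 2 + s ^ 2) : ℝ) : ℂ) := by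
    rw [← intervalIntegral.integral_neg]; simp
  rw [e3] at e2
  have hp4 : (4 * Real.pi : ℂ) ≠ 0 := by simp [Real.pi_ne_zero]
  simp only [Function.comp]
  rw [mul_comm, mul_one_div, div_eq_iff hp4]
  linear_combination e2 - e1

theorem bdd_side {y : ℝ → ℝ} (hy : Continuous y) (hp : ∀ α, y (α + 2 * Real.pi) = y α) :
    ∃ B > 0, ∀ α ε : ℝ, ε ≠ 0 → |ε| ≤ ε0 → |(z1 α * Cint z (fun β => (y β : ℂ)) (xe z z1 ε α)).re| ≤ B := by
  have hpi := Real.pi_pos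
  have hyc : Continuous fun β => (y β : ℂ) := continuous_ofReal.comp hy
  have hypc : ∀ α, (y (α + 2 * Real.pi) : ℂ) = y α := fun α => by rw [hp]
  obtain ⟨Y, hY, hYb⟩ := per_bound hyc hypc
  have hC := g.Cp
  refine ⟨1 / (4 * Real.pi) * (Y * C * (2 * Real.pi) + 2 * (Y * Real.pi)), by positivity, fun α ε he hle => ?_⟩
  have hd := g.decomp hyc hypc α he hle
  have hp4 : (4 * Real.pi : ℂ) ≠ 0 := by simp [Real.pi_ne_zero]
  replace hd := (eq_div_iff hp4).2 ((mul_comm _ _).trans hd)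
  have r2 : (∫ s in (-Real.pi)..Real.pi, (y (α + s) : ℂ) * ((s / (ε ^ 2 + s ^ 2) : ℝ) : ℂ)) =
      ((∫ s in (-Real.pi)..Real.pi, y (α + s) * (s / (ε ^ 2 + s ^ 2)) : ℝ) : ℂ) := by
    rw [← intervalIntegral.integral_ofReal]; simp only [ofReal_mul]
  rw [hd, r2]
  set J := ∫ s in (-Real.pi)..Real.pi, y (α + s) * (s / (ε ^ 2 + s ^ 2))
  rw [show ∀ a b : ℂ, (a - 2 * b + 2 * I * (J:ℂ)) / (4 * Real.pi) =
    1 / (4 * Real.pi) * (a - 2 * b) + I * ((2 * J / (4 * Real.pi) : ℝ) : ℂ) by intro a b; push_cast; ring]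
  rw [add_re, show ∀ r : ℝ, (I * (r:ℂ)).re = 0 by intro r; simp, add_zero]
  refine (abs_re_le_norm _).trans ?_
  rw [norm_mul, show ‖(1 / (4 * Real.pi) : ℂ)‖ = 1 / (4 * Real.pi) by rw [norm_div, norm_mul]; simp [abs_of_pos hpi]]
  gcongr
  refine (norm_sub_le _ _).trans (add_le_add ?_ ?_)
  · refine (intervalIntegral.norm_integral_le_of_norm_le_const (C := Y * C) fun s hs => ?_).trans (le_of_eq ?_)
    · rw [uIoc_of_le (by linarith)] at hs
      rw [norm_mul]
      exact mul_le_mul (hYb _) (g.ker α s ε (abs_le.2 (Ioc_subset_Icc_self hs)) hle) (norm_nonneg _) hY.le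
    · rw [abs_of_pos (by linarith)]; ring
  · rw [norm_mul, Complex.norm_ofNat]
    gcongr
    have hpb := poisson_bd (abs_pos.2 he)
    calc _ ≤ ∫ s in (-Real.pi)..Real.pi, Y * (|ε| / (|ε| ^ 2 + s ^ 2)) := by
          refine intervalIntegral.norm_integral_le_of_norm_le (by linarith) (Eventually.of_forall fun s _ => ?_) ?_
          · rw [norm_mul, norm_real (ε / (ε ^ 2 + s ^ 2)), Real.norm_eq_abs, abs_div, abs_of_nonneg (by positivity : (0:ℝ) ≤ ε ^ 2 + s ^ 2), sq_abs]
            gcongr; exact hYb _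
          · refine Continuous.intervalIntegrable (continuous_const.mul (continuous_const.div (by fun_prop) fun s => ?_)) _ _
            have := abs_pos.2 he; positivity
      _ ≤ _ := by rw [intervalIntegral.integral_const_mul]; gcongr

theorem root {y : ℝ → ℂ} (hy : Continuous y) (hp : ∀ α, y (α + 2 * Real.pi) = y α) :
    ∃ B > 0, ∀ α ε : ℝ, ε ≠ 0 → |ε| ≤ ε0 → ‖Cint z y (xe z z1 ε α)‖ ≤ B / Real.sqrt |ε| := by
  have hpi := Real.pi_pos
  obtain ⟨Y, hY, hYb⟩ := per_bound hy hp
  obtain ⟨m, hm, hml⟩ := g.toCrv.lower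
  have hC := g.Cp
  have hep := g.ep
  set N := ∫ s in (-Real.pi)..Real.pi, 1 / Real.sqrt |s| with hN
  have hN0 : 0 ≤ N := intervalIntegral.integral_nonneg (by linarith) fun s _ => by positivity
  refine ⟨1 / (4 * Real.pi) * (Y / m * (C * (2 * Real.pi) * Real.sqrt ε0 + 2 * N)), by positivity, fun α ε he hle => ?_⟩
  have hε := abs_pos.2 he
  have hsq : 0 < Real.sqrt |ε| := Real.sqrt_pos.2 hε
  rw [Cint_shift g.toCrv hp _ α, norm_mul, show ‖(1 / (4 * Real.pi) : ℂ)‖ = 1 / (4 * Real.pi) by rw [norm_div, norm_mul]; simp [abs_of_pos hpi],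
    mul_div_assoc]
  gcongr
  have i0 : IntervalIntegrable (fun _ : ℝ => C) volume (-Real.pi) Real.pi := intervalIntegrable_const
  have i1 := sqrt_int.const_mul (2 / Real.sqrt |ε|)
  calc _ ≤ ∫ s in (-Real.pi)..Real.pi, Y / m * (C + 2 / Real.sqrt |ε| * (1 / Real.sqrt |s|)) := by
        refine intervalIntegral.norm_integral_le_of_norm_le (by linarith) ?_ ((i0.add i1).const_mul _)
        have h0 : ∀ᵐ s : ℝ, s ≠ 0 := by simp [ae_iff]
        filter_upwards [h0] with s hs0 hs
        have hk := g.ker α s ε (abs_le.2 (Ioc_subset_Icc_self hs)) hle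
        have hss : 0 < Real.sqrt |s| := Real.sqrt_pos.2 (abs_pos.2 hs0)
        have h2 : ‖2 * I / (I * ε - s)‖ ≤ 2 / Real.sqrt |ε| * (1 / Real.sqrt |s|) := by
          rw [norm_div, norm_mul, norm_I, Complex.norm_ofNat, mul_one, div_mul_div_comm, mul_one]
          refine div_le_div_of_nonneg_left (by norm_num) (by positivity) ?_
          rw [← Real.sqrt_mul hε.le, Complex.norm_def]
          refine Real.sqrt_le_sqrt ?_
          have : normSq (I * ε - s) = s ^ 2 + ε ^ 2 := by simp [normSq_apply]; ring
          rw [this, ← sq_abs s, ← sq_abs ε]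
          nlinarith [sq_nonneg (|s| - |ε|), abs_nonneg s, abs_nonneg ε]
        have h3 : ‖z1 α * kap (xe z z1 ε α) (z (α + s))‖ ≤ C + 2 / Real.sqrt |ε| * (1 / Real.sqrt |s|) := by
          have := norm_sub_le (z1 α * kap (xe z z1 ε α) (z (α + s)) + 2 * I / (I * ε - s)) (2 * I / (I * ε - s))
          rw [add_sub_cancel_right] at this
          linarith
        rw [norm_mul] at h3
        rw [norm_mul, div_mul_eq_mul_div, mul_div_assoc]
        refine mul_le_mul (hYb _) ?_ (norm_nonneg _) hY.le
        rw [le_div_iff₀ hm, mul_comm]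
        exact (mul_le_mul_of_nonneg_right (hml α) (norm_nonneg _)).trans h3
    _ = Y / m * (C * (2 * Real.pi) + 2 * N / Real.sqrt |ε|) := by
        rw [intervalIntegral.integral_const_mul, intervalIntegral.integral_add i0 i1, intervalIntegral.integral_const_mul, ← hN]
        simp; ring_nf; simp
    _ ≤ Y / m * (C * (2 * Real.pi) * Real.sqrt ε0 + 2 * N) / Real.sqrt |ε| := by
        rw [mul_div_assoc (Y / m), add_div]
        gcongr
        rw [le_div_iff₀ hsq]
        gcongr
end Geo
end

section
open Topology Complex

structure Side (z z1 z2 : ℝ → ℂ) (c0 C ε0 : ℝ) (Ω : Set ℂ) (s : ℝ) : Prop extends Geo z z1 z2 c0 C ε0 where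
  hs : s = 1 ∨ s = -1
  op : IsOpen Ω
  pc : IsPreconnected Ω
  sc : SimplyConnectedSpace Ω
  pΩ : ∀ x : ℂ, x + 2 * Real.pi ∈ Ω ↔ x ∈ Ω
  clr : IsClosed (range z)
  dj : ∀ x ∈ Ω, x ∉ range z
  col : ∀ α ε, 0 < ε → ε ≤ ε0 → xe z z1 (s * ε) α ∈ Ω
  inf : ∃ a, ∀ x : ℂ, a ≤ s * x.im → x ∈ Ω
  bd : ∃ a, ∀ x ∈ Ω, -a ≤ s * x.im
  cl : closure Ω = Ω ∪ range z
  near : ∃ m > 0, ∀ x ∈ Ω, ∀ β, ‖x - z β‖ ≤ m * ε0 → ∃ α r, 0 < r ∧ r ≤ ε0 ∧ m * r ≤ ‖x - z β‖ ∧ x = xe z z1 (s * r) α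
  one : ∀ x ∈ Ω, Cint z z1 x = -s / 2

theorem cre {f : ℝ → ℂ} {f' : ℂ} {x : ℝ} (h : HasDerivAt f f' x) : HasDerivAt (fun t => (f t).re) f'.re x :=
  reCLM.hasFDerivAt.comp_hasDerivAt x h
theorem cim {f : ℝ → ℂ} {f' : ℂ} {x : ℝ} (h : HasDerivAt f f' x) : HasDerivAt (fun t => (f t).im) f'.im x :=
  imCLM.hasFDerivAt.comp_hasDerivAt x h

theorem Crv.int1 {z z1 z2 : ℝ → ℂ} (h : Crv z z1 z2) : ∫ β in (0:ℝ)..(2 * Real.pi), z1 β = 2 * Real.pi := by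
  rw [intervalIntegral.integral_eq_sub_of_hasDerivAt (fun x _ => h.d0 x) (h.c1.intervalIntegrable _ _)]
  have := h.per 0
  rw [zero_add] at this
  rw [this]; ring

theorem one_val {z z1 z2 : ℝ → ℂ} (h : Crv z z1 z2) (hcl : IsClosed (range z)) {Ω : Set ℂ} (ho : IsOpen Ω) (hpc : IsPreconnected Ω)
    (hdj : ∀ x ∈ Ω, x ∉ range z) {s : ℝ} (hs : s = 1 ∨ s = -1) (hinf : ∃ a, ∀ x : ℂ, a ≤ s * x.im → x ∈ Ω) {x : ℂ} (hx : x ∈ Ω) :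
    Cint z z1 x = -s / 2 := by
  obtain ⟨a, ha⟩ := hinf
  have hpi := Real.pi_ne_zero
  have hss : s * s = 1 := by rcases hs with rfl | rfl <;> norm_num
  have key : ∀ δ > 0, ‖Cint z z1 x - (-s / 2)‖ ≤ δ := by
    intro δ hδ
    obtain ⟨R, hR⟩ := Cint_inf h h.c1 hs hδ
    set w : ℂ := ((s * max R a : ℝ) : ℂ) * I with hw
    have hwi : s * w.im = max R a := by rw [hw]; simp; rw [← mul_assoc, hss, one_mul]
    have hwΩ : w ∈ Ω := ha _ (by rw [hwi]; exact le_max_right _ _)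
    have e : Cint z z1 x = Cint z z1 w :=
      ho.is_const_of_deriv_eq_zero hpc (fun y hy => (Cint_one_deriv h (hdj y hy) hcl).differentiableAt.differentiableWithinAt)
        (fun y hy => (Cint_one_deriv h (hdj y hy) hcl).deriv) hx hwΩ
    have := hR w (by rw [hwi]; exact le_max_left _ _)
    rw [h.int1, ← e] at this
    convert this using 2
    have : (Real.pi : ℂ) ≠ 0 := by exact_mod_cast hpi
    field_simp
    ring
  have : ‖Cint z z1 x - (-s / 2)‖ ≤ 0 := le_of_forall_pos_le_add fun δ hδ => by simpa using key δ hδ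
  exact sub_eq_zero.1 (norm_le_zero_iff.1 this)

theorem near_pt {z z1 z2 : ℝ → ℂ} (h : Crv z z1 z2) (hcl : IsClosed (range z)) :
    ∃ m > 0, ∀ x β, ∃ α r, m * |r| ≤ ‖x - z β‖ ∧ x = xe z z1 r α := by
  obtain ⟨m, hm, hml⟩ := h.lower
  refine ⟨m, hm, fun x β => ?_⟩
  obtain ⟨w, ⟨α, rfl⟩, hw⟩ := hcl.exists_infDist_eq_dist (range_nonempty z) x
  have hmin : ∀ γ, ‖x - z α‖ ≤ ‖x - z γ‖ := fun γ => by
    have := Metric.infDist_le_dist_of_mem (x := x) (mem_range_self γ : z γ ∈ range z)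
    rwa [hw, dist_eq_norm, dist_eq_norm] at this
  have hre : HasDerivAt (fun γ => (x - z γ).re) (-(z1 α).re) α := by
    exact cre ((h.d0 α).const_sub x)
  have him : HasDerivAt (fun γ => (x - z γ).im) (-(z1 α).im) α := by
    exact cim ((h.d0 α).const_sub x)
  have hd := (hre.pow 2).add (him.pow 2)
  have hloc : IsLocalMin ((fun γ => (x - z γ).re) ^ 2 + (fun γ => (x - z γ).im) ^ 2) α := by
    refine Eventually.of_forall fun γ => ?_
    have h1 := hmin γ
    have h2 : ‖x - z α‖ ^ 2 ≤ ‖x - z γ‖ ^ 2 := by gcongr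
    rw [← normSq_eq_norm_sq, ← normSq_eq_norm_sq, normSq_apply, normSq_apply] at h2
    simp only [Pi.add_apply, Pi.pow_apply]
    linarith
  have h0 := hloc.hasDerivAt_eq_zero hd
  set r : ℝ := ((x - z α) / (z1 α)).im with hr
  have hq : (x - z α) / z1 α = I * r := by
    apply Complex.ext
    · simp only [mul_re, I_re, I_im, ofReal_re, ofReal_im, zero_mul, mul_zero, sub_zero]
      rw [div_re]
      have : normSq (z1 α) ≠ 0 := by simpa using h.ne α
      rw [← add_div, div_eq_zero_iff]; left
      norm_num at h0
      simp only [sub_re, sub_im]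
      linarith
    · simp [hr]
  have hx : x - z α = I * r * z1 α := by rw [← hq, div_mul_cancel₀ _ (h.ne α)]
  refine ⟨α, r, ?_, by rw [xe, ← hx]; ring⟩
  refine le_trans ?_ (hmin β)
  rw [hx, norm_mul, norm_mul, norm_I, one_mul, norm_real, Real.norm_eq_abs, mul_comm]
  gcongr
  exact hml α

theorem Geo.xe_off {z z1 z2 : ℝ → ℂ} {c0 C ε0 : ℝ} (g : Geo z z1 z2 c0 C ε0) {ε : ℝ} (he : ε ≠ 0) (hle : |ε| ≤ ε0) (α : ℝ) : xe z z1 ε α ∉ range z := by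
  rintro ⟨β, hβ⟩
  exact g.off he hle α β (by rw [hβ])

theorem collar_conn {z z1 z2 : ℝ → ℂ} {c0 C ε0 : ℝ} (g : Geo z z1 z2 c0 C ε0) {Ω1 Ω2 : Set ℂ} (d : Dom z Ω1 Ω2) {s : ℝ} (hs : s = 1 ∨ s = -1) :
    (∀ α ε, 0 < ε → ε ≤ ε0 → xe z z1 (s * ε) α ∈ Ω1) ∨ (∀ α ε, 0 < ε → ε ≤ ε0 → xe z z1 (s * ε) α ∈ Ω2) := by
  have hz := g.toCrv.cz
  have hz1 := g.toCrv.c1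
  have hpc : IsPreconnected ((fun q : ℝ × ℝ => xe z z1 (s * q.1) q.2) '' (Ioc 0 ε0 ×ˢ univ)) := by
    refine (isPreconnected_Ioc.prod isPreconnected_univ).image _ (Continuous.continuousOn ?_)
    unfold xe; fun_prop
  have habs : ∀ ε, |s * ε| = |ε| := fun ε => by rcases hs with rfl | rfl <;> simp
  have hne : s ≠ 0 := by rcases hs with rfl | rfl <;> norm_num
  have hsub : ((fun q : ℝ × ℝ => xe z z1 (s * q.1) q.2) '' (Ioc 0 ε0 ×ˢ univ)) ⊆ Ω1 ∪ Ω2 := by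
    rintro _ ⟨⟨ε, α⟩, ⟨hε, -⟩, rfl⟩
    have h1 := g.xe_off (mul_ne_zero hne hε.1.ne') (by rw [habs, abs_of_pos hε.1]; exact hε.2) α
    have h2 := d.un.ge (mem_univ (xe z z1 (s * ε) α))
    exact h2.resolve_right h1
  rcases hpc.subset_or_subset d.o1 d.o2 d.dj12 hsub with h | h
  · left; exact fun α ε h1 h2 => h ⟨(ε, α), ⟨⟨h1, h2⟩, trivial⟩, rfl⟩
  · right; exact fun α ε h1 h2 => h ⟨(ε, α), ⟨⟨h1, h2⟩, trivial⟩, rfl⟩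

theorem sides {z z1 z2 : ℝ → ℂ} {c0 C ε0 : ℝ} (g : Geo z z1 z2 c0 C ε0) {Ω1 Ω2 : Set ℂ} (d : Dom z Ω1 Ω2) :
    Side z z1 z2 c0 C ε0 Ω1 (-1) ∧ Side z z1 z2 c0 C ε0 Ω2 1 := by
  have hcl : IsClosed (range z) := d.fr1 ▸ isClosed_frontier
  obtain ⟨a, ha1, ha2⟩ := d.str
  have dj1 : ∀ x ∈ Ω1, x ∉ range z := fun x hx hr => Set.disjoint_left.1 d.dj1 hx hr
  have dj2 : ∀ x ∈ Ω2, x ∉ range z := fun x hx hr => Set.disjoint_left.1 d.dj2 hx hr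
  have i1 : ∃ a, ∀ x : ℂ, a ≤ (-1) * x.im → x ∈ Ω1 := ⟨a, fun x hx => ha1 x (by linarith)⟩
  have i2 : ∃ a, ∀ x : ℂ, a ≤ 1 * x.im → x ∈ Ω2 := ⟨a, fun x hx => ha2 x (by linarith)⟩
  have o1 : ∀ x ∈ Ω1, Cint z z1 x = -((-1:ℝ):ℂ) / 2 := fun x hx => one_val g.toCrv hcl d.o1 d.pc1 dj1 (Or.inr rfl) i1 hx
  have o2 : ∀ x ∈ Ω2, Cint z z1 x = -((1:ℝ):ℂ) / 2 := fun x hx => one_val g.toCrv hcl d.o2 d.pc2 dj2 (Or.inl rfl) i2 hx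
  have hep := g.ep
  have hj := g.jump g.toCrv.c1 g.toCrv.per1 0
  have hj' : Tendsto (fun ε : ℝ => z1 0 * (Cint z z1 (xe z z1 ε 0) - Cint z z1 (xe z z1 (-ε) 0))) (𝓝[>] 0) (𝓝 (-z1 0)) := hj
  have hev : ∀ᶠ ε : ℝ in 𝓝[>] 0, 0 < ε ∧ ε ≤ ε0 := by
    filter_upwards [Ioc_mem_nhdsGT hep] with ε he using he
  have contra : ∀ c : ℂ, c ≠ -1 → (∀ ε, 0 < ε → ε ≤ ε0 → Cint z z1 (xe z z1 ε 0) - Cint z z1 (xe z z1 (-ε) 0) = c) → False := by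
    intro c hc hall
    have h1 : Tendsto (fun ε : ℝ => z1 0 * (Cint z z1 (xe z z1 ε 0) - Cint z z1 (xe z z1 (-ε) 0))) (𝓝[>] 0) (𝓝 (z1 0 * c)) := by
      refine tendsto_const_nhds.congr' ?_
      filter_upwards [hev] with ε he
      rw [hall ε he.1 he.2]
    have := tendsto_nhds_unique h1 hj'
    apply hc
    have h3 := g.ne 0
    have : z1 0 * (c + 1) = 0 := by rw [mul_add, this]; ring
    rcases mul_eq_zero.1 this with h | h
    · exact absurd h h3
    · linear_combination h
  have cp := collar_conn g d (s := 1) (Or.inl rfl)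
  have cm := collar_conn g d (s := -1) (Or.inr rfl)
  simp only [one_mul, neg_one_mul] at cp cm
  have hcol : (∀ α ε, 0 < ε → ε ≤ ε0 → xe z z1 (-1 * ε) α ∈ Ω1) ∧ (∀ α ε, 0 < ε → ε ≤ ε0 → xe z z1 (1 * ε) α ∈ Ω2) := by
    simp only [one_mul, neg_one_mul]
    rcases cp with cp | cp <;> rcases cm with cm | cm
    · exact (contra 0 (by norm_num) fun ε h1 h2 => by rw [o1 _ (cp 0 ε h1 h2), o1 _ (cm 0 ε h1 h2), sub_self]).elim
    · exact (contra 1 (by norm_num) fun ε h1 h2 => by rw [o1 _ (cp 0 ε h1 h2), o2 _ (cm 0 ε h1 h2)]; push_cast; ring).elim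
    · exact ⟨cm, cp⟩
    · exact (contra 0 (by norm_num) fun ε h1 h2 => by rw [o2 _ (cp 0 ε h1 h2), o2 _ (cm 0 ε h1 h2), sub_self]).elim
  obtain ⟨m, hm, hnear⟩ := near_pt g.toCrv hcl
  have n0 : ∀ {r : ℝ} {x : ℂ} {β : ℝ}, m * |r| ≤ ‖x - z β‖ → ‖x - z β‖ ≤ m * ε0 → |r| ≤ ε0 := fun h1 h2 =>
    le_of_mul_le_mul_left (h1.trans h2) hm
  refine ⟨⟨g, Or.inr rfl, d.o1, d.pc1, d.sc1, d.p1, hcl, dj1, hcol.1, i1, ⟨a, fun x hx => ?_⟩, ?_, ⟨m, hm, fun x hx β hb => ?_⟩, o1⟩,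
    ⟨g, Or.inl rfl, d.o2, d.pc2, d.sc2, d.p2, hcl, dj2, hcol.2, i2, ⟨a, fun x hx => ?_⟩, ?_, ⟨m, hm, fun x hx β hb => ?_⟩, o2⟩⟩
  · by_contra hc
    exact Set.disjoint_left.1 d.dj12 hx (ha2 x (by linarith))
  · rw [← d.fr1, closure_eq_self_union_frontier]
  · obtain ⟨α, r, h1, rfl⟩ := hnear x β
    have h3 := n0 h1 hb
    rcases lt_trichotomy r 0 with h | rfl | h
    · rw [abs_of_neg h] at h1 h3
      exact ⟨α, -r, by linarith, h3, h1, by simp⟩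
    · exact (dj1 _ hx ⟨α, by simp [xe]⟩).elim
    · rw [abs_of_pos h] at h3
      have := hcol.2 α r h h3
      rw [one_mul] at this
      exact (Set.disjoint_left.1 d.dj12 hx this).elim
  · by_contra hc
    exact Set.disjoint_left.1 d.dj12 (ha1 x (by linarith)) hx
  · rw [← d.fr2, closure_eq_self_union_frontier]
  · obtain ⟨α, r, h1, rfl⟩ := hnear x β
    have h3 := n0 h1 hb
    rcases lt_trichotomy r 0 with h | rfl | h
    · rw [abs_of_neg h] at h3
      have := hcol.1 α (-r) (by linarith) h3
      rw [neg_one_mul, neg_neg] at this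
      exact (Set.disjoint_left.1 d.dj12 this hx).elim
    · exact (dj2 _ hx ⟨α, by simp [xe]⟩).elim
    · rw [abs_of_pos h] at h1 h3
      exact ⟨α, r, h, h3, h1, by simp⟩
end

section
open Topology Complex

structure Fld (Ω : Set ℂ) (s : ℝ) (f : ℂ → ℂ) : Prop where
  hol : DifferentiableOn ℂ f Ω
  per : ∀ x ∈ Ω, f (x + 2 * Real.pi) = f x
  con : ContinuousOn f (closure Ω)
  dec : ∃ b : ℕ → ℝ, Tendsto b atTop atTop ∧ Tendsto (fun k => ∫ r in (0:ℝ)..(2 * Real.pi), ‖f (r + I * (s * b k : ℝ))‖) atTop (𝓝 0)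

theorem xe_d {z z1 z2 : ℝ → ℂ} (h : Crv z z1 z2) (ε α : ℝ) : HasDerivAt (xe z z1 ε) (z1 α + I * ε * z2 α) α :=
  (h.d0 α).add ((h.d1 α).const_mul (I * ε))

theorem int_ind {P : ℂ → Prop} (h : ∀ x, P (x + 2 * Real.pi) ↔ P x) (n : ℤ) : ∀ x, P (x + n * (2 * Real.pi)) ↔ P x := by
  induction n using Int.induction_on with
  | zero => intro x; simp
  | succ n ih =>
    intro x
    rw [← ih x, ← h (x + (n:ℤ) * (2 * Real.pi)), show x + ((n + 1 : ℤ) : ℂ) * (2 * Real.pi) = x + (n:ℤ) * (2 * Real.pi) + 2 * Real.pi by push_cast; ring]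
  | pred n ih =>
    intro x
    rw [← ih x, ← h, show x + ((-n - 1 : ℤ) : ℂ) * (2 * Real.pi) + 2 * Real.pi = x + ((-n:ℤ):ℂ) * (2 * Real.pi) by push_cast; ring]

namespace Side
variable {z z1 z2 : ℝ → ℂ} {c0 C ε0 : ℝ} {Ω : Set ℂ} {s : ℝ} (S : Side z z1 z2 c0 C ε0 Ω s)
include S

theorem line_mem {a b : ℝ} (ha : ∀ x : ℂ, a ≤ s * x.im → x ∈ Ω) (hb : a ≤ b) (r : ℝ) : ((r : ℂ) + I * (s * b : ℝ)) ∈ Ω := by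
  apply ha
  have hss : s * s = 1 := by rcases S.hs with rfl | rfl <;> norm_num
  simp
  rw [← mul_assoc, hss, one_mul]; exact hb

theorem prim {f : ℂ → ℂ} (hf : DifferentiableOn ℂ f Ω) (hp : ∀ x ∈ Ω, f (x + 2 * Real.pi) = f x) :
    ∃ G k, (∀ x ∈ Ω, HasDerivAt G (f x) x) ∧ ∀ x ∈ Ω, G (x + 2 * Real.pi) = G x + k := by
  obtain ⟨G, hG⟩ := exists_primitive S.op S.sc hf
  have hd : ∀ x ∈ Ω, HasDerivAt (fun x => G (x + 2 * Real.pi) - G x) 0 x := fun x hx => by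
    have h1 := (hG (x + 2 * Real.pi) ((S.pΩ x).2 hx)).comp_add_const x (2 * Real.pi : ℂ)
    rw [hp x hx] at h1
    have h2 := h1.sub (hG x hx)
    rw [sub_self] at h2
    exact h2
  obtain ⟨k, hk⟩ := S.op.exists_is_const_of_deriv_eq_zero S.pc (fun x hx => (hd x hx).differentiableAt.differentiableWithinAt) (fun x hx => (hd x hx).deriv)
  exact ⟨G, k, hG, fun x hx => by rw [← hk x hx]; ring⟩

theorem pi0 {f : ℂ → ℂ} (hf : DifferentiableOn ℂ f Ω) (hp : ∀ x ∈ Ω, f (x + 2 * Real.pi) = f x) :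
    ∃ k, (∀ ε, 0 < ε → ε ≤ ε0 → ∫ β in (0:ℝ)..(2 * Real.pi), f (xe z z1 (s * ε) β) * (z1 β + I * (s * ε : ℝ) * z2 β) = k) ∧
      ∀ a b : ℝ, (∀ x : ℂ, a ≤ s * x.im → x ∈ Ω) → a ≤ b → ∫ r in (0:ℝ)..(2 * Real.pi), f (r + I * (s * b : ℝ)) = k := by
  obtain ⟨G, k, hG, hk⟩ := S.prim hf hp
  have hz1 := S.toCrv.c1
  have hz2 := S.toCrv.c2
  refine ⟨k, fun ε h0 h1 => ?_, fun a b ha hb => ?_⟩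
  · have hc : Continuous (xe z z1 (s * ε)) := continuous_iff_continuousAt.2 fun α => (xe_d S.toCrv _ α).continuousAt
    rw [intervalIntegral.integral_eq_sub_of_hasDerivAt (f := fun β => G (xe z z1 (s * ε) β))
      (fun β _ => (hG _ (S.col β ε h0 h1)).comp_of_eq (𝕜' := ℂ) β (xe_d S.toCrv _ β) rfl |> fun h => h)]
    · have := xe_per S.toCrv (s * ε) 0
      rw [zero_add] at this
      rw [this, hk _ (S.col 0 ε h0 h1)]; ring
    · refine Continuous.intervalIntegrable (Continuous.mul ?_ (by fun_prop)) _ _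
      exact hf.continuousOn.comp_continuous hc (fun β => S.col β ε h0 h1)
  · have hd : ∀ r : ℝ, HasDerivAt (fun r : ℝ => (r:ℂ) + I * (s * b : ℝ)) 1 r := fun r => (ofRealCLM.hasDerivAt).add_const _
    rw [intervalIntegral.integral_eq_sub_of_hasDerivAt (f := fun r : ℝ => G (r + I * (s * b : ℝ)))
      (fun r _ => by
        have := (hG _ (S.line_mem ha hb r)).comp_of_eq (𝕜' := ℂ) r (hd r) rfl
        rw [mul_one] at this
        exact this)]
    · have h1 := hk _ (S.line_mem ha hb 0)
      rw [show ((2 * Real.pi : ℝ) : ℂ) + I * (s * b : ℝ) = (((0:ℝ):ℂ) + I * (s * b : ℝ)) + 2 * Real.pi by push_cast; ring, h1]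
      ring
    · refine Continuous.intervalIntegrable ?_ _ _
      exact hf.continuousOn.comp_continuous (by fun_prop) (S.line_mem ha hb)

theorem pi1 {f : ℂ → ℂ} (hf : DifferentiableOn ℂ f Ω) (hp : ∀ x ∈ Ω, f (x + 2 * Real.pi) = f x) (hc : ContinuousOn f (closure Ω))
    {a b : ℝ} (ha : ∀ x : ℂ, a ≤ s * x.im → x ∈ Ω) (hb : a ≤ b) :
    ∫ β in (0:ℝ)..(2 * Real.pi), f (z β) * z1 β = ∫ r in (0:ℝ)..(2 * Real.pi), f (r + I * (s * b : ℝ)) := by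
  obtain ⟨k, h1, h2⟩ := S.pi0 hf hp
  rw [h2 a b ha hb]
  have hz := S.toCrv.cz
  have hz1 := S.toCrv.c1
  have hz2 := S.toCrv.c2
  have hmem : ∀ ε ∈ Icc 0 ε0, ∀ β, xe z z1 (s * ε) β ∈ closure Ω := by
    intro ε hε β
    rcases hε.1.eq_or_lt with rfl | h
    · rw [S.cl]; right; exact ⟨β, by simp [xe]⟩
    · exact subset_closure (S.col β ε h hε.2)
  have hcc : ContinuousOn (fun q : ℝ × ℝ => f (xe z z1 (s * q.1) q.2) * (z1 q.2 + I * (s * q.1 : ℝ) * z2 q.2)) (Icc 0 ε0 ×ˢ univ) := by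
    refine ContinuousOn.mul (hc.comp (Continuous.continuousOn (by unfold xe; fun_prop)) fun q hq => hmem q.1 hq.1 q.2) (Continuous.continuousOn (by fun_prop))
  obtain ⟨B, hB⟩ := ((isCompact_Icc (a := (0:ℝ)) (b := ε0)).prod (isCompact_Icc (a := (0:ℝ)) (b := 2 * Real.pi))).exists_bound_of_continuousOn
    (hcc.mono (prod_mono_right (subset_univ _)))
  have hpi := Real.pi_pos
  have hev : ∀ᶠ ε : ℝ in 𝓝[>] 0, ε ∈ Ioc 0 ε0 := Ioc_mem_nhdsGT S.ep
  have ht : Tendsto (fun ε : ℝ => ∫ β in (0:ℝ)..(2 * Real.pi), f (xe z z1 (s * ε) β) * (z1 β + I * (s * ε : ℝ) * z2 β)) (𝓝[>] 0)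
      (𝓝 (∫ β in (0:ℝ)..(2 * Real.pi), f (z β) * z1 β)) := by
    refine intervalIntegral.tendsto_integral_filter_of_dominated_convergence (fun _ => B) ?_ ?_ (by simp) ?_
    · filter_upwards [hev] with ε he
      refine Continuous.aestronglyMeasurable ?_
      exact hcc.comp_continuous (f := fun β : ℝ => (ε, β)) (by fun_prop) fun β => ⟨Ioc_subset_Icc_self he, trivial⟩
    · filter_upwards [hev] with ε he
      refine Eventually.of_forall fun β hβ => ?_
      rw [uIoc_of_le (by linarith)] at hβ
      exact hB (ε, β) ⟨Ioc_subset_Icc_self he, Ioc_subset_Icc_self hβ⟩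
    · refine Eventually.of_forall fun β hβ => ?_
      have h3 : ContinuousWithinAt (fun ε : ℝ => f (xe z z1 (s * ε) β) * (z1 β + I * (s * ε : ℝ) * z2 β)) (Icc 0 ε0) 0 :=
        (hcc.comp (f := fun ε : ℝ => (ε, β)) (by fun_prop) (fun ε he => ⟨he, trivial⟩)) 0 ⟨le_rfl, S.ep.le⟩
      have h4 := h3.tendsto
      simp only [mul_zero, ofReal_zero, zero_mul, add_zero, xe] at h4
      refine (h4.mono_left ?_)
      rw [← nhdsWithin_Ioc_eq_nhdsGT S.ep]
      exact nhdsWithin_mono _ Ioc_subset_Icc_self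
  refine tendsto_nhds_unique ht (tendsto_const_nhds.congr' ?_)
  filter_upwards [hev] with ε he
  rw [h1 ε he.1 he.2]

theorem rep_core {f h : ℂ → ℂ} (F : Fld Ω s f) (hh : DifferentiableOn ℂ h Ω) (hp : ∀ x ∈ Ω, h (x + 2 * Real.pi) = h x) (hc : ContinuousOn h (closure Ω))
    {x c : ℂ} (hx : ∀ β, eI x ≠ eI (z β)) (he : ∀ ζ ∈ closure Ω, eI x ≠ eI ζ → h ζ = (f ζ - c) * kap x ζ) :
    Cint z (fun β => f (z β) * z1 β) x - c * Cint z z1 x = -(c * s / 2) := by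
  have hpi := Real.pi_pos
  obtain ⟨a, ha⟩ := S.inf
  obtain ⟨b, hb, hd⟩ := F.dec
  have hz := S.toCrv.cz
  have hz1 := S.toCrv.c1
  have hss : s * s = 1 := by rcases S.hs with rfl | rfl <;> norm_num
  have hns : ‖(s:ℂ)‖ = 1 := by rcases S.hs with rfl | rfl <;> simp
  have hs' : -s = 1 ∨ -s = -1 := by rcases S.hs with rfl | rfl <;> simp
  have hzc : ∀ β, z β ∈ closure Ω := fun β => by rw [S.cl]; right; exact ⟨β, rfl⟩
  have hfz : Continuous fun β => f (z β) := F.con.comp_continuous hz hzc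
  have hkz : Continuous fun β => kap x (z β) := by
    rw [← continuousOn_univ]
    exact kap_cont continuousOn_const (by fun_prop) fun q _ => hx q
  have e1 : Cint z (fun β => f (z β) * z1 β) x - c * Cint z z1 x = 1 / (4 * Real.pi) * ∫ β in (0:ℝ)..(2 * Real.pi), h (z β) * z1 β := by
    unfold Cint
    rw [mul_left_comm, ← mul_sub, ← intervalIntegral.integral_const_mul, ← intervalIntegral.integral_sub]
    · congr 1
      refine intervalIntegral.integral_congr fun β _ => ?_
      simp only
      rw [he _ (hzc β) (hx β)]; ring
    · exact Continuous.intervalIntegrable ((hfz.mul hz1).mul hkz) _ _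
    · exact Continuous.intervalIntegrable (by fun_prop) _ _
  set L := ∫ β in (0:ℝ)..(2 * Real.pi), h (z β) * z1 β with hL
  have key : Tendsto (fun k => 2 * (∫ r in (0:ℝ)..(2 * Real.pi), ‖f (r + I * (s * b k : ℝ))‖) + (1 + ‖c‖) * (2 / (Real.exp (b k - s * x.im) - 1)) * (2 * Real.pi)) atTop (𝓝 (2 * 0 + (1 + ‖c‖) * 0 * (2 * Real.pi))) := by
    have h1 : Tendsto (fun k => b k - s * x.im) atTop atTop := tendsto_atTop_add_const_right _ _ hb
    have h2 : Tendsto (fun k => Real.exp (b k - s * x.im) - 1) atTop atTop := tendsto_atTop_add_const_right _ _ (Real.tendsto_exp_atTop.comp h1)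
    have h3 := (tendsto_const_nhds (x := (2:ℝ))).div_atTop h2
    exact (hd.const_mul 2).add ((h3.const_mul _).mul_const _)
  have hle : ‖L + c * s * (2 * Real.pi)‖ ≤ 2 * 0 + (1 + ‖c‖) * 0 * (2 * Real.pi) := by
    refine ge_of_tendsto key ?_
    filter_upwards [hb.eventually_ge_atTop (max a (s * x.im + 2))] with k hk
    have hka : a ≤ b k := (le_max_left _ _).trans hk
    have hkb : s * x.im + 2 ≤ b k := (le_max_right _ _).trans hk
    have hmem := S.line_mem ha hka
    rw [hL, S.pi1 hh hp hc ha hka]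
    set l : ℝ → ℂ := fun r => (r:ℂ) + I * (s * b k : ℝ) with hl
    have hlc : Continuous l := by rw [hl]; fun_prop
    have hfar : ∀ r, eI x ≠ eI (l r) ∧ ‖kap x (l r) - s‖ ≤ 2 / (Real.exp (b k - s * x.im) - 1) := fun r => by
      have e : -s * (x.im - (l r).im) = b k - s * x.im := by
        simp [hl]; linear_combination (b k) * hss
      have := kap_far hs' (x := x) (w := l r) (by rw [e]; linarith)
      rw [e] at this
      push_cast at this
      exact ⟨this.1, by simpa [sub_eq_add_neg] using this.2⟩
    have hE : 2 / (Real.exp (b k - s * x.im) - 1) ≤ 1 := by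
      have := Real.add_one_le_exp (b k - s * x.im)
      rw [div_le_one (by linarith)]; linarith
    set η := 2 / (Real.exp (b k - s * x.im) - 1)
    have hη : 0 ≤ η := (norm_nonneg _).trans (hfar 0).2
    have hflc : Continuous fun r => f (l r) := F.hol.continuousOn.comp_continuous hlc hmem
    have hklc : Continuous fun r => kap x (l r) := by
      rw [← continuousOn_univ]
      exact kap_cont continuousOn_const (by fun_prop) fun q _ => (hfar q).1
    have e2 : (∫ r in (0:ℝ)..(2 * Real.pi), h (l r)) + c * s * (2 * Real.pi) = ∫ r in (0:ℝ)..(2 * Real.pi), (f (l r) * kap x (l r) - c * (kap x (l r) - s)) := by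
      rw [show (c * s * (2 * Real.pi) : ℂ) = ∫ r in (0:ℝ)..(2 * Real.pi), c * s by simp; ring, ← intervalIntegral.integral_add]
      · refine intervalIntegral.integral_congr fun r _ => ?_
        rw [he _ (subset_closure (hmem r)) (hfar r).1]; ring
      · exact Continuous.intervalIntegrable (hh.continuousOn.comp_continuous hlc hmem) _ _
      · exact intervalIntegrable_const
    change ‖(∫ r in (0:ℝ)..(2 * Real.pi), h (l r)) + c * s * (2 * Real.pi)‖ ≤ _
    rw [e2]
    calc _ ≤ ∫ r in (0:ℝ)..(2 * Real.pi), (2 * ‖f (l r)‖ + (1 + ‖c‖) * η) := by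
          refine intervalIntegral.norm_integral_le_of_norm_le (by linarith) (Eventually.of_forall fun r _ => ?_) (Continuous.intervalIntegrable ((hflc.norm.const_mul 2).add continuous_const) _ _)
          refine (norm_sub_le _ _).trans (add_le_add ?_ ?_)
          · rw [norm_mul, mul_comm]
            gcongr
            have := norm_add_le (kap x (l r) - s) s
            rw [sub_add_cancel, hns] at this
            linarith [(hfar r).2]
          · rw [norm_mul]
            refine mul_le_mul (by linarith) (hfar r).2 (norm_nonneg _) (by positivity)
      _ = _ := by
          rw [intervalIntegral.integral_add (Continuous.intervalIntegrable (hflc.norm.const_mul 2) _ _) intervalIntegrable_const, intervalIntegral.integral_const_mul, intervalIntegral.integral_const, smul_eq_mul, sub_zero]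
          ring
  have hL0 : L + c * s * (2 * Real.pi) = 0 := norm_le_zero_iff.1 (by simpa using hle)
  rw [e1, eq_neg_of_add_eq_zero_left hL0]
  have : (Real.pi : ℂ) ≠ 0 := by exact_mod_cast hpi.ne'
  field_simp; ring

theorem pInt (n : ℤ) (x : ℂ) : x + n * (2 * Real.pi) ∈ Ω ↔ x ∈ Ω := int_ind S.pΩ n x

theorem pcl (x : ℂ) : x + 2 * Real.pi ∈ closure Ω ↔ x ∈ closure Ω := by
  rw [S.cl]
  refine or_congr (S.pΩ x) ⟨?_, ?_⟩
  · rintro ⟨β, hβ⟩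
    refine ⟨β - 2 * Real.pi, ?_⟩
    have := S.per (β - 2 * Real.pi)
    rw [sub_add_cancel, hβ] at this
    exact (add_right_cancel this).symm
  · rintro ⟨β, rfl⟩
    exact ⟨β + 2 * Real.pi, S.per β⟩

theorem pclInt (n : ℤ) (x : ℂ) : x + n * (2 * Real.pi) ∈ closure Ω ↔ x ∈ closure Ω := int_ind S.pcl n x

theorem rep_out {f : ℂ → ℂ} (F : Fld Ω s f) {x : ℂ} (hx : x ∉ closure Ω) : Cint z (fun β => f (z β) * z1 β) x = 0 := by
  have hne : ∀ ζ ∈ closure Ω, eI x ≠ eI ζ := by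
    intro ζ hζ h
    obtain ⟨n, rfl⟩ := eI_eq_iff.1 h
    exact hx ((S.pclInt n _).2 hζ)
  have hzc : ∀ β, z β ∈ closure Ω := fun β => by rw [S.cl]; right; exact ⟨β, rfl⟩
  have := S.rep_core (h := fun ζ => f ζ * kap x ζ) F ?_ ?_ ?_ (x := x) (c := 0) (fun β => hne _ (hzc β)) (fun ζ _ _ => by simp)
  · simpa using this
  · intro ζ hζ
    exact (F.hol ζ hζ).mul (kap_dw (hne ζ (subset_closure hζ))).differentiableAt.differentiableWithinAt
  · intro ζ hζ
    simp only [F.per ζ hζ, kap_per_right]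
  · exact F.con.mul (kap_cont continuousOn_const continuousOn_id fun q hq => hne q hq)

theorem rep_in {f : ℂ → ℂ} (F : Fld Ω s f) {x : ℂ} (hx : x ∈ Ω) : Cint z (fun β => f (z β) * z1 β) x = -s * f x := by
  classical
  have hz := S.toCrv.cz
  have hoff := off_iff S.toCrv (S.dj x hx)
  have hfp : ∀ n : ℤ, ∀ x ∈ Ω, f (x + n * (2 * Real.pi)) = f x := by
    intro n x hx
    refine ((int_ind (P := fun w => w ∈ Ω ∧ f w = f x) (fun w => ?_) n x).2 ⟨hx, rfl⟩).2
    rw [S.pΩ]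
    exact and_congr_right fun hw => by rw [F.per w hw]
  set h : ℂ → ℂ := fun ζ => if eI ζ = eI x then 2 * I * deriv f ζ else (f ζ - f x) * kap x ζ with hh
  have hdf : ∀ ζ ∈ Ω, DifferentiableAt ℂ f ζ := fun ζ hζ => F.hol.differentiableAt (S.op.mem_nhds hζ)
  have hev : ∀ ζ, eI ζ ≠ eI x → h =ᶠ[𝓝 ζ] fun ζ => (f ζ - f x) * kap x ζ := by
    intro ζ hζ
    have : ∀ᶠ w in 𝓝 ζ, eI w ≠ eI x := eI_cont.continuousAt.eventually_ne hζ
    filter_upwards [this] with w hw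
    simp [hh, hw]
  have hda : ∀ ζ ∈ Ω, DifferentiableAt ℂ h ζ := by
    intro ζ hζ
    by_cases hc : eI ζ = eI x
    · obtain ⟨n, hn⟩ := eI_eq_iff.1 hc
      have hfx : f ζ = f x := by rw [hn, hfp n x hx]
      have d1 : DifferentiableAt ℂ (dslope f ζ) ζ :=
        ((Complex.differentiableOn_dslope (S.op.mem_nhds hζ)).2 F.hol).differentiableAt (S.op.mem_nhds hζ)
      have d2 : DifferentiableAt ℂ (dslope eI ζ) ζ :=
        ((Complex.differentiableOn_dslope (univ_mem (f := 𝓝 ζ))).2 (fun w _ => (eI_deriv w).differentiableAt.differentiableWithinAt)).differentiableAt univ_mem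
      have hne : dslope eI ζ ζ ≠ 0 := by
        rw [dslope_same, (eI_deriv ζ).deriv]; exact mul_ne_zero I_ne_zero (eI_ne _)
      have d3 : DifferentiableAt ℂ (fun w => -(eI x + eI w) * dslope f ζ w / dslope eI ζ w) ζ :=
        (((eI_deriv ζ).differentiableAt.const_add _).neg.mul d1).div d2 hne
      refine d3.congr_of_eventuallyEq ?_
      filter_upwards [d2.continuousAt.eventually_ne hne] with w hw
      by_cases hwz : w = ζ
      · subst hwz
        simp only [hh, hc, if_true]
        rw [dslope_same, dslope_same, (eI_deriv w).deriv, hc]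
        have := eI_ne x
        field_simp
        linear_combination (2 * deriv f w) * I_sq
      · have hsl : (w - ζ) * dslope eI ζ w = eI w - eI x := by
          have := sub_smul_dslope eI ζ w
          rw [smul_eq_mul, hc] at this; exact this
        have hsf : (w - ζ) * dslope f ζ w = f w - f x := by
          have := sub_smul_dslope f ζ w
          rw [smul_eq_mul, hfx] at this; exact this
        have hw0 : w - ζ ≠ 0 := sub_ne_zero.2 hwz
        have hwx : eI w - eI x ≠ 0 := by rw [← hsl]; exact mul_ne_zero hw0 hw
        have hwx' : eI x - eI w ≠ 0 := by rw [← neg_sub]; exact neg_ne_zero.2 hwx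
        simp only [hh, if_neg (sub_ne_zero.1 hwx), kap]
        rw [← hsf]
        field_simp
        linear_combination ((eI x + eI w) * dslope f ζ w) * hsl
    · exact (((hdf ζ hζ).sub_const _).mul (kap_dw (Ne.symm hc)).differentiableAt).congr_of_eventuallyEq (hev ζ hc)
  have := S.rep_core (h := h) F (fun ζ hζ => (hda ζ hζ).differentiableWithinAt) ?_ ?_ (x := x) (c := f x) hoff ?_
  · rw [S.one x hx] at this
    linear_combination this
  · intro ζ hζ
    have e : deriv f (ζ + 2 * Real.pi) = deriv f ζ := by
      rw [← deriv_comp_add_const]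
      refine Filter.EventuallyEq.deriv_eq ?_
      filter_upwards [S.op.mem_nhds hζ] with w hw using F.per w hw
    simp only [hh, eI_per, F.per ζ hζ, kap_per_right, e]
  · rw [S.cl]
    rintro ζ (hζ | ⟨β, rfl⟩)
    · exact (hda ζ hζ).continuousAt.continuousWithinAt
    · have h1 := hev (z β) (hoff β).symm
      refine ContinuousWithinAt.congr_of_eventuallyEq ?_ (h1.filter_mono nhdsWithin_le_nhds) h1.self_of_nhds
      rw [← S.cl]
      have := F.con (z β) (by rw [S.cl]; right; exact ⟨β, rfl⟩)
      exact (this.sub continuousWithinAt_const).mul (kap_dw (hoff β)).continuousAt.continuousWithinAt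
  · intro ζ _ hne
    simp [hh, hne.symm]
end Side
end

section
open Topology Complex

namespace Side
variable {z z1 z2 : ℝ → ℂ} {c0 C ε0 : ℝ} {Ω : Set ℂ} {s : ℝ} (S : Side z z1 z2 c0 C ε0 Ω s)
include S

theorem sh (x : ℂ) : ∃ n : ℤ, (x + n * (2 * Real.pi)).re ∈ Icc 0 (2 * Real.pi) := by
  obtain ⟨n, hn⟩ := red x.re
  exact ⟨n, by simpa using hn⟩

/-- Phragmen-Lindelof -/
theorem pl {F G : ℂ → ℂ} {k : ℂ} (hG : ∀ x ∈ Ω, HasDerivAt G (F x) x) (hk : ∀ x ∈ Ω, G (x + 2 * Real.pi) = G x + k)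
    (hinf : ∀ δ > 0, ∃ R, ∀ x : ℂ, R ≤ s * x.im → ‖F x‖ ≤ δ) {c L : ℝ}
    (hb : ∀ α ε, 0 < ε → ε ≤ ε0 → |(G (xe z z1 (s * ε) α)).re - c| ≤ L * Real.sqrt ε) {τ : ℝ} (hτ : τ = 1 ∨ τ = -1)
    {x : ℂ} (hx : x ∈ Ω) : τ * ((G x).re - c) ≤ 0 := by
  have hpi := Real.pi_pos
  have hss : s * s = 1 := by rcases S.hs with rfl | rfl <;> norm_num
  have hτa : |τ| = 1 := by rcases hτ with rfl | rfl <;> simp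
  obtain ⟨a0, ha0⟩ := S.bd
  obtain ⟨ai, hai⟩ := S.inf
  set a := |a0| with ha_def
  have ha : ∀ x ∈ Ω, 0 ≤ s * x.im + a := fun x hx => by linarith [ha0 x hx, le_abs_self a0]
  have hL0 : 0 ≤ L := by
    have h1 := (abs_nonneg _).trans (hb 0 ε0 S.ep le_rfl)
    exact nonneg_of_mul_nonneg_left h1 (Real.sqrt_pos.2 S.ep)
  have hkre : k.re = 0 := by
    have h1 : ∀ ε, 0 < ε → ε ≤ ε0 → |k.re| ≤ 2 * L * Real.sqrt ε := fun ε h0 h1 => by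
      have e1 := hb 0 ε h0 h1
      have e2 := hb (0 + 2 * Real.pi) ε h0 h1
      rw [xe_per S.toCrv, hk _ (S.col 0 ε h0 h1), add_re] at e2
      rw [abs_le] at *
      constructor <;> linarith [e1.1, e1.2, e2.1, e2.2]
    have ht : Tendsto (fun ε => 2 * L * Real.sqrt ε) (𝓝[>] 0) (𝓝 (2 * L * Real.sqrt 0)) :=
      ((Real.continuous_sqrt.tendsto 0).const_mul _).mono_left nhdsWithin_le_nhds
    have h2 : |k.re| ≤ 2 * L * Real.sqrt 0 := by
      refine ge_of_tendsto ht ?_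
      filter_upwards [Ioc_mem_nhdsGT S.ep] with ε he using h1 ε he.1 he.2
    simpa using h2
  have main : ∀ δ > 0, ∀ x ∈ Ω, τ * ((G x).re - c) - δ * (s * x.im + a) ≤ 0 := by
    intro δ hδ x0 hx0
    by_contra hcon
    push Not at hcon
    set u : ℂ → ℝ := fun x => τ * ((G x).re - c) - δ * (s * x.im + a) with hu
    have hcon : 0 < u x0 := hcon
    have hup1 : ∀ x : ℂ, x + 2 * Real.pi ∈ Ω ∧ u (x + 2 * Real.pi) = u x ↔ x ∈ Ω := fun x => by
      rw [S.pΩ]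
      exact ⟨fun h => h.1, fun h => ⟨h, by simp [hu, hk x h, hkre]⟩⟩
    have hup : ∀ (n : ℤ), ∀ x ∈ Ω, x + n * (2 * Real.pi) ∈ Ω ∧ u (x + n * (2 * Real.pi)) = u x := by
      intro n x hx
      refine (int_ind (P := fun w => w ∈ Ω ∧ u w = u x) (fun w => ?_) n x).2 ⟨hx, rfl⟩
      constructor
      · rintro ⟨h1, h2⟩
        have h3 := (S.pΩ w).1 h1
        exact ⟨h3, by rw [← ((hup1 w).2 h3).2, h2]⟩
      · rintro ⟨h1, h2⟩
        exact ⟨(S.pΩ w).2 h1, by rw [((hup1 w).2 h1).2, h2]⟩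
    have huc : ContinuousOn u Ω := by
      have : ContinuousOn G Ω := fun x hx => (hG x hx).continuousAt.continuousWithinAt
      exact ((continuousOn_const.mul ((continuous_re.comp_continuousOn this).sub continuousOn_const)).sub (Continuous.continuousOn (by fun_prop)))
    -- growth
    obtain ⟨R', hR'⟩ : ∃ R', ∀ x ∈ Ω, R' ≤ s * x.im → u x ≤ 0 := by
      obtain ⟨R0, hR0⟩ := hinf (δ / 2) (by positivity)
      set R := max R0 ai with hR
      have hl := S.line_mem hai (le_max_right R0 ai)
      have hGl : Continuous fun r : ℝ => G (r + I * (s * R : ℝ)) :=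
        ContinuousOn.comp_continuous (s := Ω) (fun x hx => (hG x hx).continuousAt.continuousWithinAt) (by fun_prop) hl
      obtain ⟨B, hB⟩ := (isCompact_Icc (a := (0:ℝ)) (b := 2 * Real.pi)).exists_bound_of_continuousOn hGl.continuousOn
      set Q := B + |c| + δ / 2 * |R| with hQ
      refine ⟨max R (2 / δ * |Q|), fun x hx hxR => ?_⟩
      obtain ⟨n, hn⟩ := S.sh x
      rw [← (hup n x hx).2]
      have hyΩ := (hup n x hx).1
      have hyi : (x + n * (2 * Real.pi)).im = x.im := by simp
      set y := x + n * (2 * Real.pi) with hy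
      have hyR : R ≤ s * y.im := by rw [hyi]; exact (le_max_left _ _).trans hxR
      have hyQ : 2 / δ * |Q| ≤ s * y.im := by rw [hyi]; exact (le_max_right _ _).trans hxR
      have hconv : Convex ℝ {w : ℂ | R ≤ s * w.im} := by
        have : IsLinearMap ℝ (fun w : ℂ => s * w.im) := ⟨by intros; simp; ring, by intros; simp; ring⟩
        exact convex_halfSpace_ge this R
      have hp : ((y.re : ℂ) + I * (s * R : ℝ)) ∈ {w : ℂ | R ≤ s * w.im} := by
        simp; rw [← mul_assoc, hss, one_mul]
      have hd := hconv.norm_image_sub_le_of_norm_hasDerivWithin_le (f := G) (f' := F) (C := δ / 2)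
        (fun w hw => (hG w (hai w ((le_max_right _ _).trans hw))).hasDerivWithinAt)
        (fun w hw => hR0 w ((le_max_left _ _).trans hw)) hp hyR
      have hB' := hB y.re hn
      have hdist : ‖y - (y.re + I * (s * R : ℝ))‖ = s * y.im - R := by
        have : y - (y.re + I * (s * R : ℝ)) = I * ((s * (s * y.im - R) : ℝ) : ℂ) := by
          apply Complex.ext
          · simp
          · simp; linear_combination (-y.im) * hss
        rw [this, norm_mul, norm_I, one_mul, norm_real, Real.norm_eq_abs, abs_mul, abs_of_nonneg (by linarith : (0:ℝ) ≤ s * y.im - R)]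
        rcases S.hs with h | h <;> rw [h] <;> simp
      rw [hdist] at hd
      have h5 : ‖G y‖ ≤ B + δ / 2 * (s * y.im - R) := by
        have := norm_add_le (G y - G (y.re + I * (s * R : ℝ))) (G (y.re + I * (s * R : ℝ)))
        rw [sub_add_cancel] at this
        linarith
      have h6 : τ * ((G y).re - c) ≤ ‖G y‖ + |c| := by
        refine (le_abs_self _).trans ?_
        rw [abs_mul, hτa, one_mul]
        refine (abs_sub _ _).trans (by gcongr; exact abs_re_le_norm _)
      have h7 : |Q| ≤ δ / 2 * (s * y.im) := by
        rw [div_mul_eq_mul_div, div_le_iff₀ hδ] at hyQ; linarith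
      have h8 := le_abs_self Q
      have h9 : 0 ≤ δ * a := by positivity
      have h10 := neg_abs_le R
      change τ * ((G y).re - c) - δ * (s * y.im + a) ≤ 0
      nlinarith
    -- near boundary
    obtain ⟨η, hη, hηb⟩ : ∃ η > 0, ∀ x ∈ Ω, ∀ β, ‖x - z β‖ ≤ η → u x < u x0 := by
      obtain ⟨m, hm, hn⟩ := S.near
      have ht : Tendsto (fun ε => L * Real.sqrt ε) (𝓝[>] 0) (𝓝 (L * Real.sqrt 0)) :=
        ((Real.continuous_sqrt.tendsto 0).const_mul _).mono_left nhdsWithin_le_nhds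
      rw [Real.sqrt_zero, mul_zero] at ht
      obtain ⟨e, he1, he2⟩ := ((ht.eventually (gt_mem_nhds hcon)).and (Ioc_mem_nhdsGT S.ep)).exists
      refine ⟨m * e, mul_pos hm he2.1, fun x hx β hxb => ?_⟩
      obtain ⟨α, r, r0, r1, r2, rfl⟩ := hn x hx β (hxb.trans (by gcongr; exact he2.2))
      have hre : r ≤ e := le_of_mul_le_mul_left (r2.trans hxb) hm
      have h1 := hb α r r0 r1
      have h2 : τ * ((G (xe z z1 (s * r) α)).re - c) ≤ L * Real.sqrt r := by
        refine (le_abs_self _).trans ?_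
        rw [abs_mul, hτa, one_mul]; exact h1
      have h3 := mul_nonneg hδ.le (ha _ hx)
      have h4 : L * Real.sqrt r ≤ L * Real.sqrt e := by gcongr
      simp only [hu]
      simp only [hu] at he1
      linarith
    -- compact set
    set K : Set ℂ := {x | x ∈ Ω ∧ u x0 ≤ u x ∧ x.re ∈ Icc 0 (2 * Real.pi)} with hK
    have hKc : IsCompact K := by
      refine Metric.isCompact_of_isClosed_isBounded ?_ ?_
      · refine isClosed_of_closure_subset fun x hx => ?_
        have hxc : x ∈ Ω ∪ range z := by
          rw [← S.cl]; exact closure_mono (fun w hw => hw.1) hx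
        have hxr : x.re ∈ Icc 0 (2 * Real.pi) :=
          closure_minimal (fun w (hw : w ∈ K) => hw.2.2) (isClosed_Icc.preimage continuous_re) hx
        rcases hxc with hxΩ | ⟨β, rfl⟩
        · refine ⟨hxΩ, ?_, hxr⟩
          by_contra hlt
          push Not at hlt
          have hev : ∀ᶠ w in 𝓝 x, u w < u x0 := ((huc.continuousAt (S.op.mem_nhds hxΩ)).eventually_lt continuousAt_const hlt)
          obtain ⟨w, hw1, hw2⟩ := (mem_closure_iff_frequently.1 hx).and_eventually hev |>.exists
          exact absurd hw1.2.1 (not_le.2 hw2)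
        · obtain ⟨w, hw1, hw2⟩ := Metric.mem_closure_iff.1 hx η hη
          rw [dist_comm, dist_eq_norm] at hw2
          exact absurd hw1.2.1 (not_le.2 (hηb w hw1.1 β hw2.le))
      · refine (Metric.isBounded_closedBall (x := (0:ℂ)) (r := 2 * Real.pi + (a + |R'|))).subset fun x hx => ?_
        rw [mem_closedBall_zero_iff]
        refine (Complex.norm_le_abs_re_add_abs_im x).trans (add_le_add ?_ ?_)
        · rw [abs_of_nonneg hx.2.2.1]; exact hx.2.2.2
        · have h1 := ha x hx.1
          have h2 : s * x.im < R' := by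
            by_contra h
            have := hR' x hx.1 (not_lt.1 h)
            linarith [hx.2.1]
          have h3 : |x.im| = |s * x.im| := by
            rw [abs_mul]; rcases S.hs with h | h <;> rw [h] <;> simp
          have h4 : 0 ≤ a := abs_nonneg _
          rw [h3, abs_le]
          constructor <;> linarith [le_abs_self R', abs_nonneg R']
    have hKne : K.Nonempty := by
      obtain ⟨n, hn⟩ := S.sh x0
      have := hup n x0 hx0
      exact ⟨_, this.1, this.2.ge, hn⟩
    obtain ⟨x1, hx1, hmax⟩ := hKc.exists_isMaxOn hKne (huc.mono fun w hw => hw.1)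
    have hmaxΩ : ∀ y ∈ Ω, u y ≤ u x1 := by
      intro y hy
      by_cases hyu : u x0 ≤ u y
      · obtain ⟨n, hn⟩ := S.sh y
        have h1 := hup n y hy
        rw [← h1.2]
        exact hmax ⟨h1.1, by rw [h1.2]; exact hyu, hn⟩
      · exact (not_le.1 hyu).le.trans hx1.2.1
    set N : ℂ → ℂ := fun x => cexp (τ * (G x - c) + I * (δ * s : ℝ) * x - (δ * a : ℝ)) with hN
    have hNn : ∀ x, ‖N x‖ = Real.exp (u x) := fun x => by
      simp only [hN, norm_exp, hu]; congr 1
      simp only [add_re, sub_re, mul_re, ofReal_re, ofReal_im, I_re, I_im, sub_im, mul_im]; ring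
    have hNd : DifferentiableOn ℂ N Ω := by
      have hGd : DifferentiableOn ℂ G Ω := fun x hx => (hG x hx).differentiableAt.differentiableWithinAt
      exact DifferentiableOn.cexp (by fun_prop)
    have hNmax : IsMaxOn (norm ∘ N) Ω x1 := fun y hy => by
      simp only [mem_setOf_eq, Function.comp, hNn]
      exact Real.exp_le_exp.2 (hmaxΩ y hy)
    have heq := Complex.eqOn_of_isPreconnected_of_isMaxOn_norm S.pc S.op hNd hx1.1 hNmax
    set w : ℂ := (0:ℝ) + I * (s * max ai R' : ℝ) with hw
    have hwΩ : w ∈ Ω := S.line_mem hai (le_max_left _ _) 0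
    have h1 := congrArg norm (heq hwΩ)
    simp only [Function.const_apply, hNn] at h1
    have h2 := Real.exp_injective h1
    have h3 := hR' w hwΩ (by simp [hw]; rw [← mul_assoc, hss, one_mul]; exact le_max_right _ _)
    linarith [hx1.2.1]
  refine le_of_forall_pos_le_add fun e he => ?_
  have hq := ha x hx
  have h1 := main (e / (s * x.im + a + 1)) (by positivity) x hx
  have h2 : e / (s * x.im + a + 1) * (s * x.im + a) ≤ e := by
    rw [div_mul_eq_mul_div, div_le_iff₀ (by positivity)]; nlinarith
  linarith

theorem uniq {F : ℂ → ℂ} (hF : DifferentiableOn ℂ F Ω) (hp : ∀ x ∈ Ω, F (x + 2 * Real.pi) = F x)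
    (hinf : ∀ δ > 0, ∃ R, ∀ x : ℂ, R ≤ s * x.im → ‖F x‖ ≤ δ)
    (hroot : ∃ B > 0, ∀ α ε, 0 < ε → ε ≤ ε0 → ‖F (xe z z1 (s * ε) α)‖ ≤ B / Real.sqrt ε)
    (hreb : ∃ B > 0, ∀ α ε, 0 < ε → ε ≤ ε0 → |(z1 α * F (xe z z1 (s * ε) α)).re| ≤ B)
    (hre : ∀ α, Tendsto (fun ε => (z1 α * F (xe z z1 (s * ε) α)).re) (𝓝[>] 0) (𝓝 0)) : ∀ x ∈ Ω, F x = 0 := by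
  obtain ⟨G, k, hG, hk⟩ := S.prim hF hp
  obtain ⟨B, hB0, hB⟩ := hroot
  obtain ⟨B1, hB10, hB1⟩ := hreb
  have hz1 := S.toCrv.c1
  have hz2 := S.toCrv.c2
  obtain ⟨M, hM, hMb⟩ := per_bound hz1 S.toCrv.per1
  obtain ⟨M2, hM2, hM2b⟩ := per_bound hz2 S.toCrv.per2
  have hns : ‖(s:ℂ)‖ = 1 := by rcases S.hs with rfl | rfl <;> simp
  set L := 2 * B * M with hL
  have hLp : 0 < L := by positivity
  -- Lipschitz in sqrt
  have hlip : ∀ α ε ε', 0 < ε → ε ≤ ε0 → 0 < ε' → ε' ≤ ε → ‖G (xe z z1 (s * ε) α) - G (xe z z1 (s * ε') α)‖ ≤ L * Real.sqrt ε := by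
    intro α ε ε' h0 h1 h0' h1'
    have hd : ∀ r ∈ Ioc 0 (Real.sqrt ε), HasDerivWithinAt (fun r : ℝ => G (xe z z1 (s * r ^ 2) α)) (F (xe z z1 (s * r ^ 2) α) * (I * (s * (2 * r)) * z1 α)) (Ioc 0 (Real.sqrt ε)) r := by
      intro r hr
      have hr2 : r ^ 2 ≤ ε0 := by
        refine le_trans ?_ h1
        have := Real.sq_sqrt h0.le
        nlinarith [hr.1, hr.2]
      have h2 : HasDerivAt (fun r : ℝ => xe z z1 (s * r ^ 2) α) (I * (s * (2 * r)) * z1 α) r := by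
        unfold xe
        have h3 : HasDerivAt (fun r : ℝ => (s * r ^ 2)) (s * (2 * r)) r := by
          have := (hasDerivAt_pow 2 r).const_mul s
          simpa using this
        have h4 := ((h3.ofReal_comp.const_mul I).mul_const (z1 α)).const_add (z α)
        push_cast at h4 ⊢
        exact h4
      exact ((hG _ (S.col α (r ^ 2) (by have := hr.1; positivity) hr2)).comp_of_eq (𝕜' := ℂ) r h2 rfl).hasDerivWithinAt
    have hbd : ∀ r ∈ Ioc 0 (Real.sqrt ε), ‖F (xe z z1 (s * r ^ 2) α) * (I * (s * (2 * r)) * z1 α)‖ ≤ L := by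
      intro r hr
      have hr0 := hr.1
      have hr2 : r ^ 2 ≤ ε0 := by
        refine le_trans ?_ h1
        have := Real.sq_sqrt h0.le
        nlinarith [hr.1, hr.2]
      have h3 := hB α (r ^ 2) (by positivity) hr2
      rw [Real.sqrt_sq hr0.le] at h3
      have e2 : ‖I * (s * (2 * (r:ℂ))) * z1 α‖ = 2 * r * ‖z1 α‖ := by
        rw [norm_mul, norm_mul, norm_I, norm_mul, hns, norm_mul, norm_real, Real.norm_of_nonneg hr0.le]; simp
      rw [norm_mul, e2]
      calc _ ≤ B / r * (2 * r * M) := by gcongr; exact hMb α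
        _ = L := by rw [hL]; field_simp
    have hsq : Real.sqrt ε' ≤ Real.sqrt ε := Real.sqrt_le_sqrt h1'
    have hs0 : 0 < Real.sqrt ε' := Real.sqrt_pos.2 h0'
    have := (convex_Ioc 0 (Real.sqrt ε)).norm_image_sub_le_of_norm_hasDerivWithin_le hd hbd
      (x := Real.sqrt ε') (y := Real.sqrt ε) ⟨hs0, hsq⟩ ⟨Real.sqrt_pos.2 h0, le_rfl⟩
    simp only [Real.sq_sqrt h0.le, Real.sq_sqrt h0'.le] at this
    refine this.trans ?_
    rw [Real.norm_of_nonneg (by linarith)]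
    gcongr; linarith
  -- tangential
  have htan : ∀ α α', Tendsto (fun ε => (G (xe z z1 (s * ε) α')).re - (G (xe z z1 (s * ε) α)).re) (𝓝[>] 0) (𝓝 0) := by
    intro α α'
    have hsq0 : Tendsto (fun ε => Real.sqrt ε) (𝓝[>] 0) (𝓝 0) := by
      have := (Real.continuous_sqrt.tendsto 0).mono_left (nhdsWithin_le_nhds (s := Ioi 0))
      rwa [Real.sqrt_zero] at this
    have hext : ∀ β ε, 0 < ε → ε ≤ ε0 → |(F (xe z z1 (s * ε) β) * (z1 β + I * (s * ε : ℝ) * z2 β)).re - (z1 β * F (xe z z1 (s * ε) β)).re| ≤ B * M2 * Real.sqrt ε := by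
      intro β ε h0 h1
      rw [← sub_re, show F (xe z z1 (s * ε) β) * (z1 β + I * (s * ε : ℝ) * z2 β) - z1 β * F (xe z z1 (s * ε) β) = F (xe z z1 (s * ε) β) * (I * (s * ε : ℝ) * z2 β) by ring]
      refine (abs_re_le_norm _).trans ?_
      have e2 : ‖I * (s * ε : ℝ) * z2 β‖ = ε * ‖z2 β‖ := by
        rw [norm_mul, norm_mul, norm_I, ofReal_mul, norm_mul, hns, norm_real, Real.norm_of_nonneg h0.le]; simp
      rw [norm_mul, e2]
      have hs0 : 0 < Real.sqrt ε := Real.sqrt_pos.2 h0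
      calc _ ≤ B / Real.sqrt ε * (ε * M2) := by gcongr; exact hB β ε h0 h1; exact hM2b β
        _ = B * M2 * Real.sqrt ε := by
            nth_rewrite 2 [← Real.sq_sqrt h0.le]; field_simp
    have hev : ∀ᶠ ε : ℝ in 𝓝[>] 0, ε ∈ Ioc 0 ε0 := Ioc_mem_nhdsGT S.ep
    have hcont : ∀ ε ∈ Ioc 0 ε0, Continuous fun β => F (xe z z1 (s * ε) β) * (z1 β + I * (s * ε : ℝ) * z2 β) := fun ε he => by
      have hc : Continuous (xe z z1 (s * ε)) := continuous_iff_continuousAt.2 fun α => (xe_d S.toCrv _ α).continuousAt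
      have := hF.continuousOn.comp_continuous hc (fun β => S.col β ε he.1 he.2)
      exact this.mul (by fun_prop)
    have hI : Tendsto (fun ε => ∫ β in α..α', (F (xe z z1 (s * ε) β) * (z1 β + I * (s * ε : ℝ) * z2 β)).re) (𝓝[>] 0) (𝓝 (∫ β in α..α', (0:ℝ))) := by
      refine intervalIntegral.tendsto_integral_filter_of_dominated_convergence (fun _ => B1 + B * M2 * Real.sqrt ε0) ?_ ?_ (by simp) ?_
      · filter_upwards [hev] with ε he
        exact (continuous_re.comp (hcont ε he)).aestronglyMeasurable
      · filter_upwards [hev] with ε he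
        refine Eventually.of_forall fun β _ => ?_
        have h1 := hext β ε he.1 he.2
        have h2 := hB1 β ε he.1 he.2
        have h3 : B * M2 * Real.sqrt ε ≤ B * M2 * Real.sqrt ε0 := by gcongr; exact he.2
        rw [Real.norm_eq_abs]
        rw [abs_le] at *
        constructor <;> linarith [h1.1, h1.2, h2.1, h2.2]
      · refine Eventually.of_forall fun β _ => ?_
        have h1 : Tendsto (fun ε => (F (xe z z1 (s * ε) β) * (z1 β + I * (s * ε : ℝ) * z2 β)).re - (z1 β * F (xe z z1 (s * ε) β)).re) (𝓝[>] 0) (𝓝 0) := by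
          refine squeeze_zero_norm' ?_ (by simpa using hsq0.const_mul (B * M2))
          filter_upwards [hev] with ε he using hext β ε he.1 he.2
        simpa using h1.add (hre β)
    rw [intervalIntegral.integral_zero] at hI
    refine hI.congr' ?_
    filter_upwards [hev] with ε he
    have hint := (hcont ε he).intervalIntegrable (μ := volume) α α'
    have e1 := Complex.reCLM.intervalIntegral_comp_comm hint
    refine Eq.trans e1 ?_
    rw [intervalIntegral.integral_eq_sub_of_hasDerivAt (f := fun β => G (xe z z1 (s * ε) β))
      (fun β _ => (hG _ (S.col β ε he.1 he.2)).comp_of_eq (𝕜' := ℂ) β (xe_d S.toCrv _ β) rfl) hint]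
    simp
  have hpair : ∀ α α' ε ε', 0 < ε → ε ≤ ε0 → 0 < ε' → ε' ≤ ε0 →
      (G (xe z z1 (s * ε) α)).re - L * Real.sqrt ε ≤ (G (xe z z1 (s * ε') α')).re + L * Real.sqrt ε' := by
    intro α α' ε ε' h0 h1 h0' h1'
    have : (0:ℝ) ≥ (G (xe z z1 (s * ε) α)).re - (G (xe z z1 (s * ε') α')).re - L * Real.sqrt ε - L * Real.sqrt ε' := by
      refine ge_of_tendsto (htan α' α) ?_
      filter_upwards [Ioc_mem_nhdsGT h0, Ioc_mem_nhdsGT h0'] with e he he'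
      have a1 := (abs_re_le_norm _).trans (hlip α ε e h0 h1 he.1 he.2)
      have a2 := (abs_re_le_norm _).trans (hlip α' ε' e h0' h1' he'.1 he'.2)
      rw [sub_re, abs_le] at a1 a2
      linarith [a1.1, a1.2, a2.1, a2.2]
    linarith
  have hep := S.ep
  set ι := ℝ × Ioc 0 ε0
  have : Nonempty ι := ⟨(0, ⟨ε0, hep, le_rfl⟩)⟩
  set c : ℝ := ⨆ i : ι, ((G (xe z z1 (s * i.2) i.1)).re - L * Real.sqrt i.2) with hc
  have hbdd : BddAbove (range fun i : ι => ((G (xe z z1 (s * i.2) i.1)).re - L * Real.sqrt i.2)) := by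
    refine ⟨(G (xe z z1 (s * ε0) 0)).re + L * Real.sqrt ε0, ?_⟩
    rintro _ ⟨i, rfl⟩
    exact hpair i.1 0 i.2 ε0 i.2.2.1 i.2.2.2 hep le_rfl
  have hb : ∀ α ε, 0 < ε → ε ≤ ε0 → |(G (xe z z1 (s * ε) α)).re - c| ≤ L * Real.sqrt ε := by
    intro α ε h0 h1
    have e1 := le_ciSup hbdd (α, ⟨ε, h0, h1⟩)
    have e2 : c ≤ (G (xe z z1 (s * ε) α)).re + L * Real.sqrt ε := ciSup_le fun i => hpair i.1 α i.2 ε i.2.2.1 i.2.2.2 h0 h1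
    rw [abs_le]
    constructor
    · linarith
    · have : (G (xe z z1 (s * ε) α)).re - L * Real.sqrt ε ≤ c := e1
      linarith
  have hconst : ∀ x ∈ Ω, (G x).re = c := fun x hx => by
    have e1 := S.pl hG hk hinf hb (Or.inl rfl) hx
    have e2 := S.pl hG hk hinf hb (Or.inr rfl) hx
    linarith
  intro x hx
  set v := (starRingEnd ℂ) (F x) with hv
  have hline : HasDerivAt (fun t : ℝ => x + t * v) v 0 := by
    simpa using ((ofRealCLM.hasDerivAt (x := (0:ℝ))).mul_const v).const_add x
  have hd : HasDerivAt (fun t : ℝ => G (x + t * v)) (F x * v) 0 := by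
    have hG' : HasDerivAt G (F x) (x + ((0:ℝ):ℂ) * v) := by simpa using hG x hx
    exact hG'.comp_of_eq (𝕜' := ℂ) 0 hline rfl
  have hd2 := cre hd
  have hd3 : HasDerivAt (fun t : ℝ => (G (x + t * v)).re) 0 0 := by
    refine (hasDerivAt_const (0:ℝ) c).congr_of_eventuallyEq ?_
    have : ∀ᶠ t : ℝ in 𝓝 0, x + t * v ∈ Ω := by
      refine hline.continuousAt.eventually_mem ?_
      simpa using S.op.mem_nhds hx
    filter_upwards [this] with t ht using hconst _ ht
  have h0 := hd2.unique hd3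
  rw [hv, mul_conj, ofReal_re] at h0
  exact normSq_eq_zero.1 h0
end Side
end

section
open Topology Complex

theorem Geo.jump_bdd {z z1 z2 : ℝ → ℂ} {c0 C ε0 : ℝ} (g : Geo z z1 z2 c0 C ε0) {y : ℝ → ℂ} (hy : Continuous y) (hp : ∀ α, y (α + 2 * Real.pi) = y α) :
    ∃ B > 0, ∀ α ε : ℝ, 0 < ε → ε ≤ ε0 → ‖z1 α * (Cint z y (xe z z1 ε α) - Cint z y (xe z z1 (-ε) α))‖ ≤ B := by
  have hpi := Real.pi_pos
  obtain ⟨Y, hY, hYb⟩ := per_bound hy hp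
  have hC := g.Cp
  refine ⟨1 / (4 * Real.pi) * (Y * C * (2 * Real.pi) + Y * C * (2 * Real.pi) + 4 * (Y * Real.pi)), by positivity, fun α ε he hle => ?_⟩
  have hle1 : |ε| ≤ ε0 := by rwa [abs_of_pos he]
  have e1 := g.decomp hy hp α he.ne' hle1
  have e2 := g.decomp hy hp α (neg_ne_zero.2 he.ne') (by rwa [abs_neg])
  simp only [neg_sq, neg_div] at e2
  have e3 : (∫ s in (-Real.pi)..Real.pi, y (α + s) * ((-(ε / (ε ^ 2 + s ^ 2)) : ℝ) : ℂ)) =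
    - ∫ s in (-Real.pi)..Real.pi, y (α + s) * ((ε / (ε ^ 2 + s ^ 2) : ℝ) : ℂ) := by
    rw [← intervalIntegral.integral_neg]; simp
  rw [e3] at e2
  have hp4 : (4 * Real.pi : ℂ) ≠ 0 := by simp [Real.pi_ne_zero]
  have e4 : z1 α * (Cint z y (xe z z1 ε α) - Cint z y (xe z z1 (-ε) α)) = (1 / (4 * Real.pi)) *
     ((∫ s in (-Real.pi)..Real.pi, y (α + s) * Bk z z1 α ε s) - (∫ s in (-Real.pi)..Real.pi, y (α + s) * Bk z z1 α (-ε) s)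
      - 4 * ∫ s in (-Real.pi)..Real.pi, y (α + s) * ((ε / (ε ^ 2 + s ^ 2) : ℝ) : ℂ)) := by
    rw [one_div_mul_eq_div, eq_div_iff hp4]
    linear_combination e1 - e2
  rw [e4, norm_mul, show ‖(1 / (4 * Real.pi) : ℂ)‖ = 1 / (4 * Real.pi) by rw [norm_div, norm_mul]; simp [abs_of_pos hpi]]
  have hbk : ∀ ε : ℝ, |ε| ≤ ε0 → ‖∫ s in (-Real.pi)..Real.pi, y (α + s) * Bk z z1 α ε s‖ ≤ Y * C * (2 * Real.pi) := fun ε hle => by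
    refine (intervalIntegral.norm_integral_le_of_norm_le_const (C := Y * C) fun s hs => ?_).trans (le_of_eq ?_)
    · rw [uIoc_of_le (by linarith)] at hs
      rw [norm_mul]
      exact mul_le_mul (hYb _) (g.ker α s ε (abs_le.2 (Ioc_subset_Icc_self hs)) hle) (norm_nonneg _) hY.le
    · rw [abs_of_pos (by linarith)]; ring
  gcongr
  refine (norm_sub_le _ _).trans (add_le_add ((norm_sub_le _ _).trans (add_le_add (hbk _ hle1) (hbk _ (by rwa [abs_neg])))) ?_)
  rw [norm_mul, Complex.norm_ofNat]
  gcongr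
  have hpb := poisson_bd he
  calc _ ≤ ∫ s in (-Real.pi)..Real.pi, Y * (ε / (ε ^ 2 + s ^ 2)) := by
        refine intervalIntegral.norm_integral_le_of_norm_le (by linarith) (Eventually.of_forall fun s _ => ?_) ?_
        · rw [norm_mul, norm_real (ε / (ε ^ 2 + s ^ 2)), Real.norm_of_nonneg (by positivity)]
          gcongr; exact hYb _
        · refine Continuous.intervalIntegrable (continuous_const.mul (continuous_const.div (by fun_prop) fun s => ?_)) _ _
          positivity
    _ ≤ _ := by rw [intervalIntegral.integral_const_mul]; gcongr

theorem ker_trivial {z z1 z2 : ℝ → ℂ} {c0 C ε0 : ℝ} {Ω1 Ω2 : Set ℂ} (S1 : Side z z1 z2 c0 C ε0 Ω1 (-1)) (S2 : Side z z1 z2 c0 C ε0 Ω2 1)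
    {y : ℝ → ℝ} (hy : Continuous y) (hp : ∀ α, y (α + 2 * Real.pi) = y α) (hk : ∀ α, y α + 2 * Kop z z1 y α = 0) : ∀ α, y α = 0 := by
  have hpi := Real.pi_pos
  have hyc : Continuous fun β => (y β : ℂ) := continuous_ofReal.comp hy
  have hypc : ∀ α, (y (α + 2 * Real.pi) : ℂ) = y α := fun α => by rw [hp]
  set F := Cint z (fun β => (y β : ℂ)) with hF
  have hd : ∀ x, x ∉ range z → DifferentiableAt ℂ F x := fun x hx => (Cint_deriv S1.toCrv hyc hx S1.clr).differentiableAt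
  have hFp : ∀ x : ℂ, F (x + 2 * Real.pi) = F x := fun x => by simp only [hF, Cint, kap_per_left]
  obtain ⟨B, hB0, hB⟩ := S1.toGeo.bdd_side hy hp
  obtain ⟨R, hR0, hR⟩ := S1.toGeo.root hyc hypc
  have hre1 : ∀ α, Tendsto (fun ε => (z1 α * F (xe z z1 (-1 * ε) α)).re) (𝓝[>] 0) (𝓝 0) := fun α => by
    have := S1.toGeo.lim_side hy hp α (σ := -1) (by simp)
    rwa [show - -1 / 2 * y α + Kop z z1 y α = 0 by linarith [hk α]] at this
  have hz1 := S1.toCrv.c1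
  have hz2 := S1.toCrv.c2
  -- mean zero
  have hm : ∫ β in (0:ℝ)..(2 * Real.pi), y β = 0 := by
    obtain ⟨k, hk1, hk2⟩ := S1.pi0 (f := F) (fun x hx => (hd x (S1.dj x hx)).differentiableWithinAt) (fun x _ => hFp x)
    obtain ⟨Z2, hZ2, hZ2b⟩ := per_bound S1.toCrv.c2 S1.toCrv.per2
    have hkre : k.re = 0 := by
      have hcx : ∀ ε, 0 < ε → ε ≤ ε0 → Continuous fun β => F (xe z z1 (-1 * ε) β) := fun ε h0 h1 => by
        have hc : Continuous (xe z z1 (-1 * ε)) := continuous_iff_continuousAt.2 fun α => (xe_d S1.toCrv _ α).continuousAt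
        exact continuous_iff_continuousAt.2 fun α => ContinuousAt.comp (g := F) (f := xe z z1 (-1 * ε)) (hd _ (S1.dj _ (S1.col α ε h0 h1))).continuousAt hc.continuousAt
      have t1 : Tendsto (fun ε => ∫ β in (0:ℝ)..(2 * Real.pi), (z1 β * F (xe z z1 (-1 * ε) β)).re) (𝓝[>] 0) (𝓝 (∫ β in (0:ℝ)..(2 * Real.pi), 0)) := by
        refine intervalIntegral.tendsto_integral_filter_of_dominated_convergence (fun _ => B) ?_ ?_ ?_ ?_
        · filter_upwards [Ioc_mem_nhdsGT S1.ep] with ε he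
          exact (continuous_re.comp (hz1.mul (hcx ε he.1 he.2))).aestronglyMeasurable
        · filter_upwards [Ioc_mem_nhdsGT S1.ep] with ε he
          refine Eventually.of_forall fun β _ => ?_
          exact hB β (-1 * ε) (by simpa using he.1.ne') (by simpa [abs_of_pos he.1] using he.2)
        · exact intervalIntegrable_const
        · exact Eventually.of_forall fun β _ => hre1 β
      rw [intervalIntegral.integral_zero] at t1
      have t2 : Tendsto (fun ε : ℝ => 2 * Real.pi * (R * Z2) * Real.sqrt ε) (𝓝[>] 0) (𝓝 (2 * Real.pi * (R * Z2) * Real.sqrt 0)) :=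
        ((Real.continuous_sqrt.tendsto 0).const_mul _).mono_left nhdsWithin_le_nhds
      have t3 := t1.abs.add t2
      simp only [abs_zero, Real.sqrt_zero, mul_zero, add_zero] at t3
      have : |k.re| ≤ 0 := by
        refine ge_of_tendsto t3 ?_
        filter_upwards [Ioc_mem_nhdsGT S1.ep] with ε he
        have h1 := hk1 ε he.1 he.2
        have i1 : IntervalIntegrable (fun β => z1 β * F (xe z z1 (-1 * ε) β)) volume 0 (2 * Real.pi) := (hz1.mul (hcx ε he.1 he.2)).intervalIntegrable _ _
        have i2 : IntervalIntegrable (fun β => F (xe z z1 (-1 * ε) β) * (I * (-1 * ε : ℝ) * z2 β)) volume 0 (2 * Real.pi) :=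
          ((hcx ε he.1 he.2).mul (by fun_prop)).intervalIntegrable _ _
        rw [show (fun β => F (xe z z1 (-1 * ε) β) * (z1 β + I * (-1 * ε : ℝ) * z2 β)) = fun β => z1 β * F (xe z z1 (-1 * ε) β) + F (xe z z1 (-1 * ε) β) * (I * (-1 * ε : ℝ) * z2 β) by
          funext β; ring, intervalIntegral.integral_add i1 i2] at h1
        rw [← h1, add_re]
        have e1 : (∫ β in (0:ℝ)..(2 * Real.pi), z1 β * F (xe z z1 (-1 * ε) β)).re = ∫ β in (0:ℝ)..(2 * Real.pi), (z1 β * F (xe z z1 (-1 * ε) β)).re :=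
          (ContinuousLinearMap.intervalIntegral_comp_comm reCLM i1).symm
        rw [e1]
        refine (abs_add_le _ _).trans (add_le_add le_rfl ((abs_re_le_norm _).trans ?_))
        refine (intervalIntegral.norm_integral_le_of_norm_le_const (C := R * Z2 * Real.sqrt ε) fun β _ => ?_).trans (le_of_eq ?_)
        · have e2 := hR β (-1 * ε) (by simpa using he.1.ne') (by simpa [abs_of_pos he.1] using he.2)
          have e3 : |(-1) * ε| = ε := by simp [abs_of_pos he.1]
          rw [e3] at e2
          rw [norm_mul, norm_mul, norm_mul, norm_I, one_mul, norm_real, Real.norm_eq_abs, e3]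
          calc _ ≤ R / Real.sqrt ε * (ε * Z2) := by exact mul_le_mul e2 (mul_le_mul_of_nonneg_left (hZ2b β) he.1.le) (mul_nonneg he.1.le (norm_nonneg _)) (by positivity)
            _ = R * Z2 * (ε / Real.sqrt ε) := by ring
            _ = _ := by rw [Real.div_sqrt]
        · rw [sub_zero, abs_of_pos (by positivity)]; ring
      simpa using this
    obtain ⟨a, ha⟩ := S1.inf
    by_contra hne
    set c : ℝ := 1 / (4 * Real.pi) * ∫ β in (0:ℝ)..(2 * Real.pi), y β with hc
    have hc0 : c ≠ 0 := mul_ne_zero (by positivity) hne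
    obtain ⟨R0, hR0⟩ := Cint_inf S1.toCrv hyc (s := -1) (by simp) (δ := |c| / 2) (by positivity)
    have hb := hk2 a (max a R0) ha (le_max_left _ _)
    have hcc : ((1 / (4 * Real.pi) : ℂ) * ∫ β in (0:ℝ)..(2 * Real.pi), (y β : ℂ)) = (c : ℂ) := by
      rw [hc, intervalIntegral.integral_ofReal]; push_cast; ring
    rw [hcc] at hR0
    have hl : ∀ r : ℝ, ‖F (r + I * (-1 * (max a R0) : ℝ)) + (-1 : ℝ) * c‖ ≤ |c| / 2 := fun r => hR0 _ (by simp)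
    have hcl : Continuous fun r : ℝ => F (r + I * (-1 * (max a R0) : ℝ)) :=
      continuous_iff_continuousAt.2 fun r => ContinuousAt.comp (g := F) (f := fun r : ℝ => (r + I * (-1 * (max a R0) : ℝ) : ℂ)) (hd _ (S1.dj _ (ha _ (by simp)))).continuousAt (by fun_prop)
    have hI : ∫ r in (0:ℝ)..(2 * Real.pi), (F (r + I * (-1 * (max a R0) : ℝ)) + (-1 : ℝ) * c) = k - 2 * Real.pi * c := by
      rw [intervalIntegral.integral_add (hcl.intervalIntegrable _ _) intervalIntegrable_const, hb, intervalIntegral.integral_const]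
      simp; ring
    have h1 := intervalIntegral.norm_integral_le_of_norm_le_const (a := (0:ℝ)) (b := 2 * Real.pi) (fun r _ => hl r)
    rw [hI] at h1
    have h2 := (abs_re_le_norm _).trans h1
    have h3 : (k - 2 * Real.pi * c : ℂ).re = -(2 * Real.pi * c) := by
      rw [sub_re, hkre, show (2 * Real.pi * c : ℂ) = ((2 * Real.pi * c : ℝ) : ℂ) by push_cast; ring, ofReal_re]; ring
    rw [h3, abs_neg, abs_mul, sub_zero, abs_of_pos (by positivity : 0 < 2 * Real.pi)] at h2
    have : 0 < |c| * Real.pi := by positivity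
    linarith
  have hinf : ∀ s : ℝ, (s = 1 ∨ s = -1) → ∀ δ > 0, ∃ R, ∀ x : ℂ, R ≤ s * x.im → ‖F x‖ ≤ δ := fun s hs δ hδ => by
    obtain ⟨R0, hR0⟩ := Cint_inf S1.toCrv hyc hs hδ
    refine ⟨R0, fun x hx => ?_⟩
    have := hR0 x hx
    rw [intervalIntegral.integral_ofReal, hm] at this
    simpa using this
  have hF1 : ∀ x ∈ Ω1, F x = 0 := S1.uniq (fun x hx => (hd x (S1.dj x hx)).differentiableWithinAt) (fun x _ => hFp x) (hinf _ (by simp))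
    ⟨R, hR0, fun α ε h0 h1 => by
      have := hR α (-1 * ε) (by simpa using h0.ne') (by simpa [abs_of_pos h0] using h1)
      simpa [abs_of_pos h0] using this⟩
    ⟨B, hB0, fun α ε h0 h1 => hB α (-1 * ε) (by simpa using h0.ne') (by simpa [abs_of_pos h0] using h1)⟩ hre1
  have hz : ∀ α ε, 0 < ε → ε ≤ ε0 → F (xe z z1 (-ε) α) = 0 := fun α ε h0 h1 => by
    have := hF1 _ (S1.col α ε h0 h1); simpa using this
  have hj : ∀ α, Tendsto (fun ε => z1 α * F (xe z z1 ε α)) (𝓝[>] 0) (𝓝 (-(y α : ℂ))) := fun α => by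
    refine (S1.toGeo.jump hyc hypc α).congr' ?_
    filter_upwards [Ioc_mem_nhdsGT S1.ep] with ε he
    have := hz α ε he.1 he.2
    rw [hF] at this
    rw [this, sub_zero]
  obtain ⟨J, hJ0, hJ⟩ := S1.toGeo.jump_bdd hyc hypc
  have hF2 : ∀ x ∈ Ω2, I * F x = 0 := S2.uniq (F := fun x => I * F x) (fun x hx => ((hd x (S2.dj x hx)).const_mul I).differentiableWithinAt) (fun x _ => by simp only [hFp x])
    (fun δ hδ => by
      obtain ⟨R0, h⟩ := hinf 1 (by simp) δ hδ
      exact ⟨R0, fun x hx => by simpa using h x hx⟩)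
    ⟨R, hR0, fun α ε h0 h1 => by
      have := hR α ε h0.ne' (by simpa [abs_of_pos h0] using h1)
      simpa [abs_of_pos h0] using this⟩
    ⟨J, hJ0, fun α ε h0 h1 => by
      have h2 := hJ α ε h0 h1
      have h3 := hz α ε h0 h1
      rw [hF] at h3
      rw [h3, sub_zero] at h2
      refine (abs_re_le_norm _).trans ?_
      rw [one_mul, mul_left_comm, norm_mul, norm_I, one_mul]
      exact h2⟩
    (fun α => by
      have h1 := (continuous_re.tendsto _).comp ((hj α).const_mul I)
      have h2 : (I * -(y α : ℂ)).re = 0 := by simp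
      rw [h2] at h1
      refine h1.congr fun ε => ?_
      simp only [Function.comp, one_mul, mul_left_comm])
  intro α
  have h0 : Tendsto (fun ε => z1 α * F (xe z z1 ε α)) (𝓝[>] 0) (𝓝 0) := by
    refine tendsto_const_nhds.congr' ?_
    filter_upwards [Ioc_mem_nhdsGT S1.ep] with ε he
    have := hF2 _ (S2.col α ε he.1 he.2)
    rw [one_mul] at this
    rw [(mul_eq_zero.1 this).resolve_left I_ne_zero, mul_zero]
  have := tendsto_nhds_unique h0 (hj α)
  simpa using this.symm
end

section
open Topology Complex

instance tpFact : Fact (0 < 2 * Real.pi) := ⟨Real.two_pi_pos⟩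
abbrev AC := AddCircle (2 * Real.pi)
abbrev IC := Icc (-Real.pi) Real.pi
theorem icle : -Real.pi ≤ Real.pi := by linarith [Real.pi_pos]
def prI (s : ℝ) : IC := projIcc (-Real.pi) Real.pi icle s
theorem prI_c : Continuous prI := continuous_projIcc (h := icle)

theorem Lfun_c (k : C(AC × IC, ℝ)) (y : C(AC, ℝ)) : Continuous fun a : AC => ∫ s in (-Real.pi)..Real.pi, k (a, prI s) * y (a + (s : AC)) := by
  have := prI_c
  refine intervalIntegral.continuous_parametric_intervalIntegral_of_continuous' (μ := volume) (f := fun (a : AC) (s : ℝ) => k (a, prI s) * y (a + (s : AC))) ?_ _ _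
  have h1 : Continuous fun s : ℝ => (s : AC) := AddCircle.continuous_mk' _
  simp only [Function.uncurry_def]
  fun_prop

theorem Lint (k : C(AC × IC, ℝ)) (y : C(AC, ℝ)) (a : AC) : IntervalIntegrable (fun s : ℝ => k (a, prI s) * y (a + (s : AC))) volume (-Real.pi) Real.pi := by
  have := prI_c
  have h1 : Continuous fun s : ℝ => (s : AC) := AddCircle.continuous_mk' _
  exact Continuous.intervalIntegrable (by fun_prop) _ _

def Lop : C(AC × IC, ℝ) →L[ℝ] C(AC, ℝ) →L[ℝ] C(AC, ℝ) :=
  LinearMap.mkContinuous₂ (LinearMap.mk₂ ℝ (fun k y => ⟨_, Lfun_c k y⟩)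
    (fun k k' y => by
      ext a; simp only [ContinuousMap.coe_mk, ContinuousMap.add_apply, add_mul]
      exact intervalIntegral.integral_add (Lint k y a) (Lint k' y a))
    (fun c k y => by
      ext a; simp only [ContinuousMap.coe_mk, ContinuousMap.smul_apply, smul_eq_mul, mul_assoc]
      exact intervalIntegral.integral_const_mul _ _)
    (fun k y y' => by
      ext a; simp only [ContinuousMap.coe_mk, ContinuousMap.add_apply, mul_add]
      exact intervalIntegral.integral_add (Lint k y a) (Lint k y' a))
    (fun c k y => by
      ext a; simp only [ContinuousMap.coe_mk, ContinuousMap.smul_apply, smul_eq_mul, mul_left_comm]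
      exact intervalIntegral.integral_const_mul _ _)) (2 * Real.pi)
    (fun k y => by
      rw [ContinuousMap.norm_le _ (by have := Real.pi_pos; positivity)]
      intro a
      refine (intervalIntegral.norm_integral_le_of_norm_le_const (C := ‖k‖ * ‖y‖) fun s _ => ?_).trans (le_of_eq ?_)
      · rw [norm_mul]; exact mul_le_mul (k.norm_coe_le_norm _) (y.norm_coe_le_norm _) (norm_nonneg _) (norm_nonneg _)
      · rw [abs_of_pos (by linarith [Real.pi_pos])]; ring)

theorem Lop_apply (k : C(AC × IC, ℝ)) (y : C(AC, ℝ)) (a : AC) :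
    Lop k y a = ∫ s in (-Real.pi)..Real.pi, k (a, prI s) * y (a + (s : AC)) := rfl

theorem Lop_shift (k : C(AC × IC, ℝ)) (y : C(AC, ℝ)) (α : ℝ) :
    Lop k y (α : AC) = ∫ β in (α - Real.pi)..(α + Real.pi), k ((α : AC), prI (β - α)) * y (β : AC) := by
  rw [Lop_apply]
  have := intervalIntegral.integral_comp_add_left (a := -Real.pi) (b := Real.pi) (fun β : ℝ => k ((α : AC), prI (β - α)) * y (β : AC)) α
  rw [show α - Real.pi = α + -Real.pi by ring, ← this]
  refine intervalIntegral.integral_congr fun s _ => ?_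
  simp only [add_sub_cancel_left, AddCircle.coe_add]

theorem Lop_compact (k : C(AC × IC, ℝ)) : IsCompactOperator (Lop k) := by
  have hpi := Real.pi_pos
  have hprI := prI_c
  have hcm : Continuous fun s : ℝ => (s : AC) := AddCircle.continuous_mk' _
  let e := ContinuousMap.linearIsometryBoundedOfCompact AC ℝ ℝ
  refine (isCompactOperator_iff_isCompact_closure_image_closedBall (Lop k : C(AC, ℝ) →ₗ[ℝ] C(AC, ℝ)) one_pos).2 ?_
  set S := (Lop k : C(AC, ℝ) →ₗ[ℝ] C(AC, ℝ)) '' Metric.closedBall 0 1 with hS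
  have hSm : ∀ f ∈ S, ∃ y : C(AC, ℝ), ‖y‖ ≤ 1 ∧ Lop k y = f := by
    rintro f ⟨y, hy, rfl⟩
    exact ⟨y, by simpa using hy, rfl⟩
  have hnorm : ∀ y : C(AC, ℝ), ‖y‖ ≤ 1 → ‖Lop k y‖ ≤ ‖Lop k‖ := fun y hy => by
    have := (Lop k).le_opNorm y
    nlinarith [norm_nonneg (Lop k)]
  have key : IsCompact (closure (e '' S)) := by
    refine BoundedContinuousFunction.arzela_ascoli (Metric.closedBall 0 ‖Lop k‖) (isCompact_closedBall _ _) _ ?_ ?_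
    · rintro _ x ⟨f, hf, rfl⟩
      obtain ⟨y, hy, rfl⟩ := hSm f hf
      rw [mem_closedBall_zero_iff]
      exact ((Lop k y).norm_coe_le_norm x).trans (hnorm y hy)
    · intro a
      obtain ⟨α0, rfl⟩ := QuotientAddGroup.mk_surjective a
      rw [Metric.equicontinuousAt_iff_right]
      intro δ hδ
      set h : ℝ → ℝ → ℝ := fun α β => k ((α : AC), prI (β - α)) with hh
      have hhc : Continuous (Function.uncurry h) := by
        simp only [hh, Function.uncurry_def]; fun_prop
      set φ : ℝ → ℝ := fun α => 2 * ‖k‖ * |α - α0| + ∫ β in (α0 - Real.pi)..(α0 + Real.pi), |h α β - h α0 β| with hφ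
      have hφc : Continuous φ := by
        refine Continuous.add (by fun_prop) ?_
        refine intervalIntegral.continuous_parametric_intervalIntegral_of_continuous' (μ := volume) (f := fun α β => |h α β - h α0 β|) ?_ _ _
        simp only [hh, Function.uncurry_def]; fun_prop
      have hφ0 : φ α0 = 0 := by simp [hφ]
      have hev : ∀ᶠ α in 𝓝 α0, φ α < δ := hφc.continuousAt.eventually_lt continuousAt_const (by rwa [hφ0])
      change ∀ᶠ x in 𝓝 ((α0 : ℝ) : AC), _
      rw [show 𝓝 ((α0 : ℝ) : AC) = Filter.map (fun s : ℝ => (s : AC)) (𝓝 α0) from QuotientAddGroup.nhds_eq _ _, Filter.eventually_map]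
      filter_upwards [hev] with α hα
      rintro ⟨_, f, hf, rfl⟩
      obtain ⟨y, hy, rfl⟩ := hSm f hf
      refine lt_of_le_of_lt ?_ hα
      change dist (Lop k y (α0 : AC)) (Lop k y (α : AC)) ≤ _
      rw [dist_comm, Lop_shift, Lop_shift, Real.dist_eq]
      change |(∫ β in (α - Real.pi)..(α + Real.pi), h α β * y β) - ∫ β in (α0 - Real.pi)..(α0 + Real.pi), h α0 β * y β| ≤ _
      have hc1 : ∀ α, Continuous fun β : ℝ => h α β * y β := fun α => by simp only [hh]; fun_prop
      have ii : ∀ α a b, IntervalIntegrable (fun β : ℝ => h α β * y β) volume a b := fun α a b => (hc1 α).intervalIntegrable _ _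
      have hyb : ∀ a, |y a| ≤ 1 := fun a => (y.norm_coe_le_norm a).trans hy
      have hhb : ∀ α β, |h α β| ≤ ‖k‖ := fun α β => k.norm_coe_le_norm _
      have hb : ∀ a b, |∫ β in a..b, h α β * y β| ≤ ‖k‖ * |b - a| := fun a b => by
        rw [← Real.norm_eq_abs]
        refine intervalIntegral.norm_integral_le_of_norm_le_const (C := ‖k‖) fun β _ => ?_
        rw [norm_mul]
        exact (mul_le_mul (hhb α β) (hyb _) (abs_nonneg _) (norm_nonneg _)).trans_eq (mul_one _)
      have e1 : (∫ β in (α - Real.pi)..(α + Real.pi), h α β * y β) - (∫ β in (α0 - Real.pi)..(α0 + Real.pi), h α0 β * y β)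
          = (∫ β in (α - Real.pi)..(α0 - Real.pi), h α β * y β) + (∫ β in (α0 + Real.pi)..(α + Real.pi), h α β * y β)
            + ∫ β in (α0 - Real.pi)..(α0 + Real.pi), (h α β - h α0 β) * y β := by
        have e2 : ∫ β in (α0 - Real.pi)..(α0 + Real.pi), (h α β - h α0 β) * y β =
          (∫ β in (α0 - Real.pi)..(α0 + Real.pi), h α β * y β) - ∫ β in (α0 - Real.pi)..(α0 + Real.pi), h α0 β * y β := by
          rw [← intervalIntegral.integral_sub (ii _ _ _) (ii _ _ _)]; simp only [sub_mul]
        rw [e2, ← intervalIntegral.integral_add_adjacent_intervals (ii α (α - Real.pi) (α0 - Real.pi)) (ii α (α0 - Real.pi) (α + Real.pi)),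
          ← intervalIntegral.integral_add_adjacent_intervals (ii α (α0 - Real.pi) (α0 + Real.pi)) (ii α (α0 + Real.pi) (α + Real.pi))]
        ring
      rw [e1, hφ]
      have b1 := hb (α - Real.pi) (α0 - Real.pi)
      have b2 := hb (α0 + Real.pi) (α + Real.pi)
      rw [show α0 - Real.pi - (α - Real.pi) = -(α - α0) by ring, abs_neg] at b1
      rw [show α + Real.pi - (α0 + Real.pi) = α - α0 by ring] at b2
      have b3 : |∫ β in (α0 - Real.pi)..(α0 + Real.pi), (h α β - h α0 β) * y β| ≤ ∫ β in (α0 - Real.pi)..(α0 + Real.pi), |h α β - h α0 β| := by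
        rw [← Real.norm_eq_abs]
        refine intervalIntegral.norm_integral_le_of_norm_le (by linarith) (Eventually.of_forall fun β _ => ?_) ?_
        · rw [norm_mul]
          exact (mul_le_mul_of_nonneg_left (hyb _) (norm_nonneg _)).trans_eq (mul_one _)
        · refine Continuous.intervalIntegrable ?_ _ _
          simp only [hh]; fun_prop
      refine (abs_add_le _ _).trans ((add_le_add (abs_add_le _ _) le_rfl).trans ?_)
      simp only
      linarith
  have hcl : Topology.IsClosedEmbedding e := (ContinuousMap.linearIsometryBoundedOfCompact AC ℝ ℝ).toHomeomorph.isClosedEmbedding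
  rw [hcl.closure_image_eq] at key
  exact (hcl.isInducing.isCompact_iff).2 key

theorem curve_deriv {A' : Type*} [TopologicalSpace A'] [CompactSpace A'] {F F' : ℝ → C(A', ℝ)} {a b : ℝ} (hF' : Continuous F')
    (h : ∀ t ∈ Ioo a b, ∀ x, HasDerivAt (fun t => F t x) (F' t x) t) : ∀ t ∈ Ioo a b, HasDerivAt F (F' t) t := by
  intro t ht
  have h1 : HasDerivAt (fun u => F t + ∫ τ in t..u, F' τ) (F' t) t := by
    exact (intervalIntegral.integral_hasDerivAt_right (hF'.intervalIntegrable _ _) hF'.stronglyMeasurable.stronglyMeasurableAtFilter hF'.continuousAt).const_add _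
  refine h1.congr_of_eventuallyEq ?_
  filter_upwards [isOpen_Ioo.mem_nhds ht] with u hu
  ext x
  rw [ContinuousMap.add_apply]
  have e1 : (∫ τ in t..u, F' τ) x = ∫ τ in t..u, F' τ x :=
    ((ContinuousMap.evalCLM ℝ x).intervalIntegral_comp_comm (hF'.intervalIntegrable t u)).symm
  rw [e1, intervalIntegral.integral_eq_sub_of_hasDerivAt (f := fun τ => F τ x)]
  · ring
  · intro τ hτ
    exact h τ ((ordConnected_Ioo.uIcc_subset ht hu) hτ) x
  · exact (((ContinuousMap.evalCLM ℝ x).continuous.comp hF').intervalIntegrable _ _)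

theorem lift_ex {Y : Type*} [TopologicalSpace Y] {g : ℝ → Y → ℝ} (hc : Continuous (Function.uncurry g)) (hp : ∀ α y, g (α + 2 * Real.pi) y = g α y) :
    ∃ G : C(AC × Y, ℝ), ∀ (α : ℝ) y, G ((α : AC), y) = g α y := by
  have hp' : ∀ y, Function.Periodic (fun α => g α y) (2 * Real.pi) := fun y α => hp α y
  refine ⟨⟨fun p => (hp' p.2).lift p.1, ?_⟩, fun α y => rfl⟩
  rw [← ((QuotientAddGroup.isOpenQuotientMap_mk (N := AddSubgroup.zmultiples (2 * Real.pi))).prodMap (IsOpenQuotientMap.id (X := Y))).continuous_comp_iff]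
  exact hc

theorem liftT_ex {Y : Type*} [TopologicalSpace Y] {g : ℝ → Y → ℝ → ℝ} (hc : Continuous fun p : ℝ × Y × ℝ => g p.1 p.2.1 p.2.2)
    (hp : ∀ α y t, g (α + 2 * Real.pi) y t = g α y t) :
    ∃ G : ℝ → C(AC × Y, ℝ), Continuous G ∧ ∀ t (α : ℝ) y, G t ((α : AC), y) = g α y t := by
  obtain ⟨G, hG⟩ := lift_ex (Y := Y × ℝ) (g := fun α p => g α p.1 p.2) hc (fun α p => hp α p.1 p.2)
  let H : C(ℝ × (AC × Y), ℝ) := ⟨fun p => G (p.2.1, (p.2.2, p.1)), by fun_prop⟩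
  exact ⟨H.curry, H.curry.continuous, fun t α y => hG α (y, t)⟩

theorem solve {k k' : ℝ → C(AC × IC, ℝ)} {r r' : ℝ → C(AC, ℝ)} {T : ℝ} (hk : Continuous k) (hr : Continuous r) (hkc : Continuous k') (hrc : Continuous r')
    (hk' : ∀ t ∈ Ioo 0 T, HasDerivAt k (k' t) t) (hr' : ∀ t ∈ Ioo 0 T, HasDerivAt r (r' t) t)
    (hin : ∀ t (y : C(AC, ℝ)), y + (2:ℝ) • Lop (k t) y = 0 → y = 0) :
    ∃ w w' : ℝ → C(AC, ℝ), Continuous w ∧ Continuous w' ∧ (∀ t, w t + (2:ℝ) • Lop (k t) (w t) = r t) ∧ (∀ t ∈ Ioo 0 T, HasDerivAt w (w' t) t ∧ w' t + (2:ℝ) • (Lop (k' t) (w t) + Lop (k t) (w' t)) = r' t) := by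
  let M : ℝ → (C(AC, ℝ) →L[ℝ] C(AC, ℝ)) := fun t => 1 + (2:ℝ) • Lop (k t)
  have hM : Continuous M := by simp only [M]; fun_prop
  have hu : ∀ t, IsUnit (M t) := by
    intro t
    rcases IsCompactOperator.hasEigenvalue_or_mem_resolventSet (𝕜 := ℝ) (Lop_compact (k t)) (show (-(1/2):ℝ) ≠ 0 by norm_num) with h | h
    · exfalso
      obtain ⟨y, hy⟩ := h.exists_hasEigenvector
      refine hy.2 (hin t y ?_)
      have : Lop (k t) y = (-(1/2):ℝ) • y := hy.apply_eq_smul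
      rw [this, smul_smul]; norm_num
    · have h := spectrum.mem_resolventSet_iff.1 h
      have h2 : M t = (-2:ℝ) • (algebraMap ℝ (C(AC, ℝ) →L[ℝ] C(AC, ℝ)) (-(1/2)) - Lop (k t)) := by
        ext y a
        simp [M, Algebra.algebraMap_eq_smul_one]
        ring
      rw [h2]
      exact h.smul (Units.mk0 (-2:ℝ) (by norm_num))
  have hI : Continuous fun t => Ring.inverse (M t) := by
    refine continuous_iff_continuousAt.2 fun t => ?_
    obtain ⟨u, hu'⟩ := hu t
    refine ContinuousAt.comp (g := Ring.inverse) (f := M) ?_ hM.continuousAt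
    rw [← hu']
    exact NormedRing.inverse_continuousAt (R := C(AC, ℝ) →L[ℝ] C(AC, ℝ)) u
  set w : ℝ → C(AC, ℝ) := fun t => Ring.inverse (M t) (r t) with hw
  have hwc : Continuous w := hI.clm_apply hr
  have hweq : ∀ t, w t + (2:ℝ) • Lop (k t) (w t) = r t := fun t => by
    have := congrArg (fun f : C(AC, ℝ) →L[ℝ] C(AC, ℝ) => f (r t)) (Ring.mul_inverse_cancel _ (hu t))
    simpa [M] using this
  refine ⟨w, fun t => Ring.inverse (M t) (r' t - (2:ℝ) • Lop (k' t) (w t)), hwc, hI.clm_apply (by fun_prop), hweq, fun t ht => ?_⟩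
  obtain ⟨u, hu'⟩ := hu t
  have hd0 : DifferentiableAt ℝ k t := (hk' t ht).differentiableAt
  have hd : DifferentiableAt ℝ M t := by
    simp only [M]
    exact ((DifferentiableAt.comp (𝕜 := ℝ) (E := ℝ) (F := C(AC × IC, ℝ)) (G := C(AC, ℝ) →L[ℝ] C(AC, ℝ)) (g := Lop) (f := k) t Lop.differentiableAt hd0).const_smul (2:ℝ)).const_add _
  have h3 : DifferentiableAt ℝ (fun t => Ring.inverse (M t)) t := by
    refine DifferentiableAt.comp (𝕜 := ℝ) (E := ℝ) (F := C(AC, ℝ) →L[ℝ] C(AC, ℝ)) (G := C(AC, ℝ) →L[ℝ] C(AC, ℝ)) (g := Ring.inverse) (f := M) t ?_ hd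
    rw [← hu']
    exact (hasFDerivAt_ringInverse (𝕜 := ℝ) (R := C(AC, ℝ) →L[ℝ] C(AC, ℝ)) u).differentiableAt
  have h4 : HasDerivAt w (deriv w t) t := (h3.clm_apply (hr' t ht).differentiableAt).hasDerivAt
  have h5 : HasDerivAt (fun t => Lop (k t)) (Lop (k' t)) t := by
    have := (HasFDerivAt.comp_hasDerivAt (𝕜 := ℝ) (F := C(AC × IC, ℝ)) (E := C(AC, ℝ) →L[ℝ] C(AC, ℝ)) (l := Lop) (f := k) t Lop.hasFDerivAt (hk' t ht))
    exact this
  have h6 : HasDerivAt (fun t => w t + (2:ℝ) • Lop (k t) (w t)) (deriv w t + (2:ℝ) • (Lop (k' t) (w t) + Lop (k t) (deriv w t))) t :=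
    h4.add ((h5.clm_apply h4).const_smul (2:ℝ))
  rw [funext hweq] at h6
  have h7 := h6.unique (hr' t ht)
  have h8 : M t (deriv w t) = r' t - (2:ℝ) • Lop (k' t) (w t) := by
    rw [← h7]; simp only [M, ContinuousLinearMap.add_apply, ContinuousLinearMap.one_apply, ContinuousLinearMap.smul_apply, smul_add]; abel
  simp only
  rw [← h8, show Ring.inverse (M t) (M t (deriv w t)) = deriv w t by
    have := congrArg (fun f : C(AC, ℝ) →L[ℝ] C(AC, ℝ) => f (deriv w t)) (Ring.inverse_mul_cancel _ (hu t))
    simpa using this]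
  exact ⟨h4, h7⟩
end

section
open Topology Complex

theorem deriv_of_ne_local {f g : ℝ → ℝ} {x : ℝ} (hev : ∀ᶠ y in 𝓝 x, y ≠ x → HasDerivAt f (g y) y) (hf : ContinuousAt f x) (hg : ContinuousAt g x) :
    HasDerivAt f (g x) x := by
  have e1 : ∀ᶠ y in 𝓝[>] x, HasDerivAt f (g y) y := by
    filter_upwards [nhdsWithin_le_nhds hev, self_mem_nhdsWithin] with y h1 h2 using h1 (ne_of_gt h2)
  have e2 : ∀ᶠ y in 𝓝[<] x, HasDerivAt f (g y) y := by
    filter_upwards [nhdsWithin_le_nhds hev, self_mem_nhdsWithin] with y h1 h2 using h1 (ne_of_lt h2)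
  have A : HasDerivWithinAt f (g x) (Ici x) x :=
    hasDerivWithinAt_Ici_of_tendsto_deriv (s := {y | HasDerivAt f (g y) y}) (fun y hy => hy.differentiableAt.differentiableWithinAt) hf.continuousWithinAt e1
      ((hg.tendsto.mono_left nhdsWithin_le_nhds).congr' (e1.mono fun y hy => hy.deriv.symm))
  have B : HasDerivWithinAt f (g x) (Iic x) x :=
    hasDerivWithinAt_Iic_of_tendsto_deriv (s := {y | HasDerivAt f (g y) y}) (fun y hy => hy.differentiableAt.differentiableWithinAt) hf.continuousWithinAt e2
      ((hg.tendsto.mono_left nhdsWithin_le_nhds).congr' (e2.mono fun y hy => hy.deriv.symm))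
  simpa using B.union A

structure Mov (T : ℝ) (z z1 z2 zt zt1 zt2 : ℝ → ℝ → ℂ) : Prop where
  cz : Continuous fun p : ℝ × ℝ => z p.1 p.2
  cz1 : Continuous fun p : ℝ × ℝ => z1 p.1 p.2
  cz2 : Continuous fun p : ℝ × ℝ => z2 p.1 p.2
  czt : Continuous fun p : ℝ × ℝ => zt p.1 p.2
  czt1 : Continuous fun p : ℝ × ℝ => zt1 p.1 p.2
  czt2 : Continuous fun p : ℝ × ℝ => zt2 p.1 p.2
  d0 : ∀ α t, HasDerivAt (fun a => z a t) (z1 α t) α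
  d1 : ∀ α t, HasDerivAt (fun a => z1 a t) (z2 α t) α
  dt0 : ∀ α t, HasDerivAt (fun a => zt a t) (zt1 α t) α
  e0 : ∀ α, ∀ t ∈ Ioo 0 T, HasDerivAt (fun t => z α t) (zt α t) t
  e1 : ∀ α, ∀ t ∈ Ioo 0 T, HasDerivAt (fun t => z1 α t) (zt1 α t) t
  e2 : ∀ α, ∀ t ∈ Ioo 0 T, HasDerivAt (fun t => z2 α t) (zt2 α t) t
  per : ∀ α t, z (α + 2 * Real.pi) t = z α t + 2 * Real.pi
  pert : ∀ α t, zt (α + 2 * Real.pi) t = zt α t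
  per1t : ∀ α t, zt1 (α + 2 * Real.pi) t = zt1 α t
  per2t : ∀ α t, zt2 (α + 2 * Real.pi) t = zt2 α t
  ne : ∀ α t, z1 α t ≠ 0
  inj : ∀ t, Function.Injective fun α => z α t

def Qw (c : ℝ → ℂ) (F : ℝ → ℝ → ℂ) (α s t : ℝ) : ℂ := ∫ θ in (0:ℝ)..1, c θ * F (α + θ * s) t

theorem Qw_cont {c : ℝ → ℂ} (hc : Continuous c) {F : ℝ → ℝ → ℂ} (hF : Continuous fun p : ℝ × ℝ => F p.1 p.2) :
    Continuous fun p : ℝ × ℝ × ℝ => Qw c F p.1 p.2.1 p.2.2 := by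
  refine intervalIntegral.continuous_parametric_intervalIntegral_of_continuous' (μ := volume)
    (f := fun (p : ℝ × ℝ × ℝ) (θ : ℝ) => c θ * F (p.1 + θ * p.2.1) p.2.2) ?_ _ _
  have := hF.comp (f := fun q : (ℝ × ℝ × ℝ) × ℝ => (q.1.1 + q.2 * q.1.2.1, q.1.2.2)) (by fun_prop)
  simp only [Function.uncurry_def, Function.comp_def] at *
  fun_prop

theorem Qw_dt {c : ℝ → ℂ} (hc : Continuous c) {F F' : ℝ → ℝ → ℂ} {T : ℝ} (hF : Continuous fun p : ℝ × ℝ => F p.1 p.2)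
    (hF' : Continuous fun p : ℝ × ℝ => F' p.1 p.2) (hd : ∀ α, ∀ t ∈ Ioo 0 T, HasDerivAt (fun t => F α t) (F' α t) t) (α s : ℝ) {t : ℝ} (ht : t ∈ Ioo 0 T) :
    HasDerivAt (fun t => Qw c F α s t) (Qw c F' α s t) t := by
  refine hasDerivAt_param (𝕜 := ℝ) (U := Ioo 0 T) isOpen_Ioo (F := fun t θ => c θ * F (α + θ * s) t) (F' := fun t θ => c θ * F' (α + θ * s) t)
    (fun t ht θ _ => (hd _ t ht).const_mul _) (Continuous.continuousOn ?_) (Continuous.continuousOn ?_) ht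
  · have := hF.comp (f := fun q : ℝ × ℝ => (α + q.2 * s, q.1)) (by fun_prop)
    simp only [Function.comp_def] at *
    fun_prop
  · have := hF'.comp (f := fun q : ℝ × ℝ => (α + q.2 * s, q.1)) (by fun_prop)
    simp only [Function.comp_def] at *
    fun_prop

theorem Qw_one {F F1 : ℝ → ℂ} (hd : ∀ α, HasDerivAt F (F1 α) α) (hc : Continuous F1) (α s : ℝ) :
    s * ∫ θ in (0:ℝ)..1, 1 * F1 (α + θ * s) = F (α + s) - F α := by
  have h : ∀ θ ∈ uIcc (0:ℝ) 1, HasDerivAt (fun θ : ℝ => F (α + θ * s)) (s * (1 * F1 (α + θ * s))) θ := by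
    intro θ _
    have := (hd (α + θ * s)).scomp θ (((hasDerivAt_id θ).mul_const s).const_add α)
    simpa [Function.comp_def] using this
  rw [← intervalIntegral.integral_const_mul, intervalIntegral.integral_eq_sub_of_hasDerivAt h (Continuous.intervalIntegrable (by fun_prop) _ _)]
  simp

theorem Qw_two {F1 F2 : ℝ → ℂ} (hd : ∀ α, HasDerivAt F1 (F2 α) α) (hc : Continuous F2) (α s : ℝ) :
    s * ∫ θ in (0:ℝ)..1, (1 - θ : ℂ) * F2 (α + θ * s) = (∫ θ in (0:ℝ)..1, 1 * F1 (α + θ * s)) - F1 α := by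
  have hc1 : Continuous F1 := continuous_iff_continuousAt.2 fun α => (hd α).continuousAt
  have h : ∀ θ ∈ uIcc (0:ℝ) 1, HasDerivAt (fun θ : ℝ => (1 - θ : ℂ) * F1 (α + θ * s)) (s * ((1 - θ : ℂ) * F2 (α + θ * s)) - 1 * F1 (α + θ * s)) θ := by
    intro θ _
    have h1 := (hd (α + θ * s)).scomp θ (((hasDerivAt_id θ).mul_const s).const_add α)
    have h2 : HasDerivAt (fun θ : ℝ => (1 - θ : ℂ)) (-1) θ := by simpa using (hasDerivAt_id θ).ofReal_comp.const_sub (1:ℂ)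
    refine (h2.mul h1).congr_deriv ?_
    simp; ring
  have h3 := intervalIntegral.integral_eq_sub_of_hasDerivAt h (Continuous.intervalIntegrable (by fun_prop) _ _)
  rw [intervalIntegral.integral_sub (Continuous.intervalIntegrable (by fun_prop) _ _) (Continuous.intervalIntegrable (by fun_prop) _ _), intervalIntegral.integral_const_mul] at h3
  simp at h3 ⊢
  linear_combination h3

section
variable (z z1 z2 zt zt1 zt2 : ℝ → ℝ → ℂ)
def cone : ℝ → ℂ := fun _ => 1
def clin : ℝ → ℂ := fun θ => 1 - θ
theorem cone_c : Continuous cone := continuous_const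
theorem clin_c : Continuous clin := by unfold clin; fun_prop
def eZ1 (a t : ℝ) : ℂ := I * z1 a t * eI (z a t)
def eZ2 (a t : ℝ) : ℂ := (I * z2 a t - z1 a t ^ 2) * eI (z a t)
def eZ1t (a t : ℝ) : ℂ := (I * zt1 a t - z1 a t * zt a t) * eI (z a t)
def eZ2t (a t : ℝ) : ℂ := (I * zt2 a t - 2 * z1 a t * zt1 a t + (I * z2 a t - z1 a t ^ 2) * (I * zt a t)) * eI (z a t)
def qq := Qw cone (eZ1 z z1)
def q2 := Qw clin (eZ2 z z1 z2)
def qqt := Qw cone (eZ1t z z1 zt zt1)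
def q2t := Qw clin (eZ2t z z1 z2 zt zt1 zt2)
/-- the regularised kernel -/
def kt (α s t : ℝ) : ℝ := 1 / (4 * Real.pi) * (-z1 α t - 2 * I * (q2 z z1 z2 α s t / qq z z1 α s t)).re
def ktt (α s t : ℝ) : ℝ := 1 / (4 * Real.pi) * (-zt1 α t - 2 * I * ((q2t z z1 z2 zt zt1 zt2 α s t * qq z z1 α s t - q2 z z1 z2 α s t * qqt z z1 zt zt1 α s t) / qq z z1 α s t ^ 2)).re
def mm (α s t : ℝ) : ℝ := 1 / (4 * Real.pi) * (Qw cone zt1 α s t * (2 * eI (z α t) + s * qq z z1 α s t) / qq z z1 α s t).re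
end

namespace Mov
variable {T : ℝ} {z z1 z2 zt zt1 zt2 : ℝ → ℝ → ℂ} (h : Mov T z z1 z2 zt zt1 zt2)
include h

theorem crv (t : ℝ) : Crv (fun α => z α t) (fun α => z1 α t) (fun α => z2 α t) :=
  ⟨fun α => h.d0 α t, fun α => h.d1 α t, h.cz2.comp (by fun_prop : Continuous fun α : ℝ => (α, t)), fun α => h.per α t, fun α => h.ne α t⟩

theorem einj (t α s : ℝ) (hs : |s| < 2 * Real.pi) (h0 : s ≠ 0) : eI (z (α + s) t) ≠ eI (z α t) :=
  inj_of_embed (h.crv t) (h.inj t) α s hs h0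

theorem cez : Continuous fun p : ℝ × ℝ => eI (z p.1 p.2) := eI_cont.comp h.cz
theorem ceZ1 : Continuous fun p : ℝ × ℝ => eZ1 z z1 p.1 p.2 := by have := h.cez; have := h.cz1; unfold eZ1; fun_prop
theorem ceZ2 : Continuous fun p : ℝ × ℝ => eZ2 z z1 z2 p.1 p.2 := by have := h.cez; have := h.cz1; have := h.cz2; unfold eZ2; fun_prop
theorem ceZ1t : Continuous fun p : ℝ × ℝ => eZ1t z z1 zt zt1 p.1 p.2 := by
  have := h.cez; have := h.cz1; have := h.czt; have := h.czt1; unfold eZ1t; fun_prop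
theorem ceZ2t : Continuous fun p : ℝ × ℝ => eZ2t z z1 z2 zt zt1 zt2 p.1 p.2 := by
  have := h.cez; have := h.cz1; have := h.czt; have := h.czt1; have := h.cz2; have := h.czt2; unfold eZ2t; fun_prop

theorem dZ (α t : ℝ) : HasDerivAt (fun a => eI (z a t)) (eZ1 z z1 α t) α := by
  refine ((eI_deriv _).comp_of_eq α (h.d0 α t) rfl).congr_deriv ?_
  unfold eZ1; ring
theorem dZ1 (α t : ℝ) : HasDerivAt (fun a => eZ1 z z1 a t) (eZ2 z z1 z2 α t) α := by
  refine (((h.d1 α t).const_mul I).mul (h.dZ α t)).congr_deriv ?_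
  unfold eZ1 eZ2; linear_combination (z1 α t ^ 2 * eI (z α t)) * I_sq
theorem dZt (α : ℝ) {t : ℝ} (ht : t ∈ Ioo 0 T) : HasDerivAt (fun t => eI (z α t)) (I * eI (z α t) * zt α t) t :=
  (eI_deriv _).comp_of_eq t (h.e0 α t ht) rfl
theorem dZ1t (α : ℝ) : ∀ t ∈ Ioo 0 T, HasDerivAt (fun t => eZ1 z z1 α t) (eZ1t z z1 zt zt1 α t) t := fun t ht => by
  refine (((h.e1 α t ht).const_mul I).mul (h.dZt α ht)).congr_deriv ?_
  unfold eZ1t; linear_combination (z1 α t * zt α t * eI (z α t)) * I_sq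
theorem dZ2t (α : ℝ) : ∀ t ∈ Ioo 0 T, HasDerivAt (fun t => eZ2 z z1 z2 α t) (eZ2t z z1 z2 zt zt1 zt2 α t) t := fun t ht => by
  refine ((((h.e2 α t ht).const_mul I).sub ((h.e1 α t ht).pow 2)).mul (h.dZt α ht)).congr_deriv ?_
  unfold eZ2t; push_cast; simp only [Pi.sub_apply, Pi.pow_apply]; ring

theorem cqq : Continuous fun p : ℝ × ℝ × ℝ => qq z z1 p.1 p.2.1 p.2.2 := Qw_cont cone_c h.ceZ1
theorem cq2 : Continuous fun p : ℝ × ℝ × ℝ => q2 z z1 z2 p.1 p.2.1 p.2.2 := Qw_cont clin_c h.ceZ2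
theorem cqqt : Continuous fun p : ℝ × ℝ × ℝ => qqt z z1 zt zt1 p.1 p.2.1 p.2.2 := Qw_cont cone_c h.ceZ1t
theorem cq2t : Continuous fun p : ℝ × ℝ × ℝ => q2t z z1 z2 zt zt1 zt2 p.1 p.2.1 p.2.2 := Qw_cont clin_c h.ceZ2t

theorem qq_s (α s t : ℝ) : s * qq z z1 α s t = eI (z (α + s) t) - eI (z α t) :=
  Qw_one (F := fun a => eI (z a t)) (F1 := fun a => eZ1 z z1 a t) (fun α => h.dZ α t) (h.ceZ1.comp (by fun_prop : Continuous fun α : ℝ => (α, t))) α s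
theorem q2_s (α s t : ℝ) : s * q2 z z1 z2 α s t = qq z z1 α s t - eZ1 z z1 α t :=
  Qw_two (F1 := fun a => eZ1 z z1 a t) (F2 := fun a => eZ2 z z1 z2 a t) (fun α => h.dZ1 α t) (h.ceZ2.comp (by fun_prop : Continuous fun α : ℝ => (α, t))) α s

theorem qq_ne (α s t : ℝ) (hs : |s| < 2 * Real.pi) : qq z z1 α s t ≠ 0 := by
  by_cases h0 : s = 0
  · subst h0
    simp [qq, Qw, cone, eZ1, h.ne, eI_ne]
  · intro hq
    have := h.qq_s α s t
    rw [hq, mul_zero] at this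
    exact h.einj t α s hs h0 (sub_eq_zero.1 this.symm)

theorem kap_reg (α s t : ℝ) (hs : |s| < 2 * Real.pi) (h0 : s ≠ 0) :
    z1 α t * kap (z α t) (z (α + s) t) = (-z1 α t - 2 * I * (q2 z z1 z2 α s t / qq z z1 α s t)) + 2 * I / s := by
  have h1 := h.qq_s α s t
  have h2 := h.q2_s α s t
  have hq := h.qq_ne α s t hs
  have hs' : (s : ℂ) ≠ 0 := by exact_mod_cast h0
  have h3 : eI (z (α + s) t) = eI (z α t) + s * qq z z1 α s t := by rw [h1]; ring
  rw [kap, h3]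
  have h4 : eI (z α t) - (eI (z α t) + s * qq z z1 α s t) ≠ 0 := by
    rw [sub_add_cancel_left]; exact neg_ne_zero.2 (mul_ne_zero hs' hq)
  unfold eZ1 at h2
  generalize qq z z1 α s t = Q at *
  generalize q2 z z1 z2 α s t = Q2 at *
  have h5 : eI (z α t) - (eI (z α t) + s * Q) = -(s * Q) := by ring
  rw [h5]
  field_simp
  linear_combination (2 * I) * h2 - 2 * z1 α t * eI (z α t) * I_sq

theorem kt_eq (α s t : ℝ) (hs : |s| < 2 * Real.pi) (h0 : s ≠ 0) :
    kt z z1 z2 α s t = 1 / (4 * Real.pi) * (z1 α t * kap (z α t) (z (α + s) t)).re := by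
  rw [h.kap_reg α s t hs h0, add_re, kt]
  have : (2 * I / (s : ℂ)).re = 0 := by rw [div_ofReal_re]; simp
  rw [this, add_zero]

def Dom2 : Set (ℝ × ℝ × ℝ) := {p | |p.2.1| < 2 * Real.pi}

omit h in
theorem dom2_open : IsOpen Dom2 := isOpen_lt (by fun_prop) continuous_const

theorem kt_c : ContinuousOn (fun p : ℝ × ℝ × ℝ => kt z z1 z2 p.1 p.2.1 p.2.2) Dom2 := by
  have a1 : Continuous fun p : ℝ × ℝ × ℝ => z1 p.1 p.2.2 := h.cz1.comp (by fun_prop : Continuous fun p : ℝ × ℝ × ℝ => (p.1, p.2.2))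
  refine continuousOn_const.mul (continuous_re.comp_continuousOn (a1.neg.continuousOn.sub (continuousOn_const.mul ?_)))
  exact h.cq2.continuousOn.div h.cqq.continuousOn fun p hp => h.qq_ne _ _ _ hp

theorem ktt_c : ContinuousOn (fun p : ℝ × ℝ × ℝ => ktt z z1 z2 zt zt1 zt2 p.1 p.2.1 p.2.2) Dom2 := by
  have a1 : Continuous fun p : ℝ × ℝ × ℝ => zt1 p.1 p.2.2 := h.czt1.comp (by fun_prop : Continuous fun p : ℝ × ℝ × ℝ => (p.1, p.2.2))
  refine continuousOn_const.mul (continuous_re.comp_continuousOn (a1.neg.continuousOn.sub (continuousOn_const.mul ?_)))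
  exact (((h.cq2t.mul h.cqq).sub (h.cq2.mul h.cqqt)).continuousOn).div (h.cqq.pow 2).continuousOn fun p hp => pow_ne_zero 2 (h.qq_ne _ _ _ hp)

theorem mm_c : ContinuousOn (fun p : ℝ × ℝ × ℝ => mm z z1 zt1 p.1 p.2.1 p.2.2) Dom2 := by
  have a1 : Continuous fun p : ℝ × ℝ × ℝ => eI (z p.1 p.2.2) := h.cez.comp (by fun_prop : Continuous fun p : ℝ × ℝ × ℝ => (p.1, p.2.2))
  have a2 : Continuous fun p : ℝ × ℝ × ℝ => (p.2.1 : ℂ) := by fun_prop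
  refine continuousOn_const.mul (continuous_re.comp_continuousOn (ContinuousOn.div ?_ h.cqq.continuousOn fun p hp => h.qq_ne _ _ _ hp))
  exact ((Qw_cont cone_c h.czt1).mul ((continuous_const.mul a1).add (a2.mul h.cqq))).continuousOn

theorem kt_dt (α s : ℝ) {t : ℝ} (hs : |s| < 2 * Real.pi) (ht : t ∈ Ioo 0 T) :
    HasDerivAt (fun t => kt z z1 z2 α s t) (ktt z z1 z2 zt zt1 zt2 α s t) t := by
  refine (cre ?_).const_mul _
  refine ((h.e1 α t ht).neg).sub (HasDerivAt.const_mul _ ?_)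
  exact (Qw_dt clin_c h.ceZ2 h.ceZ2t h.dZ2t α s ht).div (Qw_dt cone_c h.ceZ1 h.ceZ1t h.dZ1t α s ht) (h.qq_ne α s t hs)

theorem ktt_eq (α s : ℝ) {t : ℝ} (hs : |s| < 2 * Real.pi) (h0 : s ≠ 0) (ht : t ∈ Ioo 0 T) :
    ktt z z1 z2 zt zt1 zt2 α s t = 1 / (4 * Real.pi) * (zt1 α t * kap (z α t) (z (α + s) t) + z1 α t * (kapx (z α t) (z (α + s) t) * (zt α t - zt (α + s) t))).re := by
  have h1 := h.kt_dt α s hs ht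
  have h2 : (fun t => kt z z1 z2 α s t) = fun t => 1 / (4 * Real.pi) * (z1 α t * kap (z α t) (z (α + s) t)).re :=
    funext fun t => h.kt_eq α s t hs h0
  rw [h2] at h1
  refine h1.unique ((cre ((h.e1 α t ht).mul ?_)).const_mul _)
  have hne := h.einj t α s hs h0
  have hA := h.dZt α ht
  have hB := h.dZt (α + s) ht
  have hn' : eI (z α t) - eI (z (α + s) t) ≠ 0 := sub_ne_zero.2 hne.symm
  refine ((hA.add hB).div (hA.sub hB) hn').congr_deriv ?_
  unfold kapx
  simp only [Pi.add_apply, Pi.sub_apply]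
  field_simp
  ring

theorem mm_eq (α s t : ℝ) (hs : |s| < 2 * Real.pi) (h0 : s ≠ 0) :
    mm z z1 zt1 α s t = 1 / (4 * Real.pi) * ((zt α t - zt (α + s) t) * kap (z α t) (z (α + s) t)).re := by
  have h1 := h.qq_s α s t
  have h2 : s * Qw cone zt1 α s t = zt (α + s) t - zt α t :=
    Qw_one (F := fun a => zt a t) (F1 := fun a => zt1 a t) (fun α => h.dt0 α t) (h.czt1.comp (by fun_prop : Continuous fun α : ℝ => (α, t))) α s
  have hq := h.qq_ne α s t hs
  have hs' : (s : ℂ) ≠ 0 := by exact_mod_cast h0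
  rw [mm, kap]
  congr 2
  have h3 : eI (z (α + s) t) = eI (z α t) + s * qq z z1 α s t := by rw [h1]; ring
  have h4 : zt α t - zt (α + s) t = -(s * Qw cone zt1 α s t) := by rw [h2]; ring
  rw [h3, h4, sub_add_cancel_left]
  field_simp
  ring

/-- `∂_α` of `mm(α, β - α)` is the time derivative of the kernel -/
theorem mm_d (α β : ℝ) {t : ℝ} (hs : |β - α| < 2 * Real.pi) (ht : t ∈ Ioo 0 T) :
    HasDerivAt (fun a => mm z z1 zt1 a (β - a) t) (ktt z z1 z2 zt zt1 zt2 α (β - α) t) α := by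
  have hU : ∀ᶠ a in 𝓝 α, |β - a| < 2 * Real.pi :=
    (isOpen_lt (by fun_prop : Continuous fun a : ℝ => |β - a|) continuous_const).mem_nhds hs
  have key : ∀ a, |β - a| < 2 * Real.pi → a ≠ β → HasDerivAt (fun a => mm z z1 zt1 a (β - a) t) (ktt z z1 z2 zt zt1 zt2 a (β - a) t) a := by
    intro a ha hne
    have hs0 : β - a ≠ 0 := sub_ne_zero.2 hne.symm
    have hev : (fun a => mm z z1 zt1 a (β - a) t) =ᶠ[𝓝 a] fun a => 1 / (4 * Real.pi) * ((zt a t - zt β t) * kap (z a t) (z β t)).re := by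
      have h1 : ∀ᶠ a' in 𝓝 a, |β - a'| < 2 * Real.pi :=
        (isOpen_lt (by fun_prop : Continuous fun a : ℝ => |β - a|) continuous_const).mem_nhds ha
      filter_upwards [h1, isOpen_ne.mem_nhds hne] with a' h1 h2
      rw [h.mm_eq a' (β - a') t h1 (sub_ne_zero.2 (Ne.symm h2)), add_sub_cancel]
    refine HasDerivAt.congr_of_eventuallyEq ?_ hev
    rw [h.ktt_eq a (β - a) ha hs0 ht, add_sub_cancel]
    have hk : eI (z a t) ≠ eI (z β t) := by
      have := h.einj t a (β - a) ha hs0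
      rw [add_sub_cancel] at this; exact this.symm
    refine (cre ((((h.dt0 a t).sub_const _).mul ((kap_dx hk).comp_of_eq a (h.d0 a t) rfl)).congr_deriv ?_)).const_mul _
    simp only [Function.comp_apply]; ring
  by_cases hne : α = β
  · subst hne
    have cc : ∀ {f : ℝ → ℝ → ℝ → ℝ}, ContinuousOn (fun p : ℝ × ℝ × ℝ => f p.1 p.2.1 p.2.2) Dom2 → ContinuousAt (fun a => f a (α - a) t) α := by
      intro f hf
      have : ContinuousAt (fun p : ℝ × ℝ × ℝ => f p.1 p.2.1 p.2.2) (α, α - α, t) := hf.continuousAt (dom2_open.mem_nhds hs)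
      exact ContinuousAt.comp (f := fun a : ℝ => ((a, α - a, t) : ℝ × ℝ × ℝ)) this (by fun_prop)
    exact deriv_of_ne_local (hU.mono fun a ha hn => key a ha hn) (cc h.mm_c) (cc h.ktt_c)
  · exact key α hs hne

omit h in
theorem shift_win {f : ℝ → ℝ} (hp : ∀ β, f (β + 2 * Real.pi) = f β) (a : ℝ) : ∫ β in (0:ℝ)..(2 * Real.pi), f β = ∫ β in (a - Real.pi)..(a + Real.pi), f β := by
  have := Function.Periodic.intervalIntegral_add_eq (f := f) (T := 2 * Real.pi) hp 0 (a - Real.pi)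
  rw [zero_add] at this; rw [this]; congr 1; ring

theorem mper (t α β : ℝ) : (zt α t - zt (β + 2 * Real.pi) t) * kap (z α t) (z (β + 2 * Real.pi) t) = (zt α t - zt β t) * kap (z α t) (z β t) := by
  rw [h.per, h.pert, kap_per_right]

theorem N_eq {w : ℝ → ℝ} (hp : ∀ β, w (β + 2 * Real.pi) = w β) (t a0 : ℝ) {α : ℝ} (ha : |α - a0| < Real.pi) :
    ∫ β in (0:ℝ)..(2 * Real.pi), w β * (1 / (4 * Real.pi) * ((zt α t - zt β t) * kap (z α t) (z β t)).re) =
      ∫ β in (a0 - Real.pi)..(a0 + Real.pi), w β * mm z z1 zt1 α (β - α) t := by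
  rw [shift_win (f := fun β => w β * (1 / (4 * Real.pi) * ((zt α t - zt β t) * kap (z α t) (z β t)).re)) (fun β => by simp only [hp, h.mper]) a0]
  refine intervalIntegral.integral_congr_ae ?_
  filter_upwards [compl_mem_ae_iff.2 (measure_singleton (μ := (volume : Measure ℝ)) α)] with β hβ hmem
  rw [uIoc_of_le (by linarith [Real.pi_pos])] at hmem
  have h1 : |β - α| < 2 * Real.pi := by
    rw [abs_lt] at ha ⊢
    constructor <;> linarith [hmem.1, hmem.2, ha.1, ha.2]
  rw [h.mm_eq α (β - α) t h1 (sub_ne_zero.2 hβ), add_sub_cancel]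

theorem N_d {w : ℝ → ℝ} (hw : Continuous w) (hp : ∀ β, w (β + 2 * Real.pi) = w β) {t : ℝ} (ht : t ∈ Ioo 0 T) (α : ℝ) :
    HasDerivAt (fun α => ∫ β in (0:ℝ)..(2 * Real.pi), w β * (1 / (4 * Real.pi) * ((zt α t - zt β t) * kap (z α t) (z β t)).re))
      (∫ s in (-Real.pi)..Real.pi, ktt z z1 z2 zt zt1 zt2 α s t * w (α + s)) α := by
  have hpi := Real.pi_pos
  have hin : ∀ a ∈ Ioo (α - Real.pi) (α + Real.pi), ∀ β ∈ uIcc (α - Real.pi) (α + Real.pi), |β - a| < 2 * Real.pi := by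
    intro a ha β hb
    rw [uIcc_of_le (by linarith)] at hb
    rw [abs_lt]; constructor <;> linarith [hb.1, hb.2, ha.1, ha.2]
  have hev : (fun α => ∫ β in (0:ℝ)..(2 * Real.pi), w β * (1 / (4 * Real.pi) * ((zt α t - zt β t) * kap (z α t) (z β t)).re)) =ᶠ[𝓝 α]
      fun a => (∫ β in (α - Real.pi)..(α + Real.pi), ((w β * mm z z1 zt1 a (β - a) t : ℝ) : ℂ)).re := by
    filter_upwards [Ioo_mem_nhds (show α - Real.pi < α by linarith) (show α < α + Real.pi by linarith)] with a ha
    rw [h.N_eq hp t α (by rw [abs_lt]; constructor <;> linarith [ha.1, ha.2]), intervalIntegral.integral_ofReal, ofReal_re]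
  refine HasDerivAt.congr_of_eventuallyEq ?_ hev
  have cc : ∀ {f : ℝ → ℝ → ℝ → ℝ}, ContinuousOn (fun p : ℝ × ℝ × ℝ => f p.1 p.2.1 p.2.2) Dom2 →
      ContinuousOn (fun q : ℝ × ℝ => ((w q.2 * f q.1 (q.2 - q.1) t : ℝ) : ℂ)) (Ioo (α - Real.pi) (α + Real.pi) ×ˢ uIcc (α - Real.pi) (α + Real.pi)) := by
    intro f hf
    refine continuous_ofReal.comp_continuousOn ((hw.comp continuous_snd).continuousOn.mul ?_)
    exact hf.comp (f := fun q : ℝ × ℝ => ((q.1, q.2 - q.1, t) : ℝ × ℝ × ℝ)) (by fun_prop) (fun q hq => hin q.1 hq.1 q.2 hq.2)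
  have := cre (hasDerivAt_param (𝕜 := ℝ) (U := Ioo (α - Real.pi) (α + Real.pi)) isOpen_Ioo
    (F := fun a β => ((w β * mm z z1 zt1 a (β - a) t : ℝ) : ℂ)) (F' := fun a β => ((w β * ktt z z1 z2 zt zt1 zt2 a (β - a) t : ℝ) : ℂ))
    (fun a ha β hb => ((h.mm_d a β (hin a ha β hb) ht).const_mul (w β)).ofReal_comp) (cc h.mm_c) (cc h.ktt_c)
    (x := α) (by constructor <;> linarith))
  refine this.congr_deriv ?_
  rw [intervalIntegral.integral_ofReal, ofReal_re]
  have h2 := intervalIntegral.integral_comp_add_left (a := -Real.pi) (b := Real.pi) (fun β : ℝ => w β * ktt z z1 z2 zt zt1 zt2 α (β - α) t) α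
  rw [show α - Real.pi = α + -Real.pi by ring, ← h2]
  refine intervalIntegral.integral_congr fun s _ => ?_
  simp only [add_sub_cancel_left]; ring

theorem Kop_eq (y : ℝ → ℝ) (α t : ℝ) : Kop (fun a => z a t) (fun a => z1 a t) y α = ∫ s in (-Real.pi)..Real.pi, kt z z1 z2 α s t * y (α + s) := by
  rw [Kop, ← intervalIntegral.integral_const_mul]
  refine intervalIntegral.integral_congr_ae ?_
  filter_upwards [compl_mem_ae_iff.2 (measure_singleton (μ := (volume : Measure ℝ)) 0)] with s hs hmem
  rw [uIoc_of_le icle] at hmem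
  have : |s| < 2 * Real.pi := by rw [abs_lt]; constructor <;> linarith [hmem.1, hmem.2, Real.pi_pos]
  rw [h.kt_eq α s t this hs]; ring

theorem per1 (α t : ℝ) : z1 (α + 2 * Real.pi) t = z1 α t := (h.crv t).per1 α
theorem per2 (α t : ℝ) : z2 (α + 2 * Real.pi) t = z2 α t := (h.crv t).per2 α

theorem kt_per (α s t : ℝ) : kt z z1 z2 (α + 2 * Real.pi) s t = kt z z1 z2 α s t := by
  have e : ∀ θ : ℝ, α + 2 * Real.pi + θ * s = (α + θ * s) + 2 * Real.pi := fun θ => by ring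
  simp only [kt, q2, qq, Qw, eZ1, eZ2, e, h.per, h.per1, h.per2, eI_per]

theorem ktt_per (α s t : ℝ) : ktt z z1 z2 zt zt1 zt2 (α + 2 * Real.pi) s t = ktt z z1 z2 zt zt1 zt2 α s t := by
  have e : ∀ θ : ℝ, α + 2 * Real.pi + θ * s = (α + θ * s) + 2 * Real.pi := fun θ => by ring
  simp only [ktt, q2, qq, q2t, qqt, Qw, eZ1, eZ2, eZ1t, eZ2t, e, h.per, h.per1, h.per2, eI_per, h.pert, h.per1t, h.per2t]

theorem omega_reg {r r' : ℝ → ℝ → ℝ} (cr : Continuous fun p : ℝ × ℝ => r p.1 p.2) (cr' : Continuous fun p : ℝ × ℝ => r' p.1 p.2)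
    (pr : ∀ α t, r (α + 2 * Real.pi) t = r α t) (pr' : ∀ α t, r' (α + 2 * Real.pi) t = r' α t)
    (hr : ∀ α, ∀ t ∈ Ioo 0 T, HasDerivAt (fun t => r α t) (r' α t) t)
    (hin : ∀ t (y : ℝ → ℝ), Continuous y → (∀ α, y (α + 2 * Real.pi) = y α) →
      (∀ α, y α + 2 * Kop (fun a => z a t) (fun a => z1 a t) y α = 0) → ∀ α, y α = 0) :
    ∃ w w' : ℝ → ℝ → ℝ, (Continuous fun p : ℝ × ℝ => w p.1 p.2) ∧ (Continuous fun p : ℝ × ℝ => w' p.1 p.2) ∧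
      (∀ α t, w (α + 2 * Real.pi) t = w α t) ∧ (∀ α t, w' (α + 2 * Real.pi) t = w' α t) ∧
      (∀ α t, w α t + 2 * Kop (fun a => z a t) (fun a => z1 a t) (fun a => w a t) α = r α t) ∧
      (∀ α, ∀ t ∈ Ioo 0 T, HasDerivAt (fun t => w α t) (w' α t) t) ∧
      (∀ α, ∀ t ∈ Ioo 0 T, w' α t + 2 * ((∫ s in (-Real.pi)..Real.pi, ktt z z1 z2 zt zt1 zt2 α s t * w (α + s) t) +
        Kop (fun a => z a t) (fun a => z1 a t) (fun a => w' a t) α) = r' α t) := by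
  have hpi := Real.pi_pos
  have hd : ∀ s : IC, |(s:ℝ)| < 2 * Real.pi := fun s => by
    rw [abs_lt]; constructor <;> linarith [s.2.1, s.2.2]
  have cc : ∀ {f : ℝ → ℝ → ℝ → ℝ}, ContinuousOn (fun p : ℝ × ℝ × ℝ => f p.1 p.2.1 p.2.2) Dom2 →
      Continuous (fun p : ℝ × IC × ℝ => f p.1 p.2.1 p.2.2) := by
    intro f hf
    exact hf.comp_continuous (f := fun p : ℝ × IC × ℝ => ((p.1, (p.2.1 : ℝ), p.2.2) : ℝ × ℝ × ℝ)) (by fun_prop) (fun p => hd p.2.1)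
  obtain ⟨k, ck, hk⟩ := liftT_ex (Y := IC) (g := fun α s t => kt z z1 z2 α s t) (cc h.kt_c) (fun α s t => h.kt_per α s t)
  obtain ⟨k', ck', hk'⟩ := liftT_ex (Y := IC) (g := fun α s t => ktt z z1 z2 zt zt1 zt2 α s t) (cc h.ktt_c) (fun α s t => h.ktt_per α s t)
  have rl : ∀ {f : ℝ → ℝ → ℝ}, (Continuous fun p : ℝ × ℝ => f p.1 p.2) → (∀ α t, f (α + 2 * Real.pi) t = f α t) →
      ∃ G : ℝ → C(AC, ℝ), Continuous G ∧ ∀ t (α : ℝ), G t (α : AC) = f α t := by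
    intro f hf hp
    obtain ⟨G, hG, hG2⟩ := liftT_ex (Y := Unit) (g := fun α _ t => f α t) (hf.comp (by fun_prop : Continuous fun p : ℝ × Unit × ℝ => (p.1, p.2.2))) (fun α _ t => hp α t)
    let j : C(AC, AC × Unit) := ⟨fun a => (a, ()), by fun_prop⟩
    exact ⟨fun t => (G t).comp j, (ContinuousMap.continuous_precomp j).comp hG, fun t α => hG2 t α ()⟩
  obtain ⟨R, cR, hR⟩ := rl cr pr
  obtain ⟨R', cR', hR'⟩ := rl cr' pr'
  have hL : ∀ (κ : ℝ → C(AC × IC, ℝ)) (f : ℝ → ℝ → ℝ → ℝ), (∀ t (α : ℝ) (s : IC), κ t ((α : AC), s) = f α s t) → ∀ t (y : C(AC, ℝ)) (α : ℝ),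
      Lop (κ t) y (α : AC) = ∫ s in (-Real.pi)..Real.pi, f α s t * y ((α + s : ℝ) : AC) := by
    intro κ f hκ t y α
    rw [Lop_apply]
    refine intervalIntegral.integral_congr fun s hs => ?_
    rw [uIcc_of_le icle] at hs
    simp only [hκ, prI, projIcc_of_mem icle hs, AddCircle.coe_add]
  have hLk := hL k _ hk
  have hLk' := hL k' _ hk'
  have cm : Continuous fun a : ℝ => (a : AC) := AddCircle.continuous_mk' _
  have pm : ∀ a : ℝ, ((a + 2 * Real.pi : ℝ) : AC) = (a : AC) := fun a => by
    rw [AddCircle.coe_add, AddCircle.coe_period, add_zero]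
  obtain ⟨w, w', cw, cw', e1, e2⟩ := solve (T := T) ck cR ck' cR' (fun t ht => curve_deriv ck' (fun τ hτ p => by
      obtain ⟨a, s⟩ := p
      obtain ⟨α, rfl⟩ := QuotientAddGroup.mk_surjective a
      have := h.kt_dt α s (hd s) hτ
      refine (this.congr_deriv (hk' τ α s).symm).congr_of_eventuallyEq (Eventually.of_forall fun τ => hk τ α s)) t ht)
    (fun t ht => curve_deriv cR' (fun τ hτ a => by
      obtain ⟨α, rfl⟩ := QuotientAddGroup.mk_surjective a
      refine ((hr α τ hτ).congr_deriv (hR' τ α).symm).congr_of_eventuallyEq (Eventually.of_forall fun τ => hR τ α)) t ht)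
    (fun t y hy => by
      have := hin t (fun α => y (α : AC)) (y.continuous.comp cm) (fun α => by simp only [pm]) (fun α => by
        rw [h.Kop_eq, ← hLk t y α]
        exact congrArg (fun f : C(AC, ℝ) => f (α : AC)) hy)
      ext a
      obtain ⟨α, rfl⟩ := QuotientAddGroup.mk_surjective a
      exact this α)
  have joint : ∀ {v : ℝ → C(AC, ℝ)}, Continuous v → Continuous fun p : ℝ × ℝ => v p.2 (p.1 : AC) := by
    intro v hv
    exact (hv.comp continuous_snd).eval (cm.comp continuous_fst)
  refine ⟨fun α t => w t (α : AC), fun α t => w' t (α : AC), joint cw, joint cw', fun α t => by simp only [pm], fun α t => by simp only [pm], ?_, ?_, ?_⟩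
  · intro α t
    rw [h.Kop_eq, ← hLk t (w t) α, ← hR]
    exact congrArg (fun f : C(AC, ℝ) => f (α : AC)) (e1 t)
  · intro α t ht
    exact (ContinuousMap.evalCLM ℝ (α : AC)).hasFDerivAt.comp_hasDerivAt t (e2 t ht).1
  · intro α t ht
    rw [h.Kop_eq, ← hLk t (w' t) α, ← hLk' t (w t) α, ← hR']
    exact congrArg (fun f : C(AC, ℝ) => f (α : AC)) (e2 t ht).2
end Mov
end

section
open Topology Complex

theorem kap_bd {x w : ℂ} {M d : ℝ} (hd : 0 < d) (h : d ≤ ‖eI x - eI w‖) (hM : ‖eI w‖ ≤ M) : ‖kap x w‖ ≤ 1 + 2 * M / d := by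
  have hne : eI x - eI w ≠ 0 := norm_pos_iff.1 (hd.trans_le h)
  have : kap x w = 1 + 2 * eI w / (eI x - eI w) := by
    rw [kap]; field_simp; ring
  rw [this]
  refine (norm_add_le _ _).trans ?_
  rw [norm_one, norm_div, norm_mul, Complex.norm_ofNat]
  have h0 : 0 ≤ M := (norm_nonneg _).trans hM
  have h1 : 0 ≤ 2 * M := by positivity
  gcongr

/-- the limit of the commutator -/
theorem Geo.comm_lim {z z1 z2 : ℝ → ℂ} {c0 C ε0 : ℝ} (g : Geo z z1 z2 c0 C ε0) {y : ℝ → ℝ} (hy : Continuous y) (hp : ∀ α, y (α + 2 * Real.pi) = y α)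
    {p p1 : ℝ → ℂ} (pd : ∀ α, HasDerivAt p (p1 α) α) (pc : Continuous p1) (pp : ∀ α, p (α + 2 * Real.pi) = p α) (α : ℝ) {σ : ℝ} (hσ : σ = 1 ∨ σ = -1) :
    Tendsto (fun ε : ℝ => (Cint z (fun β => (y β : ℂ) * p β) (xe z z1 (σ * ε) α) - p α * Cint z (fun β => (y β : ℂ)) (xe z z1 (σ * ε) α)).re) (𝓝[>] 0)
      (𝓝 (-∫ β in (0:ℝ)..(2 * Real.pi), y β * (1 / (4 * Real.pi) * ((p α - p β) * kap (z α) (z β)).re))) := by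
  have hpi := Real.pi_pos
  have hz := g.toCrv.cz
  have hpcon : Continuous p := continuous_iff_continuousAt.2 fun α => (pd α).continuousAt
  have hσ1 : |σ| = 1 := by rcases hσ with h | h <;> simp [h]
  obtain ⟨M, hM, hMb⟩ := per_bound (f := fun β => eI (z β)) (eI_cont.comp hz) (fun α => by rw [g.per, eI_per])
  have hp1p : ∀ α, p1 (α + 2 * Real.pi) = p1 α := by
    intro a
    have h1 := (pd (a + 2 * Real.pi)).comp_add_const a (2 * Real.pi)
    rw [funext pp] at h1
    exact h1.unique (pd a)
  obtain ⟨L, hL, hLb⟩ := per_bound pc hp1p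
  obtain ⟨Y, hY, hYb⟩ := per_bound (f := fun β => (y β : ℂ)) (by fun_prop) (fun α => by rw [hp])
  have lip : ∀ s, ‖p (α + s) - p α‖ ≤ L * |s| := by
    intro s
    have := Convex.norm_image_sub_le_of_norm_hasDerivWithin_le (s := univ) (fun x _ => (pd x).hasDerivWithinAt)
      (fun x _ => hLb x) convex_univ (mem_univ α) (mem_univ (α + s))
    simpa using this
  have e1 : (-∫ β in (0:ℝ)..(2 * Real.pi), y β * (1 / (4 * Real.pi) * ((p α - p β) * kap (z α) (z β)).re)) =
      ∫ s in (-Real.pi)..Real.pi, 1 / (4 * Real.pi) * (y (α + s) * ((p (α + s) - p α) * kap (z α) (z (α + s))).re) := by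
    rw [Mov.shift_win (f := fun β => y β * (1 / (4 * Real.pi) * ((p α - p β) * kap (z α) (z β)).re)) (fun β => by simp only [hp, pp, g.per, kap_per_right]) α]
    have h2 := intervalIntegral.integral_comp_add_left (a := -Real.pi) (b := Real.pi) (fun β : ℝ => y β * (1 / (4 * Real.pi) * ((p α - p β) * kap (z α) (z β)).re)) α
    rw [show α - Real.pi = α + -Real.pi by ring, ← h2, ← intervalIntegral.integral_neg]
    refine intervalIntegral.integral_congr fun s _ => ?_
    rw [show p α - p (α + s) = -(p (α + s) - p α) by ring, neg_mul, neg_re]; ring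
  rw [e1]
  have hev : ∀ᶠ ε : ℝ in 𝓝[>] 0, 0 < ε ∧ ε ≤ ε0 := by
    filter_upwards [self_mem_nhdsWithin, nhdsWithin_le_nhds (Iic_mem_nhds g.ep)] with ε h1 h2 using ⟨h1, h2⟩
  have hoff : ∀ ε : ℝ, 0 < ε → ε ≤ ε0 → ∀ β, eI (xe z z1 (σ * ε) α) ≠ eI (z β) := by
    intro ε h1 h2 β
    refine g.off (mul_ne_zero (by rcases hσ with h | h <;> simp [h]) h1.ne') ?_ α β
    rw [abs_mul, hσ1, one_mul, abs_of_pos h1]; exact h2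
  have hcont : ∀ ε : ℝ, 0 < ε → ε ≤ ε0 → Continuous fun s => kap (xe z z1 (σ * ε) α) (z (α + s)) := by
    intro ε h1 h2
    rw [← continuousOn_univ]
    exact kap_cont continuousOn_const (Continuous.continuousOn (by fun_prop)) (fun q _ => hoff ε h1 h2 _)
  have e2 : ∀ᶠ ε : ℝ in 𝓝[>] 0, ∫ s in (-Real.pi)..Real.pi, 1 / (4 * Real.pi) * (y (α + s) * ((p (α + s) - p α) * kap (xe z z1 (σ * ε) α) (z (α + s))).re) =
      (Cint z (fun β => (y β : ℂ) * p β) (xe z z1 (σ * ε) α) - p α * Cint z (fun β => (y β : ℂ)) (xe z z1 (σ * ε) α)).re := by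
    filter_upwards [hev] with ε hε
    have hk := hcont ε hε.1 hε.2
    rw [Cint_shift g.toCrv (fun a => by simp only [hp, pp]) _ α, Cint_shift g.toCrv (fun a => by simp only [hp]) _ α]
    have : (1 / (4 * Real.pi) : ℂ) * (∫ s in (-Real.pi)..Real.pi, (y (α + s) : ℂ) * p (α + s) * kap (xe z z1 (σ * ε) α) (z (α + s))) -
        p α * ((1 / (4 * Real.pi)) * ∫ s in (-Real.pi)..Real.pi, (y (α + s) : ℂ) * kap (xe z z1 (σ * ε) α) (z (α + s))) =
        ∫ s in (-Real.pi)..Real.pi, (1 / (4 * Real.pi) : ℂ) * (y (α + s) * ((p (α + s) - p α) * kap (xe z z1 (σ * ε) α) (z (α + s)))) := by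
      rw [← intervalIntegral.integral_const_mul, ← intervalIntegral.integral_const_mul, ← intervalIntegral.integral_const_mul,
        ← intervalIntegral.integral_sub (Continuous.intervalIntegrable (by fun_prop) _ _) (Continuous.intervalIntegrable (by fun_prop) _ _)]
      refine intervalIntegral.integral_congr fun s _ => ?_
      ring
    rw [this]
    have h3 := intervalIntegral.intervalIntegral_re (𝕜 := ℂ) (μ := volume) (a := -Real.pi) (b := Real.pi)
      (f := fun s : ℝ => (1 / (4 * Real.pi) : ℂ) * (y (α + s) * ((p (α + s) - p α) * kap (xe z z1 (σ * ε) α) (z (α + s)))))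
      (Continuous.intervalIntegrable (by fun_prop) _ _)
    refine Eq.trans ?_ h3
    refine intervalIntegral.integral_congr fun s _ => ?_
    simp only [RCLike.re_eq_complex_re]
    rw [show (1 / (4 * Real.pi) : ℂ) = ((1 / (4 * Real.pi) : ℝ) : ℂ) by push_cast; rfl, re_ofReal_mul, re_ofReal_mul]
  refine Tendsto.congr' e2 ?_
  refine intervalIntegral.tendsto_integral_filter_of_dominated_convergence (fun _ => 1 / (4 * Real.pi) * (Y * (L * Real.pi + 2 * M * L / c0))) ?_ ?_ intervalIntegrable_const ?_
  · filter_upwards [hev] with ε hε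
    have hk := hcont ε hε.1 hε.2
    exact (Continuous.aestronglyMeasurable (by fun_prop))
  · filter_upwards [hev] with ε hε
    refine Eventually.of_forall fun s hs => ?_
    rw [uIoc_of_le icle] at hs
    have hs' : |s| ≤ Real.pi := abs_le.2 ⟨hs.1.le, hs.2⟩
    have hle : |σ * ε| ≤ ε0 := by rw [abs_mul, hσ1, one_mul, abs_of_pos hε.1]; exact hε.2
    have h1 := g.low α s (σ * ε) hs' hle
    rw [abs_mul σ, hσ1, one_mul, abs_of_pos hε.1] at h1
    have hc0 := g.c0p
    have h2 := kap_bd (by have := hε.1; positivity) h1 (hMb (α + s))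
    have hY' : |y (α + s)| ≤ Y := by have := hYb (α + s); rwa [Complex.norm_real] at this
    rw [norm_mul, Real.norm_of_nonneg (by positivity), norm_mul]
    refine mul_le_mul_of_nonneg_left (mul_le_mul hY' ?_ (norm_nonneg _) hY.le) (by positivity)
    refine (abs_re_le_norm _).trans ?_
    rw [norm_mul]
    refine (mul_le_mul (lip s) h2 (norm_nonneg _) (by positivity)).trans ?_
    have h4 : |s| / (|s| + ε) ≤ 1 := div_le_one_of_le₀ (by linarith [hε.1]) (by have := hε.1; positivity)
    have : L * |s| * (1 + 2 * M / (c0 * (|s| + ε))) = L * |s| + 2 * M * L / c0 * (|s| / (|s| + ε)) := by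
      have : |s| + ε ≠ 0 := by have := hε.1; positivity
      field_simp
    rw [this]
    have h5 : 0 ≤ 2 * M * L / c0 := by positivity
    nlinarith
  · filter_upwards [compl_mem_ae_iff.2 (measure_singleton (μ := (volume : Measure ℝ)) 0)] with s hs hmem
    rw [uIoc_of_le icle] at hmem
    have hne : eI (z α) ≠ eI (z (α + s)) := (g.inj α s (by rw [abs_lt]; constructor <;> linarith [hmem.1, hmem.2]) hs).symm
    have h1 : ContinuousAt (fun x => kap x (z (α + s))) (z α) := (kap_dx hne).continuousAt
    have h2 : Tendsto (fun ε : ℝ => xe z z1 (σ * ε) α) (𝓝[>] 0) (𝓝 (z α)) := by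
      have : Continuous fun ε : ℝ => xe z z1 (σ * ε) α := by unfold xe; fun_prop
      have h3 := this.tendsto 0
      simp only [xe, mul_zero, ofReal_zero, zero_mul, add_zero] at h3
      exact h3.mono_left nhdsWithin_le_nhds
    exact (((continuous_re.tendsto _).comp ((h1.tendsto.comp h2).const_mul _)).const_mul _).const_mul _

section
variable {z z1 z2 : ℝ → ℂ} {c0 C ε0 s : ℝ} {Ω : Set ℂ}
theorem xe_tend {z z1 : ℝ → ℂ} (σ α : ℝ) : Tendsto (fun ε : ℝ => xe z z1 (σ * ε) α) (𝓝[>] 0) (𝓝 (z α)) := by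
  have : Continuous fun ε : ℝ => xe z z1 (σ * ε) α := by unfold xe; fun_prop
  have h3 := this.tendsto 0
  simp only [xe, mul_zero, ofReal_zero, zero_mul, add_zero] at h3
  exact h3.mono_left nhdsWithin_le_nhds

theorem Side.ev (S : Side z z1 z2 c0 C ε0 Ω s) : ∀ᶠ ε : ℝ in 𝓝[>] 0, 0 < ε ∧ ε ≤ ε0 := by
  filter_upwards [self_mem_nhdsWithin, nhdsWithin_le_nhds (Iic_mem_nhds S.ep)] with ε h1 h2 using ⟨h1, h2⟩

theorem Side.cl_lim (S : Side z z1 z2 c0 C ε0 Ω s) {Y : Type*} [TopologicalSpace Y] {f : ℂ → Y} (hf : ContinuousOn f (closure Ω)) (α : ℝ) :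
    Tendsto (fun ε : ℝ => f (xe z z1 (s * ε) α)) (𝓝[>] 0) (𝓝 (f (z α))) := by
  have hm : z α ∈ closure Ω := by rw [S.cl]; exact Or.inr ⟨α, rfl⟩
  refine (hf (z α) hm).tendsto.comp (tendsto_nhdsWithin_iff.2 ⟨xe_tend s α, ?_⟩)
  filter_upwards [S.ev] with ε hε using subset_closure (S.col α ε hε.1 hε.2)

/-- boundary identity at a fixed time -/
theorem Side.bdry (S : Side z z1 z2 c0 C ε0 Ω s) {w w' : ℝ → ℝ} (hw : Continuous w) (pw : ∀ α, w (α + 2 * Real.pi) = w α)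
    (hw' : Continuous w') (pw' : ∀ α, w' (α + 2 * Real.pi) = w' α) (hK : Continuous (Kop z z1 w'))
    {p p1 : ℝ → ℂ} (pd : ∀ α, HasDerivAt p (p1 α) α) (pc : Continuous p1) (pp : ∀ α, p (α + 2 * Real.pi) = p α)
    {f ft : ℂ → ℂ} (hf : ContinuousOn f (closure Ω)) (hfe : ∀ x ∈ Ω, f x = Cint z (fun β => (w β : ℂ)) x)
    (hft : ∀ x ∈ Ω, ft x = (1 / (4 * Real.pi)) * ∫ β in (0:ℝ)..(2 * Real.pi), ((w' β : ℂ) * kap x (z β) - (w β : ℂ) * p β * kapx x (z β)))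
    {H : ℂ → ℝ} (hH : ContinuousOn H (closure Ω)) {L : ℂ → ℂ →L[ℝ] ℝ} (hd : ∀ x ∈ Ω, HasFDerivAt H (L x) x) (hL : ∀ x ∈ Ω, ∀ v, L x v = (ft x * v).re)
    {dN : ℝ → ℝ} (hN : ∀ α, HasDerivAt (fun α => ∫ β in (0:ℝ)..(2 * Real.pi), w β * (1 / (4 * Real.pi) * ((p α - p β) * kap (z α) (z β)).re)) (dN α) α) (α : ℝ) :
    HasDerivAt (fun α => (p α * f (z α)).re + H (z α)) (-s / 2 * w' α + Kop z z1 w' α + dN α) α := by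
  have hpi := Real.pi_pos
  have hz := S.toCrv.cz
  have hz1 := S.toCrv.c1
  have hz2 := S.c2
  have hpcon : Continuous p := continuous_iff_continuousAt.2 fun α => (pd α).continuousAt
  have hwc : Continuous fun β => (w β : ℂ) := by fun_prop
  have hwc' : Continuous fun β => (w' β : ℂ) := by fun_prop
  have hwp : Continuous fun β => (w β : ℂ) * p β := by fun_prop
  set N : ℝ → ℝ := fun α => ∫ β in (0:ℝ)..(2 * Real.pi), w β * (1 / (4 * Real.pi) * ((p α - p β) * kap (z α) (z β)).re) with hNdef
  have hsne : s ≠ 0 := by rcases S.hs with h | h <;> simp [h]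
  have hs1 : |s| = 1 := by rcases S.hs with h | h <;> simp [h]
  have hσ := S.hs
  have habs : ∀ ε : ℝ, 0 < ε → ε ≤ ε0 → |s * ε| ≤ ε0 := fun ε h1 h2 => by rw [abs_mul, hs1, one_mul, abs_of_pos h1]; exact h2
  -- the identity along the collar curve
  have step : ∀ ε : ℝ, 0 < ε → ε ≤ ε0 → ∀ a, HasDerivAt (fun a => H (xe z z1 (s * ε) a) + (Cint z (fun β => (w β : ℂ) * p β) (xe z z1 (s * ε) a)).re)
      ((Cint z (fun β => (w' β : ℂ)) (xe z z1 (s * ε) a) * (z1 a + I * (s * ε : ℝ) * z2 a)).re) a := by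
    intro ε h1 h2 a
    have hx := S.col a ε h1 h2
    have hxo := S.dj _ hx
    have hg := xe_d S.toCrv (s * ε) a
    have hA : HasDerivAt (fun a => H (xe z z1 (s * ε) a)) (L (xe z z1 (s * ε) a) (z1 a + I * (s * ε : ℝ) * z2 a)) a :=
      (hd _ hx).comp_hasDerivAt a hg
    have hB := cre ((Cint_deriv S.toCrv hwp hxo S.clr).comp_of_eq a hg rfl)
    refine (hA.add hB).congr_deriv ?_
    rw [hL _ hx, ← add_re, hft _ hx]
    congr 1
    have hoff := off_iff S.toCrv hxo
    have hk1 : Continuous fun β => kap (xe z z1 (s * ε) a) (z β) := by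
      rw [← continuousOn_univ]; exact kap_cont continuousOn_const hz.continuousOn (fun q _ => hoff q)
    have hk2 : Continuous fun β => kapx (xe z z1 (s * ε) a) (z β) := by
      rw [← continuousOn_univ]; exact kapx_cont continuousOn_const hz.continuousOn (fun q _ => hoff q)
    rw [intervalIntegral.integral_sub (Continuous.intervalIntegrable (by fun_prop) _ _) (Continuous.intervalIntegrable (by fun_prop) _ _), Cint]
    ring
  have ccont : ∀ ε : ℝ, 0 < ε → ε ≤ ε0 → Continuous fun a => (Cint z (fun β => (w' β : ℂ)) (xe z z1 (s * ε) a)) := by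
    intro ε h1 h2
    refine continuous_iff_continuousAt.2 fun a => ?_
    exact ((Cint_deriv S.toCrv hwc' (S.dj _ (S.col a ε h1 h2)) S.clr).continuousAt).comp_of_eq (xe_d S.toCrv (s * ε) a).continuousAt rfl
  set D : ℝ → ℝ := fun α => (p α * f (z α)).re + H (z α) - N α with hD
  have lim1 : ∀ a, Tendsto (fun ε : ℝ => H (xe z z1 (s * ε) a) + (Cint z (fun β => (w β : ℂ) * p β) (xe z z1 (s * ε) a)).re) (𝓝[>] 0) (𝓝 (D a)) := by
    intro a
    have l1 := S.cl_lim hH a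
    have l2 := S.toGeo.comm_lim hw pw pd pc pp a hσ
    have l3 := (continuous_re.tendsto _).comp ((S.cl_lim hf a).const_mul (p a))
    have l4 := (l1.add l2).add l3
    have : D a = H (z a) + -N a + (p a * f (z a)).re := by simp only [hD]; ring
    rw [this]
    refine l4.congr' ?_
    filter_upwards [S.ev] with ε hε
    simp only [Function.comp_apply]
    rw [hfe _ (S.col a ε hε.1 hε.2), sub_re]; ring
  obtain ⟨B1, hB1, hb1⟩ := S.toGeo.bdd_side hw' pw'
  obtain ⟨B2, hB2, hb2⟩ := S.toGeo.root hwc' (fun α => by rw [pw'])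
  obtain ⟨M, hM, hMb⟩ := per_bound hz2 S.toCrv.per2
  have small : ∀ a ε : ℝ, 0 < ε → ε ≤ ε0 → ‖Cint z (fun β => (w' β : ℂ)) (xe z z1 (s * ε) a) * (I * (s * ε : ℝ) * z2 a)‖ ≤ B2 * M * Real.sqrt ε := by
    intro a ε h1 h2
    have h3 := hb2 a (s * ε) (mul_ne_zero hsne h1.ne') (habs ε h1 h2)
    have h4 : |s * ε| = ε := by rw [abs_mul, hs1, one_mul, abs_of_pos h1]
    rw [h4] at h3
    rw [norm_mul, norm_mul, norm_mul, norm_I, one_mul, norm_real, Real.norm_eq_abs, h4]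
    have h5 : B2 / Real.sqrt ε * (ε * M) = B2 * M * Real.sqrt ε := by
      have h6 := Real.mul_self_sqrt h1.le
      have h7 : Real.sqrt ε ≠ 0 := (Real.sqrt_pos.2 h1).ne'
      field_simp
      rw [Real.sq_sqrt h1.le]
    rw [← h5]
    gcongr
    exact hMb a
  have cfun : ∀ ε : ℝ, Continuous (fun α => Cint z (fun β => (w' β : ℂ)) (xe z z1 (s * ε) α)) →
      Continuous fun α => (Cint z (fun β => (w' β : ℂ)) (xe z z1 (s * ε) α) * (z1 α + I * (s * ε : ℝ) * z2 α)).re := by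
    intro ε h
    exact continuous_re.comp (h.mul (S.toCrv.c1.add (continuous_const.mul S.toCrv.c2)))
  have lim2 : ∀ a b, Tendsto (fun ε : ℝ => ∫ α in a..b, (Cint z (fun β => (w' β : ℂ)) (xe z z1 (s * ε) α) * (z1 α + I * (s * ε : ℝ) * z2 α)).re) (𝓝[>] 0)
      (𝓝 (∫ α in a..b, (-s / 2 * w' α + Kop z z1 w' α))) := by
    intro a b
    refine intervalIntegral.tendsto_integral_filter_of_dominated_convergence (fun _ => B1 + B2 * M * Real.sqrt ε0) ?_ ?_ intervalIntegrable_const ?_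
    · filter_upwards [S.ev] with ε hε
      have := ccont ε hε.1 hε.2
      exact Continuous.aestronglyMeasurable (cfun ε this)
    · filter_upwards [S.ev] with ε hε
      refine Eventually.of_forall fun a _ => ?_
      rw [mul_add, add_re, mul_comm _ (z1 a)]
      refine (norm_add_le _ _).trans (add_le_add (hb1 a (s * ε) (mul_ne_zero hsne hε.1.ne') (habs ε hε.1 hε.2)) ?_)
      refine (abs_re_le_norm _).trans ((small a ε hε.1 hε.2).trans ?_)
      exact mul_le_mul_of_nonneg_left (Real.sqrt_le_sqrt hε.2) (by positivity)
    · refine Eventually.of_forall fun a _ => ?_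
      have l1 := S.toGeo.lim_side hw' pw' a hσ
      have l2 : Tendsto (fun ε : ℝ => (Cint z (fun β => (w' β : ℂ)) (xe z z1 (s * ε) a) * (I * (s * ε : ℝ) * z2 a)).re) (𝓝[>] 0) (𝓝 0) := by
        refine squeeze_zero_norm' (a := fun ε => B2 * M * Real.sqrt ε) ?_ ?_
        · filter_upwards [S.ev] with ε hε using (abs_re_le_norm _).trans (small a ε hε.1 hε.2)
        · have : Continuous fun ε : ℝ => B2 * M * Real.sqrt ε := by fun_prop
          have h3 := this.tendsto 0
          simp only [Real.sqrt_zero, mul_zero] at h3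
          exact h3.mono_left nhdsWithin_le_nhds
      have l3 := l1.add l2
      rw [add_zero] at l3
      refine l3.congr fun ε => ?_
      rw [mul_add, add_re, mul_comm (z1 a)]
  have key : ∀ a b, D b - D a = ∫ α in a..b, (-s / 2 * w' α + Kop z z1 w' α) := by
    intro a b
    refine tendsto_nhds_unique (((lim1 b).sub (lim1 a)).congr' ?_) (lim2 a b)
    filter_upwards [S.ev] with ε hε
    have := ccont ε hε.1 hε.2
    exact (intervalIntegral.integral_eq_sub_of_hasDerivAt (fun x _ => step ε hε.1 hε.2 x) (Continuous.intervalIntegrable (cfun ε this) _ _)).symm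
  have hDd : HasDerivAt D (-s / 2 * w' α + Kop z z1 w' α) α := by
    have h1 : Continuous fun α => -s / 2 * w' α + Kop z z1 w' α := by fun_prop
    have h2 := (intervalIntegral.integral_hasDerivAt_right (h1.intervalIntegrable 0 α) (h1.stronglyMeasurableAtFilter _ _) h1.continuousAt)
    have h3 := h2.const_add (D 0)
    refine h3.congr_of_eventuallyEq (Eventually.of_forall fun b => ?_)
    simp only
    rw [← key 0 b]; ring
  refine (hDd.add (hN α)).congr_of_eventuallyEq (Eventually.of_forall fun b => ?_)
  simp only [hD, Pi.add_apply, hNdef]; ring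
end
end

section
open Topology Complex
section
variable {z z1 z2 : ℝ → ℂ} {c0 C ε0 : ℝ} {Ω Ω1 Ω2 : Set ℂ} {s : ℝ}

theorem Side.zmem (S : Side z z1 z2 c0 C ε0 Ω s) (α : ℝ) : z α ∈ closure Ω := by
  rw [S.cl]; exact Or.inr ⟨α, rfl⟩

theorem Side.fz_c (S : Side z z1 z2 c0 C ε0 Ω s) {f : ℂ → ℂ} (hf : ContinuousOn f (closure Ω)) : Continuous fun α => f (z α) :=
  hf.comp_continuous S.toCrv.cz S.zmem

theorem Side.fz_per (S : Side z z1 z2 c0 C ε0 Ω s) {f : ℂ → ℂ} (F : Fld Ω s f) (α : ℝ) : f (z (α + 2 * Real.pi)) = f (z α) := by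
  refine tendsto_nhds_unique (S.cl_lim F.con _) ((S.cl_lim F.con α).congr' ?_)
  filter_upwards [S.ev] with ε hε
  rw [← F.per _ (S.col α ε hε.1 hε.2), xe_per S.toCrv]

theorem rep_both (S1 : Side z z1 z2 c0 C ε0 Ω1 (-1)) (S2 : Side z z1 z2 c0 C ε0 Ω2 1) (dj : Disjoint Ω1 Ω2)
    {f1 f2 : ℂ → ℂ} (F1 : Fld Ω1 (-1) f1) (F2 : Fld Ω2 1 f2) {y : ℝ → ℝ} (hy : ∀ α, (f1 (z α) - f2 (z α)) * z1 α = (y α : ℂ)) :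
    Continuous y ∧ (∀ α, y (α + 2 * Real.pi) = y α) ∧ (∀ x ∈ Ω1, f1 x = Cint z (fun β => (y β : ℂ)) x) ∧
      (∀ x ∈ Ω2, f2 x = Cint z (fun β => (y β : ℂ)) x) ∧ ∀ α, y α + 2 * Kop z z1 y α = 2 * (z1 α * f1 (z α)).re := by
  have hz := S1.toCrv.cz
  have h1 := S1.toCrv.c1
  have c1 := S1.fz_c F1.con
  have c2 := S2.fz_c F2.con
  have yre : y = fun α => ((f1 (z α) - f2 (z α)) * z1 α).re := by ext α; rw [hy, ofReal_re]
  have yc : Continuous y := by rw [yre]; exact continuous_re.comp ((c1.sub c2).mul h1)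
  have yp : ∀ α, y (α + 2 * Real.pi) = y α := by
    intro α; simp only [yre, S1.fz_per F1, S2.fz_per F2, S1.toCrv.per1]
  have lin : ∀ x, x ∉ range z → Cint z (fun β => (y β : ℂ)) x = Cint z (fun β => f1 (z β) * z1 β) x - Cint z (fun β => f2 (z β) * z1 β) x := by
    intro x hx
    have hk : Continuous fun β => kap x (z β) := by
      rw [← continuousOn_univ]
      exact kap_cont continuousOn_const hz.continuousOn fun β _ => off_iff S1.toCrv hx β
    rw [Cint, Cint, Cint, ← mul_sub, ← intervalIntegral.integral_sub (Continuous.intervalIntegrable (by exact (c1.mul h1).mul hk) _ _) (Continuous.intervalIntegrable (by exact (c2.mul h1).mul hk) _ _)]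
    congr 1
    refine intervalIntegral.integral_congr fun β _ => ?_
    simp only [← hy]; ring
  have e1 : ∀ x ∈ Ω1, f1 x = Cint z (fun β => (y β : ℂ)) x := by
    intro x hx
    have : x ∉ closure Ω2 := by
      rw [S2.cl]; rintro (h | h)
      · exact disjoint_left.1 dj hx h
      · exact S1.dj x hx h
    rw [lin x (S1.dj x hx), S1.rep_in F1 hx, S2.rep_out F2 this]; push_cast; ring
  have e2 : ∀ x ∈ Ω2, f2 x = Cint z (fun β => (y β : ℂ)) x := by
    intro x hx
    have : x ∉ closure Ω1 := by
      rw [S1.cl]; rintro (h | h)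
      · exact disjoint_left.1 dj h hx
      · exact S2.dj x hx h
    rw [lin x (S2.dj x hx), S2.rep_in F2 hx, S1.rep_out F1 this]; push_cast; ring
  refine ⟨yc, yp, e1, e2, fun α => ?_⟩
  have l1 := S1.toGeo.lim_side yc yp α (σ := -1) (Or.inr rfl)
  have l2 := (S1.cl_lim F1.con α)
  have l3 : Tendsto (fun ε : ℝ => (z1 α * f1 (xe z z1 (-1 * ε) α)).re) (𝓝[>] 0) (𝓝 (z1 α * f1 (z α)).re) :=
    (continuous_re.tendsto _).comp (l2.const_mul _)
  have := tendsto_nhds_unique (l1.congr' (f₂ := fun ε : ℝ => (z1 α * f1 (xe z z1 (-1 * ε) α)).re) ?_) l3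
  · rw [← this]; ring
  · filter_upwards [S1.ev] with ε hε
    rw [e1 _ (S1.col α ε hε.1 hε.2)]
end

section
variable {T : ℝ} {z z1 z2 zt zt1 zt2 : ℝ → ℝ → ℂ}

theorem Mov.near_off (h : Mov T z z1 z2 zt zt1 zt2) {t : ℝ} {x : ℂ} (hx : x ∉ range fun a => z a t) :
    ∀ᶠ τ in 𝓝 t, ∀ β, eI x ≠ eI (z β τ) := by
  have hc : Continuous fun q : ℝ × ℝ => eI (z q.1 q.2) := eI_cont.comp h.cz
  have h1 : ∀ᶠ τ in 𝓝 t, ∀ β ∈ Icc 0 (2 * Real.pi), eI x ≠ eI (z β τ) := by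
    refine isCompact_Icc.eventually_forall_of_forall_eventually fun β _ => ?_
    have h2 : IsOpen {q : ℝ × ℝ | eI x ≠ eI (z q.2 q.1)} := isOpen_ne_fun continuous_const (hc.comp continuous_swap)
    exact h2.mem_nhds (off_iff (h.crv t) hx β)
  filter_upwards [h1] with τ hτ β
  obtain ⟨n, hn⟩ := red β
  have h3 := hτ _ hn
  have h4 := (h.crv τ).perInt n β
  rw [h4] at h3
  refine fun h5 => h3 (h5.trans (eI_eq_iff.2 ⟨-n, ?_⟩))
  push_cast; ring

theorem Mov.cint_dt (h : Mov T z z1 z2 zt zt1 zt2) {y y' : ℝ → ℝ → ℂ} (cy : Continuous fun p : ℝ × ℝ => y p.1 p.2) (cy' : Continuous fun p : ℝ × ℝ => y' p.1 p.2)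
    (dy : ∀ α, ∀ t ∈ Ioo 0 T, HasDerivAt (fun t => y α t) (y' α t) t) {t : ℝ} (ht : t ∈ Ioo 0 T) {x : ℂ} (hx : x ∉ range fun a => z a t) :
    HasDerivAt (fun t => Cint (fun a => z a t) (fun a => y a t) x)
      ((1 / (4 * Real.pi)) * ∫ β in (0:ℝ)..(2 * Real.pi), (y' β t * kap x (z β t) - y β t * zt β t * kapx x (z β t))) t := by
  obtain ⟨U, hU, hUo, htU⟩ := mem_nhds_iff.1 ((h.near_off hx).and (isOpen_Ioo.mem_nhds ht))
  have c1 : ContinuousOn (fun q : ℝ × ℝ => kap x (z q.2 q.1)) (U ×ˢ uIcc 0 (2 * Real.pi)) :=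
    kap_cont continuousOn_const (h.cz.comp continuous_swap).continuousOn fun q hq => (hU hq.1).1 _
  have c2 : ContinuousOn (fun q : ℝ × ℝ => kapx x (z q.2 q.1)) (U ×ˢ uIcc 0 (2 * Real.pi)) :=
    kapx_cont continuousOn_const (h.cz.comp continuous_swap).continuousOn fun q hq => (hU hq.1).1 _
  have c3 := (cy.comp continuous_swap).continuousOn (s := U ×ˢ uIcc 0 (2 * Real.pi))
  have c4 := (cy'.comp continuous_swap).continuousOn (s := U ×ˢ uIcc 0 (2 * Real.pi))
  have c5 := (h.czt.comp continuous_swap).continuousOn (s := U ×ˢ uIcc 0 (2 * Real.pi))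
  have := hasDerivAt_param (𝕜 := ℝ) hUo (a := 0) (b := 2 * Real.pi) (F := fun τ β => y β τ * kap x (z β τ))
    (F' := fun τ β => y' β τ * kap x (z β τ) - y β τ * zt β τ * kapx x (z β τ)) (fun τ hτ β _ => ?_) (c3.mul c1) ((c4.mul c1).sub ((c3.mul c5).mul c2)) htU
  · exact this.const_mul _
  · have h1 := (kap_dw ((hU hτ).1 β)).comp τ (h.e0 β τ (hU hτ).2)
    refine ((dy β τ (hU hτ).2).mul h1).congr_deriv ?_
    simp only [Function.comp]; ring

theorem Mov.stay (h : Mov T z z1 z2 zt zt1 zt2) {Ω Ω' : ℝ → Set ℂ} {s : ℝ} (hs : s ≠ 0) {t : ℝ} (ht : t ∈ Ioo 0 T)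
    (un : ∀ t x, x ∈ Ω t ∨ x ∈ Ω' t ∨ x ∈ range fun a => z a t) (off : ∀ x ∈ Ω t, x ∉ range fun a => z a t)
    (h1 : ∀ t, ∀ x ∈ Ω t, Cint (fun a => z a t) (fun a => z1 a t) x = -s / 2) (h2 : ∀ t, ∀ x ∈ Ω' t, Cint (fun a => z a t) (fun a => z1 a t) x = s / 2)
    {x : ℂ} (hx : x ∈ Ω t) : ∀ᶠ τ in 𝓝 t, x ∈ Ω τ := by
  have hc := (h.cint_dt h.cz1 h.czt1 h.e1 ht (off x hx)).continuousAt
  have h3 : ∀ᶠ τ in 𝓝 t, Cint (fun a => z a τ) (fun a => z1 a τ) x ≠ s / 2 := by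
    refine hc.eventually_ne ?_
    rw [h1 t x hx]
    intro h4
    have : (s : ℂ) = 0 := by linear_combination -h4
    exact hs (by exact_mod_cast this)
  filter_upwards [h3, h.near_off (off x hx)] with τ a b
  rcases un τ x with c | c | ⟨β, c⟩
  · exact c
  · exact absurd (h2 τ x c) a
  · exact absurd (congrArg eI c).symm (b β)

theorem Mov.kp_c (h : Mov T z z1 z2 zt zt1 zt2) (t : ℝ) : Continuous fun p : ℝ × ℝ => kt z z1 z2 p.1 (prI p.2) t := by
  refine h.kt_c.comp_continuous (f := fun p : ℝ × ℝ => (p.1, ((prI p.2 : ℝ), t))) ?_ fun p => ?_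
  · have := prI_c; fun_prop
  · have := (prI p.2).2
    have hp := Real.pi_pos
    simp only [Dom2, mem_ofPred_eq, abs_lt]
    constructor <;> linarith [this.1, this.2]

theorem Mov.Kop_p (h : Mov T z z1 z2 zt zt1 zt2) (y : ℝ → ℝ) (t α : ℝ) :
    Kop (fun a => z a t) (fun a => z1 a t) y α = ∫ s in (-Real.pi)..Real.pi, kt z z1 z2 α (prI s) t * y (α + s) := by
  rw [h.Kop_eq]
  refine intervalIntegral.integral_congr fun s hs => ?_
  rw [uIcc_of_le icle] at hs
  simp only [prI, projIcc_of_mem icle hs]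

theorem Mov.Kop_c (h : Mov T z z1 z2 zt zt1 zt2) {y : ℝ → ℝ} (hy : Continuous y) (t : ℝ) : Continuous (Kop (fun a => z a t) (fun a => z1 a t) y) := by
  rw [funext (h.Kop_p y t)]
  have := h.kp_c t
  exact intervalIntegral.continuous_parametric_intervalIntegral_of_continuous' (this.mul (by fun_prop)) _ _

theorem Mov.Kop_sub (h : Mov T z z1 z2 zt zt1 zt2) {y y' : ℝ → ℝ} (hy : Continuous y) (hy' : Continuous y') (t α : ℝ) :
    Kop (fun a => z a t) (fun a => z1 a t) (fun a => y a - y' a) α = Kop (fun a => z a t) (fun a => z1 a t) y α - Kop (fun a => z a t) (fun a => z1 a t) y' α := by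
  have h1 : Continuous fun s : ℝ => kt z z1 z2 α (prI s) t := (h.kp_c t).comp (by fun_prop : Continuous fun s : ℝ => (α, s))
  rw [h.Kop_p, h.Kop_p, h.Kop_p, ← intervalIntegral.integral_sub (Continuous.intervalIntegrable (by fun_prop) _ _) (Continuous.intervalIntegrable (by fun_prop) _ _)]
  refine intervalIntegral.integral_congr fun s _ => ?_
  ring

/-- the complexified two-fluid system -/
structure CFlow (T : ℝ) (z z1 z2 zt zt1 zt2 : ℝ → ℝ → ℂ) (Ω1 Ω2 : ℝ → Set ℂ) (f1 f2 : ℂ → ℝ → ℂ) (Q1 Q2 : ℂ → ℝ → ℝ) (r r' : ℝ → ℝ → ℝ) : Prop where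
  mov : Mov T z z1 z2 zt zt1 zt2
  dom : ∀ t, Dom (fun a => z a t) (Ω1 t) (Ω2 t)
  F1 : ∀ t, Fld (Ω1 t) (-1) fun x => f1 x t
  F2 : ∀ t, Fld (Ω2 t) 1 fun x => f2 x t
  kin : ∀ α t, ((f1 (z α t) t - f2 (z α t) t) * z1 α t).im = 0
  rdef : ∀ α t, r α t = 2 * (z1 α t * f1 (z α t) t).re
  cr : Continuous fun p : ℝ × ℝ => r p.1 p.2
  cr' : Continuous fun p : ℝ × ℝ => r' p.1 p.2
  pr' : ∀ α t, r' (α + 2 * Real.pi) t = r' α t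
  hr : ∀ α, ∀ t ∈ Ioo 0 T, HasDerivAt (fun t => r α t) (r' α t) t
  qc1 : ∀ t ∈ Ioo 0 T, ContinuousOn (fun x => Q1 x t) (closure (Ω1 t))
  qc2 : ∀ t ∈ Ioo 0 T, ContinuousOn (fun x => Q2 x t) (closure (Ω2 t))
  eu1 : ∀ t ∈ Ioo 0 T, ∀ x ∈ Ω1 t, ∃ L : ℂ →L[ℝ] ℝ, HasFDerivAt (fun x => Q1 x t) L x ∧ ∀ v, L v = (deriv (fun τ => f1 x τ) t * v).re
  eu2 : ∀ t ∈ Ioo 0 T, ∀ x ∈ Ω2 t, ∃ L : ℂ →L[ℝ] ℝ, HasFDerivAt (fun x => Q2 x t) L x ∧ ∀ v, L v = (deriv (fun τ => f2 x τ) t * v).re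

theorem CFlow.main {Ω1 Ω2 : ℝ → Set ℂ} {f1 f2 : ℂ → ℝ → ℂ} {Q1 Q2 : ℂ → ℝ → ℝ} {r r' : ℝ → ℝ → ℝ}
    (h : CFlow T z z1 z2 zt zt1 zt2 Ω1 Ω2 f1 f2 Q1 Q2 r r') :
    ∃ w w' : ℝ → ℝ → ℝ, (Continuous fun p : ℝ × ℝ => w p.1 p.2) ∧ (Continuous fun p : ℝ × ℝ => w' p.1 p.2) ∧
      (∀ α t, w (α + 2 * Real.pi) t = w α t) ∧
      (∀ α t, (f1 (z α t) t - f2 (z α t) t) * z1 α t = (w α t : ℂ)) ∧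
      (∀ α, ∀ t ∈ Ioo 0 T, HasDerivAt (fun t => w α t) (w' α t) t) ∧
      (∀ α, ∀ t ∈ Ioo 0 T, HasDerivAt (fun α => (zt α t * f1 (z α t) t).re + Q1 (z α t) t) (r' α t / 2) α) ∧
      (∀ α, ∀ t ∈ Ioo 0 T, HasDerivAt (fun α => (zt α t * f2 (z α t) t).re + Q2 (z α t) t) (r' α t / 2 - w' α t) α) := by
  have M := h.mov
  have hS : ∀ t, ∃ c0 C ε0, Side (fun a => z a t) (fun a => z1 a t) (fun a => z2 a t) c0 C ε0 (Ω1 t) (-1) ∧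
      Side (fun a => z a t) (fun a => z1 a t) (fun a => z2 a t) c0 C ε0 (Ω2 t) 1 := by
    intro t
    obtain ⟨c0, C, ε0, g⟩ := geo (M.crv t) (M.inj t)
    exact ⟨c0, C, ε0, sides g (h.dom t)⟩
  choose c0 C ε0 S using hS
  have hy : ∀ α t, (f1 (z α t) t - f2 (z α t) t) * z1 α t = ((((f1 (z α t) t - f2 (z α t) t) * z1 α t).re : ℝ) : ℂ) := by
    intro α t
    apply Complex.ext
    · rw [ofReal_re]
    · rw [ofReal_im, h.kin]
  have B := fun t => rep_both (S t).1 (S t).2 (h.dom t).dj12 (h.F1 t) (h.F2 t) (fun α => hy α t)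
  have hin : ∀ t (y : ℝ → ℝ), Continuous y → (∀ α, y (α + 2 * Real.pi) = y α) →
      (∀ α, y α + 2 * Kop (fun a => z a t) (fun a => z1 a t) y α = 0) → ∀ α, y α = 0 :=
    fun t y a b c => ker_trivial (S t).1 (S t).2 a b c
  obtain ⟨w, w', cw, cw', pw, pw', hw, dw, hw'⟩ := M.omega_reg h.cr h.cr'
    (fun α t => by rw [h.rdef, h.rdef, (S t).1.fz_per (h.F1 t), M.per1]) h.pr' h.hr hin
  have cwt : ∀ t, Continuous fun a => w a t := fun t => cw.comp (by fun_prop : Continuous fun a : ℝ => (a, t))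
  have cwt' : ∀ t, Continuous fun a => w' a t := fun t => cw'.comp (by fun_prop : Continuous fun a : ℝ => (a, t))
  have weq : ∀ α t, ((f1 (z α t) t - f2 (z α t) t) * z1 α t).re = w α t := by
    intro α t
    obtain ⟨b1, b2, _, _, b5⟩ := B t
    have := hin t (fun α => ((f1 (z α t) t - f2 (z α t) t) * z1 α t).re - w α t) (b1.sub (cwt t)) (fun α => by
      have h1 := b2 α
      simp only [h1, pw]) ?_ α
    · linarith
    · intro α
      rw [M.Kop_sub b1 (cwt t)]
      have h2 := b5 α
      have h3 := hw α t
      have h4 := h.rdef α t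
      linarith
  have hweq : ∀ α t, (f1 (z α t) t - f2 (z α t) t) * z1 α t = (w α t : ℂ) := fun α t => by rw [hy, weq]
  have B := fun t => rep_both (S t).1 (S t).2 (h.dom t).dj12 (h.F1 t) (h.F2 t) (fun α => hweq α t)
  have dwc : ∀ α, ∀ t ∈ Ioo 0 T, HasDerivAt (fun t => (w α t : ℂ)) (w' α t : ℂ) t := fun α t ht => (dw α t ht).ofReal_comp
  have un : ∀ t x, x ∈ Ω1 t ∨ x ∈ Ω2 t ∨ x ∈ range fun a => z a t := by
    intro t x
    have := (h.dom t).un.symm.subset (mem_univ x)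
    exact or_assoc.1 this
  have st1 : ∀ t ∈ Ioo 0 T, ∀ x ∈ Ω1 t, ∀ᶠ τ in 𝓝 t, x ∈ Ω1 τ := fun t ht x hx =>
    M.stay (s := -1) (by norm_num) ht un ((S t).1.dj) (fun t => (S t).1.one) (fun t x hx => by rw [(S t).2.one x hx]; push_cast; ring) hx
  have st2 : ∀ t ∈ Ioo 0 T, ∀ x ∈ Ω2 t, ∀ᶠ τ in 𝓝 t, x ∈ Ω2 τ := fun t ht x hx =>
    M.stay (s := 1) (by norm_num) ht (fun t x => or_left_comm.1 (un t x)) ((S t).2.dj) (fun t => (S t).2.one) (fun t x hx => by rw [(S t).1.one x hx]; push_cast; ring) hx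
  have ft1 : ∀ t ∈ Ioo 0 T, ∀ x ∈ Ω1 t, deriv (fun τ => f1 x τ) t =
      (1 / (4 * Real.pi)) * ∫ β in (0:ℝ)..(2 * Real.pi), ((w' β t : ℂ) * kap x (z β t) - (w β t : ℂ) * zt β t * kapx x (z β t)) := by
    intro t ht x hx
    have k := M.cint_dt (y := fun α t => (w α t : ℂ)) (y' := fun α t => (w' α t : ℂ)) (continuous_ofReal.comp cw) (continuous_ofReal.comp cw') dwc ht ((S t).1.dj x hx)
    refine (k.congr_of_eventuallyEq ?_).deriv
    filter_upwards [st1 t ht x hx] with τ hτ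
    exact (B τ).2.2.1 x hτ
  have ft2 : ∀ t ∈ Ioo 0 T, ∀ x ∈ Ω2 t, deriv (fun τ => f2 x τ) t =
      (1 / (4 * Real.pi)) * ∫ β in (0:ℝ)..(2 * Real.pi), ((w' β t : ℂ) * kap x (z β t) - (w β t : ℂ) * zt β t * kapx x (z β t)) := by
    intro t ht x hx
    have k := M.cint_dt (y := fun α t => (w α t : ℂ)) (y' := fun α t => (w' α t : ℂ)) (continuous_ofReal.comp cw) (continuous_ofReal.comp cw') dwc ht ((S t).2.dj x hx)
    refine (k.congr_of_eventuallyEq ?_).deriv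
    filter_upwards [st2 t ht x hx] with τ hτ
    exact (B τ).2.2.2.1 x hτ
  have czt1 : ∀ t, Continuous fun a => zt1 a t := fun t => M.czt1.comp (by fun_prop : Continuous fun a : ℝ => (a, t))
  refine ⟨w, w', cw, cw', pw, hweq, dw, fun α t ht => ?_, fun α t ht => ?_⟩
  · classical
    choose! L hL1 hL2 using h.eu1 t ht
    refine ((S t).1.bdry (cwt t) (fun α => pw α t) (cwt' t) (fun α => pw' α t) (M.Kop_c (cwt' t) t) (fun α => M.dt0 α t) (czt1 t) (fun α => M.pert α t)
      (h.F1 t).con (B t).2.2.1 (ft1 t ht) (h.qc1 t ht) hL1 hL2 (fun α => M.N_d (cwt t) (fun α => pw α t) ht α) α).congr_deriv ?_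
    have := hw' α t ht
    linarith
  · choose! L hL1 hL2 using h.eu2 t ht
    refine ((S t).2.bdry (cwt t) (fun α => pw α t) (cwt' t) (fun α => pw' α t) (M.Kop_c (cwt' t) t) (fun α => M.dt0 α t) (czt1 t) (fun α => M.pert α t)
      (h.F2 t).con (B t).2.2.2.1 (ft2 t ht) (h.qc2 t ht) hL1 hL2 (fun α => M.N_d (cwt t) (fun α => pw α t) ht α) α).congr_deriv ?_
    have := hw' α t ht
    linarith
end
end

section
open Topology Complex

theorem max_pr {T K M0 : ℝ} (hT : 0 < T) {Y Y' : ℝ → ℝ → ℝ} (cY : Continuous fun p : ℝ × ℝ => Y p.1 p.2)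
    (pY : ∀ α t, Y (α + 2 * Real.pi) t = Y α t) (h0 : ∀ α t, 0 ≤ Y α t) (hi : ∀ α, Y α 0 ≤ M0)
    (hd : ∀ α, ∀ t ∈ Ioo 0 T, HasDerivAt (fun t => Y α t) (Y' α t) t)
    (hm : ∀ α, ∀ t ∈ Ioo 0 T, (∀ β, Y β t ≤ Y α t) → Y' α t ≤ K * (1 + Y α t)) {t : ℝ} (ht : t ∈ Icc 0 T) (α : ℝ) :
    (1 + Y α t) * Real.exp (-(K + 1) * t) ≤ 1 + M0 := by
  set φ : ℝ → ℝ → ℝ := fun α t => (1 + Y α t) * Real.exp (-(K + 1) * t) with hφ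
  have cφ : Continuous fun p : ℝ × ℝ => φ p.1 p.2 := by simp only [hφ]; fun_prop
  have main : Ico 0 T ⊆ {t | φ α t ≤ 1 + M0} := by
    intro T' hT'
    obtain ⟨⟨a, t0⟩, hm0, hmax⟩ := (isCompact_Icc.prod isCompact_Icc).exists_isMaxOn (s := Icc 0 (2 * Real.pi) ×ˢ Icc 0 T')
      ⟨(0, 0), ⟨⟨le_rfl, Real.two_pi_pos.le⟩, ⟨le_rfl, hT'.1⟩⟩⟩ cφ.continuousOn
    have hmax' : ∀ β, ∀ τ ∈ Icc 0 T', φ β τ ≤ φ a t0 := by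
      intro β τ hτ
      obtain ⟨n, hn⟩ := red β
      have hp : Function.Periodic (fun x => φ x τ) (2 * Real.pi) := fun x => by simp only [hφ, pY]
      have h1 := hp.int_mul n β
      rw [← h1]
      exact hmax (mk_mem_prod hn hτ)
    refine (hmax' α T' ⟨hT'.1, le_rfl⟩).trans ?_
    obtain ⟨-, ht0⟩ := hm0
    simp only at ht0
    rcases ht0.1.eq_or_lt with h | h
    · rw [← h]; simp only [hφ, mul_zero, Real.exp_zero, mul_one]; linarith [hi a]
    exfalso
    have htI : t0 ∈ Ioo 0 T := ⟨h, ht0.2.trans_lt hT'.2⟩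
    have h1 := hm a t0 htI fun β => by
      have := hmax' β t0 ht0
      simp only [hφ] at this
      linarith [le_of_mul_le_mul_right this (Real.exp_pos _)]
    have h2 : HasDerivAt (fun t => φ a t) (Y' a t0 * Real.exp (-(K + 1) * t0) + (1 + Y a t0) * (Real.exp (-(K + 1) * t0) * (-(K + 1)))) t0 := by
      refine ((hd a t0 htI).const_add 1).mul ?_
      simpa using ((hasDerivAt_id t0).const_mul (-(K + 1))).exp
    have h3 : Y' a t0 * Real.exp (-(K + 1) * t0) + (1 + Y a t0) * (Real.exp (-(K + 1) * t0) * (-(K + 1))) < 0 := by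
      have : Y' a t0 - (K + 1) * (1 + Y a t0) < 0 := by nlinarith [h0 a t0]
      nlinarith [mul_pos_of_neg_of_neg this (neg_lt_zero.2 (Real.exp_pos (-(K + 1) * t0)))]
    have h4 := h2.tendsto_slope
    have h5 : ∀ᶠ τ in 𝓝[<] t0, slope (fun t => φ a t) t0 τ < 0 :=
      (h4.mono_left (nhdsWithin_mono _ fun x (hx : x < t0) => hx.ne)).eventually_lt_const h3
    obtain ⟨τ, h6, h7⟩ := (h5.and (Ioo_mem_nhdsLT h)).exists
    have h8 := hmax' a τ ⟨h7.1.le, h7.2.le.trans ht0.2⟩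
    rw [slope_def_field] at h6
    have h9 : 0 ≤ (φ a τ - φ a t0) / (τ - t0) := div_nonneg_of_nonpos (by linarith) (by linarith [h7.2])
    linarith
  have hcl : IsClosed {t | φ α t ≤ 1 + M0} := isClosed_le (cφ.comp (by fun_prop : Continuous fun t : ℝ => (α, t))) continuous_const
  have := hcl.closure_subset_iff.2 main
  rw [closure_Ico hT.ne] at this
  exact this ht

/-- bounded with bounded derivative at a point -/
def Bd (B : ℝ) (f : ℝ → ℂ) (α : ℝ) : Prop := ∃ f', HasDerivAt f f' α ∧ ‖f α‖ ≤ B ∧ ‖f'‖ ≤ B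

namespace Bd
variable {B C : ℝ} {f g : ℝ → ℂ} {α : ℝ}
theorem pos (h : Bd B f α) : 0 ≤ B := by obtain ⟨_, _, h, _⟩ := h; exact (norm_nonneg _).trans h
theorem mul (hf : Bd B f α) (hg : Bd C g α) : Bd (2 * B * C) (fun a => f a * g a) α := by
  have hB := hf.pos
  have hC := hg.pos
  obtain ⟨f', f1, f2, f3⟩ := hf
  obtain ⟨g', g1, g2, g3⟩ := hg
  have k1 := mul_le_mul f2 g2 (norm_nonneg _) hB
  have k2 := mul_le_mul f3 g2 (norm_nonneg _) hB
  have k3 := mul_le_mul f2 g3 (norm_nonneg _) hB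
  have k4 := mul_nonneg hB hC
  refine ⟨_, f1.mul g1, ?_, ?_⟩
  · simp only [norm_mul]; linarith
  · refine (norm_add_le _ _).trans ?_
    simp only [norm_mul]; linarith
theorem add (hf : Bd B f α) (hg : Bd C g α) : Bd (B + C) (fun a => f a + g a) α := by
  obtain ⟨f', f1, f2, f3⟩ := hf
  obtain ⟨g', g1, g2, g3⟩ := hg
  exact ⟨_, f1.add g1, (norm_add_le _ _).trans (add_le_add f2 g2), (norm_add_le _ _).trans (add_le_add f3 g3)⟩
theorem conj (hf : Bd B f α) : Bd B (fun a => starRingEnd ℂ (f a)) α := by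
  obtain ⟨f', f1, f2, f3⟩ := hf
  refine ⟨starRingEnd ℂ f', ?_, by simpa using f2, by simpa using f3⟩
  exact (Complex.conjCLE : ℂ →L[ℝ] ℂ).hasFDerivAt.comp_hasDerivAt α f1
theorem re (hf : Bd B f α) : Bd B (fun a => ((f a).re : ℂ)) α := by
  obtain ⟨f', f1, f2, f3⟩ := hf
  exact ⟨_, (cre f1).ofReal_comp, by rw [norm_real]; exact (abs_re_le_norm _).trans f2, by rw [norm_real]; exact (abs_re_le_norm _).trans f3⟩
theorem im (hf : Bd B f α) : Bd B (fun a => ((f a).im : ℂ)) α := by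
  obtain ⟨f', f1, f2, f3⟩ := hf
  exact ⟨_, (cim f1).ofReal_comp, by rw [norm_real]; exact (abs_im_le_norm _).trans f2, by rw [norm_real]; exact (abs_im_le_norm _).trans f3⟩
theorem smul (c : ℝ) (hf : Bd B f α) : Bd (|c| * B) (fun a => (c : ℂ) * f a) α := by
  obtain ⟨f', f1, f2, f3⟩ := hf
  refine ⟨_, f1.const_mul _, ?_, ?_⟩ <;> rw [norm_mul, norm_real, Real.norm_eq_abs] <;> gcongr
theorem inv (hf : Bd B f α) (hC : 0 < C) (h : C⁻¹ ≤ ‖f α‖) : Bd (C + B * C ^ 2) (fun a => (f a)⁻¹) α := by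
  have hB := hf.pos
  obtain ⟨f', f1, f2, f3⟩ := hf
  have h0 : 0 < ‖f α‖ := (inv_pos.2 hC).trans_le h
  have h1 : ‖f α‖⁻¹ ≤ C := inv_le_of_inv_le₀ hC h
  refine ⟨_, f1.fun_inv (norm_pos_iff.1 h0), ?_, ?_⟩
  · rw [norm_inv]; nlinarith [mul_nonneg hB (sq_nonneg C)]
  · rw [norm_div, norm_neg, norm_pow, div_eq_mul_inv, ← inv_pow]
    have : ‖f'‖ * ‖f α‖⁻¹ ^ 2 ≤ B * C ^ 2 := by gcongr
    linarith
theorem norm (hf : Bd B f α) (h0 : f α ≠ 0) : Bd B (fun a => ((‖f a‖ : ℝ) : ℂ)) α := by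
  obtain ⟨f', f1, f2, f3⟩ := hf
  have hd := (DifferentiableAt.norm ℝ f1.differentiableAt h0).hasDerivAt
  refine ⟨_, hd.ofReal_comp, by simpa using f2, ?_⟩
  rw [norm_real]
  have h1 : HasDerivAt (fun a => ‖f a‖ ^ 2) (2 * inner ℝ (f α) f') α := f1.norm_sq
  have h2 := (hd.pow 2).unique h1
  have h3 := abs_real_inner_le_norm (f α) f'
  have h4 := norm_pos_iff.2 h0
  simp only [Nat.cast_ofNat, Nat.add_one_sub_one, pow_one] at h2
  have h5 : ‖f α‖ * |deriv (fun a => ‖f a‖) α| = |inner ℝ (f α) f'| := by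
    rw [← abs_of_pos h4, ← abs_mul]; congr 1; linarith
  rw [Real.norm_eq_abs]
  refine le_trans ?_ f3
  rw [← h5] at h3
  exact le_of_mul_le_mul_left h3 h4
end Bd

theorem S0_bd (B c1 c2 c3 : ℝ) (hB : 0 < B) : ∃ K, ∀ (ζ z1 z2 zt V : ℝ → ℂ) (α : ℝ), Bd B ζ α → Bd B z1 α → Bd B z2 α → Bd B zt α → Bd B V α → B⁻¹ ≤ ‖z1 α‖ →
    Bd K (fun a => ((-1 : ℝ) : ℂ) * ((((z1 a * V a).im : ℝ) : ℂ) * (((zt a * (z1 a)⁻¹).im : ℝ) : ℂ)) +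
      ((-1 / 2 : ℝ) : ℂ) * (((((z1 a * V a).im : ℝ) : ℂ) * (((z1 a * V a).im : ℝ) : ℂ)) * ((((‖z1 a‖ : ℝ) : ℂ))⁻¹ * (((‖z1 a‖ : ℝ) : ℂ))⁻¹)) +
      ((c1 : ℝ) : ℂ) * (((-1 : ℝ) : ℂ) * (((zt a * V a).re : ℝ) : ℂ) + ((1 / 2 : ℝ) : ℂ) * (starRingEnd ℂ (V a) * V a)) +
      (c2 : ℂ) * ζ a + (c3 : ℂ) * ((((starRingEnd ℂ (z1 a) * z2 a).im : ℝ) : ℂ) * ((((‖z1 a‖ : ℝ) : ℂ))⁻¹ * ((((‖z1 a‖ : ℝ) : ℂ))⁻¹ * (((‖z1 a‖ : ℝ) : ℂ))⁻¹)))) α :=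
  ⟨_, fun _ _ _ _ _ _ hζ h1 h2 ht hV hl =>
    have h0 := norm_pos_iff.1 ((inv_pos.2 hB).trans_le hl)
    have n := (h1.norm h0).inv hB (by rwa [norm_real, norm_norm])
    have m := (h1.mul hV).im
    ((((((m.mul (ht.mul (h1.inv hB hl)).im).smul (-1)).add (((m.mul m).mul (n.mul n)).smul (-1 / 2))).add
      ((((ht.mul hV).re.smul (-1)).add ((hV.conj.mul hV).smul (1 / 2))).smul c1)).add (hζ.smul c2)).add (((h1.conj.mul h2).im.mul (n.mul (n.mul n))).smul c3))⟩

theorem Yt_bd {W Wa Wt a a' D E Ea Et k B : ℝ} (hE : 0 < E) (hl : E⁻¹ ≤ B ^ 2) (ha : |a| ≤ k) (ha' : |a'| ≤ k) (hD : |D| ≤ k) (hEa : |Ea| ≤ 2 * B ^ 2) (hEt : |Et| ≤ 2 * B ^ 2)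
    (h1 : Wt = Wa * a + W * a' + D) (h2 : (2 * W * Wa * E - W ^ 2 * Ea) / E ^ 2 = 0) :
    (2 * W * Wt * E - W ^ 2 * Et) / E ^ 2 ≤ (2 * k * B ^ 4 + 2 * k + 2 * B ^ 4 + 1 + B ^ 2 * k ^ 2) * (1 + W ^ 2 / E) := by
  have hk : 0 ≤ k := (abs_nonneg _).trans ha
  set e := E⁻¹ with he
  have he0 : 0 < e := inv_pos.2 hE
  have hEe : E * e = 1 := mul_inv_cancel₀ hE.ne'
  set y := W ^ 2 * e with hy
  have hy0 : 0 ≤ y := by positivity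
  have e1 : (2 * W * Wt * E - W ^ 2 * Et) / E ^ 2 = 2 * W * Wt * e - y * e * Et := by
    rw [hy, he]; field_simp
  have e2 : 2 * W * Wa * e = y * e * Ea := by
    rw [hy, he]; field_simp at h2 ⊢; linarith
  have e3 : W ^ 2 / E = y := by rw [hy, he]; field_simp
  rw [e1, e3, h1]
  have e4 : 2 * W * (Wa * a + W * a' + D) * e - y * e * Et = y * (a * e * Ea + 2 * a' - e * Et) + 2 * W * D * e := by
    have : 2 * W * (Wa * a + W * a' + D) * e = a * (2 * W * Wa * e) + 2 * y * a' + 2 * W * D * e := by rw [hy]; ring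
    rw [this, e2]; ring
  rw [e4]
  have b1 : a * e * Ea ≤ 2 * k * B ^ 4 := by
    refine (le_abs_self _).trans ?_
    rw [abs_mul, abs_mul, abs_of_pos he0]
    calc |a| * e * |Ea| ≤ k * B ^ 2 * (2 * B ^ 2) := by gcongr
      _ = _ := by ring
  have b2 : -(e * Et) ≤ 2 * B ^ 4 := by
    refine (neg_le_abs _).trans ?_
    rw [abs_mul, abs_of_pos he0]
    calc e * |Et| ≤ B ^ 2 * (2 * B ^ 2) := by gcongr
      _ = _ := by ring
  have b3 : a' ≤ k := (le_abs_self _).trans ha'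
  have b4 : 2 * W * D * e ≤ y + B ^ 2 * k ^ 2 := by
    have h3 : D ^ 2 ≤ k ^ 2 := sq_le_sq' (by linarith [neg_le_of_abs_le hD]) ((le_abs_self _).trans hD)
    have h4 : e * D ^ 2 ≤ B ^ 2 * k ^ 2 := by gcongr
    have h5 : 2 * W * D * e ≤ W ^ 2 * e + e * D ^ 2 := by nlinarith [mul_nonneg he0.le (sq_nonneg (W - D))]
    linarith
  have b5 : y * (a * e * Ea + 2 * a' - e * Et) ≤ y * (2 * k * B ^ 4 + 2 * k + 2 * B ^ 4) := by
    apply mul_le_mul_of_nonneg_left _ hy0; linarith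
  have p1 : 0 ≤ 2 * k * B ^ 4 + 2 * k + 2 * B ^ 4 := by positivity
  have p2 : 0 ≤ B ^ 2 * k ^ 2 * y := by positivity
  nlinarith
end

section
open Topology Complex

theorem esq {f : ℝ → ℂ} {f' : ℂ} {x B : ℝ} (h : HasDerivAt f f' x) (h1 : ‖f x‖ ≤ B) (h2 : ‖f'‖ ≤ B) :
    HasDerivAt (fun a => ‖f a‖ ^ 2) (2 * inner ℝ (f x) f') x ∧ |2 * inner ℝ (f x) f'| ≤ 2 * B ^ 2 := by
  refine ⟨h.norm_sq, ?_⟩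
  rw [abs_mul, abs_two]
  have h3 := abs_real_inner_le_norm (f x) f'
  have h4 := mul_le_mul h1 h2 (norm_nonneg _) ((norm_nonneg _).trans h1)
  nlinarith

theorem id_pt {z1 z2 zt V1 V2 : ℂ} {W y p1 p2 ρ1 ρ2 g σ : ℝ} (hz : z1 ≠ 0) (hρ1 : 0 < ρ1) (hρ2 : 0 < ρ2)
    (h : z1 * V2 = (W : ℂ) + I * ((z1 * V1).im : ℝ)) (hj : p2 - p1 = -σ * (starRingEnd ℂ z1 * z2).im / ‖z1‖ ^ 3) :
    (zt * V2).re + (-p2 / ρ2 - g * y - ‖V2‖ ^ 2 / 2) = W * (zt * z1⁻¹).re - W ^ 2 / ‖z1‖ ^ 2 / 2 +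
    (((-1 : ℝ) : ℂ) * ((((z1 * V1).im : ℝ) : ℂ) * (((zt * z1⁻¹).im : ℝ) : ℂ)) +
      ((-1 / 2 : ℝ) : ℂ) * (((((z1 * V1).im : ℝ) : ℂ) * (((z1 * V1).im : ℝ) : ℂ)) * ((((‖z1‖ : ℝ) : ℂ))⁻¹ * (((‖z1‖ : ℝ) : ℂ))⁻¹)) +
      ((ρ1 / ρ2 : ℝ) : ℂ) * (((-1 : ℝ) : ℂ) * (((zt * V1).re : ℝ) : ℂ) + ((1 / 2 : ℝ) : ℂ) * (starRingEnd ℂ V1 * V1)) +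
      ((ρ1 / ρ2 * g - g : ℝ) : ℂ) * (y : ℂ) + ((σ / ρ2 : ℝ) : ℂ) * ((((starRingEnd ℂ z1 * z2).im : ℝ) : ℂ) * ((((‖z1‖ : ℝ) : ℂ))⁻¹ * ((((‖z1‖ : ℝ) : ℂ))⁻¹ * (((‖z1‖ : ℝ) : ℂ))⁻¹)))).re +
    ρ1 / ρ2 * ((zt * V1).re + (-p1 / ρ1 - g * y - ‖V1‖ ^ 2 / 2)) := by
  have n0 : ‖z1‖ ≠ 0 := norm_ne_zero_iff.2 hz
  have e0 : starRingEnd ℂ V1 * V1 = ((‖V1‖ ^ 2 : ℝ) : ℂ) := by rw [mul_comm, mul_conj, normSq_eq_norm_sq]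
  rw [e0]
  generalize (z1 * V1).im = m at *
  have e1 : zt * V2 = (zt * z1⁻¹) * ((W : ℂ) + I * (m : ℝ)) := by rw [← h]; field_simp
  have e2 : ‖V2‖ ^ 2 = (W ^ 2 + m ^ 2) / ‖z1‖ ^ 2 := by
    have : ‖z1‖ ^ 2 * ‖V2‖ ^ 2 = W ^ 2 + m ^ 2 := by
      rw [← mul_pow, ← norm_mul, h, ← normSq_eq_norm_sq, normSq_apply]; simp; ring
    rw [← this]; field_simp
  have e3 : p2 = p1 + -σ * (starRingEnd ℂ z1 * z2).im / ‖z1‖ ^ 3 := by linarith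
  rw [e1, e2, e3]
  generalize (starRingEnd ℂ z1 * z2).im = κ
  generalize zt * z1⁻¹ = q
  generalize (zt * V1).re = x
  generalize ‖z1‖ = n at *
  generalize ‖V1‖ = v
  simp only [← ofReal_inv, ← ofReal_mul, ← ofReal_add, ofReal_re]
  simp only [mul_re, add_re, add_im, ofReal_re, ofReal_im, mul_im, I_re, I_im]
  field_simp
  ring

theorem CFlow.bound (B σ g ρ1 ρ2 T : ℝ) (hB : 0 < B) (hT : 0 < T) (hρ1 : 0 < ρ1) (hρ2 : 0 < ρ2) :
    ∃ C, ∀ (z z1 z2 zt zt1 zt2 : ℝ → ℝ → ℂ) (Ω1 Ω2 : ℝ → Set ℂ) (f1 f2 : ℂ → ℝ → ℂ) (Q1 Q2 : ℂ → ℝ → ℝ) (r r' p1 p2 : ℝ → ℝ → ℝ)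
    (_ : CFlow T z z1 z2 zt zt1 zt2 Ω1 Ω2 f1 f2 Q1 Q2 r r')
    (_ : ∀ α t, |(z α t).im| ≤ B) (_ : ∀ α t, ‖z1 α t‖ ≤ B) (_ : ∀ α t, ‖z2 α t‖ ≤ B) (_ : ∀ α t, ‖zt α t‖ ≤ B) (_ : ∀ α t, ‖zt1 α t‖ ≤ B)
    (_ : ∀ α t, B⁻¹ ≤ ‖z1 α t‖) (_ : ∀ α, ∀ t ∈ Ioo 0 T, ∃ z3, HasDerivAt (fun a => z2 a t) z3 α ∧ ‖z3‖ ≤ B)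
    (_ : ∀ α, ∀ t ∈ Ioo 0 T, Bd B (fun a => f1 (z a t) t) α) (_ : ∀ α t, |r α t| ≤ B) (_ : ∀ α t, |r' α t| ≤ B)
    (_ : ∀ α, ∀ t ∈ Ioo 0 T, DifferentiableAt ℝ (fun a => f2 (z a t) t) α)
    (_ : ∀ α, ∀ t ∈ Ioo 0 T, Q1 (z α t) t = -p1 α t / ρ1 - g * (z α t).im - ‖f1 (z α t) t‖ ^ 2 / 2)
    (_ : ∀ α, ∀ t ∈ Ioo 0 T, Q2 (z α t) t = -p2 α t / ρ2 - g * (z α t).im - ‖f2 (z α t) t‖ ^ 2 / 2)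
    (_ : ∀ α, ∀ t ∈ Ioo 0 T, p2 α t - p1 α t = -σ * (starRingEnd ℂ (z1 α t) * z2 α t).im / ‖z1 α t‖ ^ 3)
    (_ : ∀ α, ‖f2 (z α 0) 0‖ ≤ B), ∀ t ∈ Icc 0 T, ∀ α, ‖(f1 (z α t) t - f2 (z α t) t) * z1 α t‖ ≤ C := by
  obtain ⟨KS, hKS⟩ := S0_bd B (ρ1 / ρ2) (ρ1 / ρ2 * g - g) (σ / ρ2) hB
  set k := 2 * B * (B + B * B ^ 2) + |KS| + ρ1 / ρ2 * B with hk
  set K := 2 * k * B ^ 4 + 2 * k + 2 * B ^ 4 + 1 + B ^ 2 * k ^ 2 with hK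
  refine ⟨B + (B ^ 2 * ((1 + B ^ 2) * Real.exp (|K + 1| * T)) + 1), ?_⟩
  intro z z1 z2 zt zt1 zt2 Ω1 Ω2 f1 f2 Q1 Q2 r r' p1 p2 h him hz1 hz2 hzt hzt1 hlo hz3 hV1 hr hr' hV2 hQ1 hQ2 hj hini t ht α
  have M := h.mov
  obtain ⟨w, w', cw, cw', pw, hw, dw, hR1, hR2⟩ := h.main
  set W : ℝ → ℝ → ℝ := fun α t => r α t / 2 - w α t with hW
  have ne : ∀ α t, ‖z1 α t‖ ≠ 0 := fun α t => norm_ne_zero_iff.2 (M.ne α t)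
  have hWV : ∀ α t, z1 α t * f2 (z α t) t = (W α t : ℂ) + I * ((z1 α t * f1 (z α t) t).im : ℝ) := by
    intro α t
    have h1 := hw α t
    have h2 := h.rdef α t
    have h3 : z1 α t * f2 (z α t) t = z1 α t * f1 (z α t) t - (w α t : ℂ) := by rw [← h1]; ring
    rw [h3]
    apply Complex.ext
    · simp [hW, h2]
    · simp
  have hWre : ∀ α t, W α t = (z1 α t * f2 (z α t) t).re := fun α t => by rw [hWV]; simp
  set Y : ℝ → ℝ → ℝ := fun α t => W α t ^ 2 / ‖z1 α t‖ ^ 2 with hY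
  have cr := h.cr
  have cz1 := M.cz1
  have cY : Continuous fun p : ℝ × ℝ => Y p.1 p.2 := by
    simp only [hY, hW]
    exact Continuous.div (by fun_prop) (by fun_prop) fun p => pow_ne_zero 2 (ne _ _)
  have pr : ∀ α t, r (α + 2 * Real.pi) t = r α t := by
    intro α t
    obtain ⟨c0, C, ε0, G⟩ := geo (M.crv t) (M.inj t)
    rw [h.rdef, h.rdef, (sides G (h.dom t)).1.fz_per (h.F1 t), M.per1]
  have pY : ∀ α t, Y (α + 2 * Real.pi) t = Y α t := fun α t => by simp only [hY, hW, pr, pw, M.per1]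
  have dW : ∀ α, ∀ t ∈ Ioo 0 T, HasDerivAt (fun t => W α t) (r' α t / 2 - w' α t) t :=
    fun α t ht => ((h.hr α t ht).div_const 2).sub (dw α t ht)
  have dY : ∀ α, ∀ t ∈ Ioo 0 T, HasDerivAt (fun t => Y α t) ((2 * W α t * (r' α t / 2 - w' α t) * ‖z1 α t‖ ^ 2 - W α t ^ 2 * (2 * inner ℝ (z1 α t) (zt1 α t))) / (‖z1 α t‖ ^ 2) ^ 2) t := by
    intro α t ht
    refine (((dW α t ht).fun_pow 2).fun_div (M.e1 α t ht).norm_sq (pow_ne_zero 2 (ne α t))).congr_deriv ?_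
    simp
  have hi : ∀ α, Y α 0 ≤ B ^ 2 := by
    intro α
    simp only [hY]
    rw [← div_pow, ← sq_abs]
    refine pow_le_pow_left₀ (abs_nonneg _) ?_ 2
    rw [abs_div, abs_norm, div_le_iff₀ (norm_pos_iff.2 (M.ne α 0)), hWre]
    refine (abs_re_le_norm _).trans ?_
    rw [norm_mul, mul_comm]
    exact mul_le_mul_of_nonneg_right (hini α) (norm_nonneg _)
  have hm : ∀ α, ∀ t ∈ Ioo 0 T, (∀ β, Y β t ≤ Y α t) → (2 * W α t * (r' α t / 2 - w' α t) * ‖z1 α t‖ ^ 2 - W α t ^ 2 * (2 * inner ℝ (z1 α t) (zt1 α t))) / (‖z1 α t‖ ^ 2) ^ 2 ≤ K * (1 + Y α t) := by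
    intro α t ht hmax
    have bz1 : Bd B (fun a => z1 a t) α := ⟨_, M.d1 α t, hz1 α t, hz2 α t⟩
    have bzt : Bd B (fun a => zt a t) α := ⟨_, M.dt0 α t, hzt α t, hzt1 α t⟩
    have bz2 : Bd B (fun a => z2 a t) α := by obtain ⟨z3, a, b⟩ := hz3 α t ht; exact ⟨z3, a, hz2 α t, b⟩
    have bζ : Bd B (fun a => ((z a t).im : ℂ)) α := ⟨_, (cim (M.d0 α t)).ofReal_comp, by rw [norm_real]; exact him α t,
      by rw [norm_real]; exact (abs_im_le_norm _).trans (hz1 α t)⟩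
    obtain ⟨S', dS, -, bS⟩ := hKS _ _ _ _ _ α bζ bz1 bz2 bzt (hV1 α t ht) (hlo α t)
    obtain ⟨q', dq, bq, bq'⟩ := bzt.mul (bz1.inv hB (hlo α t))
    obtain ⟨Wa, dWa⟩ : ∃ Wa, HasDerivAt (fun a => W a t) Wa α := by
      refine ⟨_, (cre ((M.d1 α t).mul (hV2 α t ht).hasDerivAt)).congr_of_eventuallyEq (Eventually.of_forall fun a => hWre a t)⟩
    have dYa : HasDerivAt (fun a => Y a t) ((2 * W α t * Wa * ‖z1 α t‖ ^ 2 - W α t ^ 2 * (2 * inner ℝ (z1 α t) (z2 α t))) / (‖z1 α t‖ ^ 2) ^ 2) α := by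
      refine ((dWa.fun_pow 2).fun_div (M.d1 α t).norm_sq (pow_ne_zero 2 (ne α t))).congr_deriv ?_
      simp
    have hY0 := (IsLocalMax.hasDerivAt_eq_zero (f := fun a => Y a t) (Eventually.of_forall hmax) dYa)
    have dS' := cre dS
    have dq' := cre dq
    have d2 := (((dWa.mul dq').sub (dYa.div_const 2)).add dS').add ((hR1 α t ht).const_mul (ρ1 / ρ2))
    have key := (hR2 α t ht).unique (d2.congr_of_eventuallyEq (Eventually.of_forall fun a => ?_))
    · refine Yt_bd (by have := norm_pos_iff.2 (M.ne α t); positivity) ?_ (a := (zt α t * (z1 α t)⁻¹).re) (a' := q'.re) (D := S'.re + ρ1 / ρ2 * (r' α t / 2)) ?_ ?_ ?_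
        (esq (M.d1 α t) (hz1 α t) (hz2 α t)).2 (esq (M.e1 α t ht) (hz1 α t) (hzt1 α t)).2 (Wa := Wa) ?_ hY0
      · rw [← inv_pow]
        refine pow_le_pow_left₀ (by positivity) (inv_le_of_inv_le₀ hB (hlo α t)) 2
      · refine (abs_re_le_norm _).trans (bq.trans ?_)
        have : 0 ≤ ρ1 / ρ2 * B := by positivity
        linarith [abs_nonneg KS]
      · refine (abs_re_le_norm _).trans (bq'.trans ?_)
        have : 0 ≤ ρ1 / ρ2 * B := by positivity
        linarith [abs_nonneg KS]
      · have b1 := (abs_re_le_norm _).trans (bS.trans (le_abs_self KS))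
        have b2 : |ρ1 / ρ2 * (r' α t / 2)| ≤ ρ1 / ρ2 * B := by
          rw [abs_mul, abs_of_pos (div_pos hρ1 hρ2), abs_div, abs_two]
          gcongr
          linarith [hr' α t, abs_nonneg (r' α t)]
        have b3 : 0 ≤ 2 * B * (B + B * B ^ 2) := by positivity
        exact (abs_add_le _ _).trans (by linarith)
      · rw [hY0] at key
        linarith
    · simp only [Pi.add_apply, Pi.sub_apply, Pi.mul_apply, hY]
      rw [hQ1 a t ht, hQ2 a t ht]
      exact id_pt (M.ne a t) hρ1 hρ2 (hWV a t) (hj a t ht)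
  have fin := max_pr hT cY pY (fun α t => by simp only [hY]; positivity) hi dY hm ht α
  have hx : Real.exp (-(K + 1) * t) * Real.exp (|K + 1| * T) ≥ 1 := by
    rw [← Real.exp_add, ge_iff_le, Real.one_le_exp_iff]
    have := mul_le_mul (le_abs_self (K + 1)) ht.2 ht.1 (abs_nonneg _)
    linarith
  have f1 : Y α t ≤ (1 + B ^ 2) * Real.exp (|K + 1| * T) := by
    have y0 : 0 ≤ Y α t := by simp only [hY]; positivity
    have := mul_le_mul_of_nonneg_right fin (Real.exp_pos (|K + 1| * T)).le
    nlinarith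
  have f2 : W α t ^ 2 ≤ B ^ 2 * ((1 + B ^ 2) * Real.exp (|K + 1| * T)) := by
    have : W α t ^ 2 = ‖z1 α t‖ ^ 2 * Y α t := by simp only [hY]; have := ne α t; field_simp
    rw [this]
    exact mul_le_mul (pow_le_pow_left₀ (norm_nonneg _) (hz1 α t) 2) f1 (by simp only [hY]; positivity) (by positivity)
  rw [hw, norm_real, Real.norm_eq_abs]
  have f3 : w α t = r α t / 2 - W α t := by simp only [hW]; ring
  have f4 := abs_le.1 (hr α t)
  rw [f3, abs_le]
  constructor <;> nlinarith [sq_nonneg (W α t - 1), sq_nonneg (W α t + 1), sq_nonneg (W α t)]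
end

section
open Topology Complex Pointwise

abbrev St (T : ℝ) : Set (ℝ × ℝ) := univ ×ˢ Icc (0:ℝ) T

def Dv (T : ℝ) (v : ℝ × ℝ) (F : ℝ × ℝ → ℂ) (p : ℝ × ℝ) : ℂ := fderivWithin ℝ F (St T) p v

structure Rg (T A : ℝ) (n : ℕ) (F : ℝ × ℝ → ℂ) : Prop where
  s : ContDiffOn ℝ n F (St T)
  b : ∀ p ∈ St T, ∀ i ≤ n, ‖iteratedFDerivWithin ℝ i F (St T) p‖ ≤ A
  p : ∀ q ∈ St T, F (q + (2 * Real.pi, 0)) = F q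

variable {T A : ℝ} {F : ℝ × ℝ → ℂ}

theorem St_ud (hT : 0 < T) : UniqueDiffOn ℝ (St T) := uniqueDiffOn_univ.prod (uniqueDiffOn_Icc hT)

theorem Rg.bd {n : ℕ} (h : Rg T A n F) {p : ℝ × ℝ} (hp : p ∈ St T) : ‖F p‖ ≤ A := by
  simpa using h.b p hp 0 (Nat.zero_le _)

theorem Rg.dv {n : ℕ} (hT : 0 < T) (h : Rg T A (n + 1) F) {v : ℝ × ℝ} (hv : ‖v‖ ≤ 1) : Rg T A n (Dv T v F) where
  s := (h.s.fderivWithin (St_ud hT) (by norm_cast)).clm_apply contDiffOn_const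
  b p hp i hi := by
    have h1 := norm_iteratedFDerivWithin_clm_apply_const (f := fderivWithin ℝ F (St T)) (c := v) (n := i) (N := n)
      ((h.s.fderivWithin (St_ud hT) (by norm_cast)) p hp) (St_ud hT) hp (by exact_mod_cast hi)
    rw [norm_iteratedFDerivWithin_fderivWithin (St_ud hT) hp] at h1
    have h2 := h.b p hp (i + 1) (by omega)
    refine h1.trans ?_
    nlinarith [norm_nonneg v, norm_nonneg (iteratedFDerivWithin ℝ (i + 1) F (St T) p)]
  p q hq := by
    have h1 := fderivWithin_comp_add_right (𝕜 := ℝ) (f := F) (s := St T) (x := q) ((2 * Real.pi, 0) : ℝ × ℝ)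
    have h2 : ((2 * Real.pi, 0) : ℝ × ℝ) +ᵥ St T = St T := by
      ext ⟨x, y⟩
      rw [mem_vadd_set_iff_neg_vadd_mem]
      simp
    rw [h2] at h1
    unfold Dv
    rw [← h1, fderivWithin_congr (fun x hx => h.p x hx) (h.p q hq)]

theorem Rg.sym {n : ℕ} (hT : 0 < T) (h : Rg T A (n + 2) F) (v w : ℝ × ℝ) {p : ℝ × ℝ} (hp : p ∈ St T) :
    Dv T v (Dv T w F) p = Dv T w (Dv T v F) p := by
  have h1 : DifferentiableWithinAt ℝ (fderivWithin ℝ F (St T)) (St T) p :=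
    ((h.s.fderivWithin (m := 1) (St_ud hT) (by norm_cast; omega)).differentiableOn (by norm_num)) p hp
  have h2 := (h.s p hp).isSymmSndFDerivWithinAt (by simp) (St_ud hT) ?_ hp
  · have h3 : ∀ v w, Dv T v (Dv T w F) p = fderivWithin ℝ (fderivWithin ℝ F (St T)) (St T) p v w := by
      intro v w
      unfold Dv
      rw [fderivWithin_clm_apply (St_ud hT p hp) h1 (differentiableWithinAt_const w)]
      simp
    rw [h3, h3, h2.eq]
  · rw [interior_prod_eq, interior_univ, interior_Icc, closure_prod_eq, closure_univ, closure_Ioo hT.ne]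
    exact hp

def cl (T t : ℝ) : ℝ := max 0 (min t T)
theorem cl_mem (hT : 0 < T) (t : ℝ) : cl T t ∈ Icc 0 T := ⟨le_max_left _ _, max_le hT.le (min_le_right _ _)⟩
theorem cl_eq {t : ℝ} (h : t ∈ Icc 0 T) : cl T t = t := by simp [cl, h.1, h.2]
theorem cl_c : Continuous (cl T) := by unfold cl; fun_prop
theorem cl_ev {t : ℝ} (h : t ∈ Ioo 0 T) : ∀ᶠ s in 𝓝 t, cl T s = s := by
  filter_upwards [isOpen_Ioo.mem_nhds h] with s hs using cl_eq ⟨hs.1.le, hs.2.le⟩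

theorem Rg.cont {n : ℕ} (hT : 0 < T) (h : Rg T A n F) : Continuous fun p : ℝ × ℝ => F (p.1, cl T p.2) := by
  rw [← continuousOn_univ]
  have := cl_c (T := T)
  exact h.s.continuousOn.comp (by fun_prop) fun p _ => ⟨mem_univ _, cl_mem hT _⟩

theorem Rg.da {n : ℕ} (hT : 0 < T) (h : Rg T A (n + 1) F) (α t : ℝ) :
    HasDerivAt (fun a => F (a, cl T t)) (Dv T (1, 0) F (α, cl T t)) α := by
  have h1 := ((h.s.differentiableOn (by simp)) (α, cl T t) ⟨mem_univ _, cl_mem hT _⟩).hasFDerivWithinAt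
  have h2 : HasDerivAt (fun a : ℝ => (a, cl T t)) (1, 0) α := (hasDerivAt_id α).prodMk (hasDerivAt_const _ _)
  have h3 := h1.comp_hasDerivWithinAt (s := univ) α h2.hasDerivWithinAt (fun a _ => show (a, cl T t) ∈ St T from ⟨mem_univ _, cl_mem hT _⟩)
  exact hasDerivWithinAt_univ.1 h3

theorem Rg.dt {n : ℕ} (h : Rg T A (n + 1) F) (α : ℝ) {t : ℝ} (ht : t ∈ Ioo 0 T) :
    HasDerivAt (fun t => F (α, cl T t)) (Dv T (0, 1) F (α, cl T t)) t := by
  have ht' : t ∈ Icc 0 T := ⟨ht.1.le, ht.2.le⟩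
  rw [cl_eq ht']
  have h1 := ((h.s.differentiableOn (by simp)) (α, t) ⟨mem_univ _, ht'⟩).hasFDerivWithinAt
  have h2 : HasDerivAt (fun a : ℝ => (α, a)) (0, 1) t := (hasDerivAt_const _ _).prodMk (hasDerivAt_id t)
  have h3 := (h1.comp_hasDerivWithinAt (s := Icc 0 T) t h2.hasDerivWithinAt fun a ha => ⟨mem_univ _, ha⟩).hasDerivAt (Icc_mem_nhds ht.1 ht.2)
  exact h3.congr_of_eventuallyEq ((cl_ev ht).mono fun s hs => by simp [hs])

theorem Rg.pe {n : ℕ} (hT : 0 < T) (h : Rg T A n F) (α t : ℝ) : F (α + 2 * Real.pi, cl T t) = F (α, cl T t) := by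
  simpa using h.p (α, cl T t) ⟨mem_univ _, cl_mem hT _⟩
end

section
open Topology Complex

def io : ℂ ≃ₗᵢ[ℝ] E2 := Complex.orthonormalBasisOneI.repr
theorem io0 (x : ℂ) : io x 0 = x.re := by simp [io]
theorem io1 (x : ℂ) : io x 1 = x.im := by simp [io]
theorem io_sre (x : E2) : (io.symm x).re = x 0 := by rw [← io0, io.apply_symm_apply]
theorem io_sim (x : E2) : (io.symm x).im = x 1 := by rw [← io1, io.apply_symm_apply]
theorem e2_ext {x y : E2} (h0 : x 0 = y 0) (h1 : x 1 = y 1) : x = y := by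
  ext i; fin_cases i <;> assumption
theorem io_one : io 1 = EuclideanSpace.single 0 1 := e2_ext (by simp [io0]) (by simp [io1])
theorem io_I : io I = EuclideanSpace.single 1 1 := e2_ext (by simp [io0]) (by simp [io1])
theorem io_tr : transl = io (2 * Real.pi) := e2_ext (by simp [io0, transl]) (by simp [io1, transl])
theorem io_x : xvec = io 1 := e2_ext (by simp [io0, xvec]) (by simp [io1, xvec])
theorem io_e2 : e2vec = io I := e2_ext (by simp [io0, e2vec]) (by simp [io1, e2vec])
theorem io_in (x y : E2) : inner ℝ x y = (starRingEnd ℂ (io.symm x) * io.symm y).re := by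
  rw [← io.symm.inner_map_map]; rw [Complex.inner]
  try rw [mul_comm]
theorem io_perp (w : ℂ) : perpv (io w) = io (I * w) := e2_ext (by simp [io0, io1, perpv]) (by simp [io0, io1, perpv])

def cj (u : E2 → E2) (x : ℂ) : ℂ := starRingEnd ℂ (io.symm (u (io x)))
def ioc : E2 ≃ₗᵢ[ℝ] ℂ := io.symm.trans conjLIE
theorem ioc_ap (x : E2) : ioc x = starRingEnd ℂ (io.symm x) := rfl
theorem cj_eq (u : E2 → E2) : cj u = ioc ∘ u ∘ io := rfl

theorem dec_line {f : ℂ → ℂ} {a s : ℝ} (hs : s = 1 ∨ s = -1) (hc : ContinuousOn f {x : ℂ | a ≤ s * x.im})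
    (hi : IntegrableOn (fun x => ‖f x‖ ^ 2) {x : ℂ | a ≤ s * x.im ∧ x.re ∈ Icc 0 (2 * Real.pi)}) :
    ∃ b : ℕ → ℝ, Tendsto b atTop atTop ∧ Tendsto (fun k => ∫ r in (0:ℝ)..(2 * Real.pi), ‖f (r + I * (s * b k : ℝ))‖) atTop (𝓝 0) := by
  have hss : s * s = 1 := by rcases hs with rfl | rfl <;> norm_num
  have pi := Real.two_pi_pos
  set G : ℝ → ℝ := fun y => ∫ r in (0:ℝ)..(2 * Real.pi), ‖f (r + I * (s * y : ℝ))‖ ^ 2 with hG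
  have hGi : IntegrableOn G (Ici a) := by
    have e1 : {x : ℂ | a ≤ s * x.im ∧ x.re ∈ Icc 0 (2 * Real.pi)} = measurableEquivRealProd ⁻¹' (Icc 0 (2 * Real.pi) ×ˢ {y : ℝ | a ≤ s * y}) := by
      ext x; simp [measurableEquivRealProd_apply]; tauto
    rw [e1] at hi
    have e2 : (fun x => ‖f x‖ ^ 2) = (fun p : ℝ × ℝ => ‖f (p.1 + I * p.2)‖ ^ 2) ∘ measurableEquivRealProd := by
      funext x; simp [measurableEquivRealProd_apply, mul_comm I]
    rw [e2, volume_preserving_equiv_real_prod.integrableOn_comp_preimage measurableEquivRealProd.measurableEmbedding, IntegrableOn, Measure.volume_eq_prod, ← Measure.prod_restrict] at hi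
    have h1 : IntegrableOn (fun y : ℝ => ∫ x in Icc 0 (2 * Real.pi), ‖f (x + I * y)‖ ^ 2) {y : ℝ | a ≤ s * y} := hi.integral_prod_right
    have h2 : MeasurePreserving (fun y : ℝ => s * y) volume volume := by
      rcases hs with rfl | rfl
      · simp only [one_mul]; exact MeasurePreserving.id _
      · simpa using Measure.measurePreserving_neg (volume : Measure ℝ)
    have h3 : MeasurableEmbedding (fun y : ℝ => s * y) := measurableEmbedding_mulLeft₀ (by rintro rfl; simp at hss)
    rw [← h2.integrableOn_comp_preimage h3] at h1
    have e3 : (fun y : ℝ => s * y) ⁻¹' {y : ℝ | a ≤ s * y} = Ici a := by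
      ext y; simp [← mul_assoc, hss]
    rw [e3] at h1
    refine h1.congr_fun (fun y _ => ?_) measurableSet_Ici
    simp only [hG, Function.comp]
    rw [integral_Icc_eq_integral_Ioc, intervalIntegral.integral_of_le pi.le]
  have ex : ∀ k : ℕ, ∃ b : ℝ, (k : ℝ) ≤ b ∧ a ≤ b ∧ G b ≤ (1 / ((k:ℝ) + 1)) ^ 2 := by
    intro k
    by_contra! hcon
    have h1 : IntegrableOn (fun _ : ℝ => (1 / ((k:ℝ) + 1)) ^ 2) (Ici (max a k)) := by
      refine (hGi.mono_set (Ici_subset_Ici.2 (le_max_left _ _))).mono' (by fun_prop) ?_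
      filter_upwards [ae_restrict_mem measurableSet_Ici] with y hy
      have hy' := max_le_iff.1 (mem_Ici.1 hy)
      rw [Real.norm_of_nonneg (by positivity)]
      exact (hcon y hy'.2 hy'.1).le
    rw [integrableOn_const_iff] at h1
    have : (1 / ((k:ℝ) + 1)) ^ 2 ≠ 0 := by positivity
    simp at h1
    linarith [show (0:ℝ) < (k:ℝ) + 1 by positivity]
  choose b hb1 hb2 hb3 using ex
  refine ⟨b, tendsto_atTop_mono hb1 tendsto_natCast_atTop_atTop, ?_⟩
  refine squeeze_zero (g := fun k : ℕ => (2 * Real.pi + 1) * (1 / ((k:ℝ) + 1))) (fun k => intervalIntegral.integral_nonneg pi.le fun _ _ => norm_nonneg _) ?_ ?_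
  · intro k
    set ε := 1 / ((k:ℝ) + 1) with hε
    have ε0 : 0 < ε := by positivity
    have cf : Continuous fun r : ℝ => f (r + I * (s * b k : ℝ)) := by
      rw [← continuousOn_univ]
      refine hc.comp (by fun_prop) fun r _ => ?_
      simp only [mem_ofPred_eq, add_im, ofReal_im, mul_im, I_re, I_im, ofReal_re]
      have := hb2 k
      have : s * (s * b k) = b k := by rw [← mul_assoc, hss, one_mul]
      linarith
    have cn := cf.norm
    have cq : Continuous fun r : ℝ => ε⁻¹ * ‖f (r + I * (s * b k : ℝ))‖ ^ 2 := (cn.pow 2).const_mul _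
    have h1 : ∫ r in (0:ℝ)..(2 * Real.pi), ‖f (r + I * (s * b k : ℝ))‖ ≤ ∫ r in (0:ℝ)..(2 * Real.pi), (ε + ε⁻¹ * ‖f (r + I * (s * b k : ℝ))‖ ^ 2) := by
      refine intervalIntegral.integral_mono_on pi.le (cn.intervalIntegrable _ _) ((continuous_const.add cq).intervalIntegrable _ _) fun r _ => ?_
      set N := ‖f (r + I * (s * b k : ℝ))‖
      have e1 : ε * ε⁻¹ = 1 := mul_inv_cancel₀ ε0.ne'
      nlinarith [mul_nonneg (inv_nonneg.2 ε0.le) (sq_nonneg (N - ε)), norm_nonneg (f (r + I * (s * b k : ℝ)))]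
    rw [intervalIntegral.integral_add (continuous_const.intervalIntegrable _ _) (cq.intervalIntegrable _ _), intervalIntegral.integral_const_mul] at h1
    have h2 : ε⁻¹ * G (b k) ≤ ε := by
      rw [inv_mul_le_iff₀ ε0, ← sq]; exact hb3 k
    simp only [intervalIntegral.integral_const, sub_zero, smul_eq_mul] at h1
    nlinarith
  · simpa using tendsto_one_div_add_atTop_nhds_zero_nat.const_mul (2 * Real.pi + 1)
end

section
open Topology Complex

theorem io_cl (Ω : Set E2) : closure (io ⁻¹' Ω) = io ⁻¹' closure Ω := (io.toHomeomorph.preimage_closure Ω).symm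

section
variable {Ω : Set E2} {u : E2 → E2} (ho : IsOpen Ω) (hu : ContDiffOn ℝ 3 u (closure Ω))
  (hd : ∀ x ∈ Ω, fderiv ℝ u x (EuclideanSpace.single 0 1) 0 + fderiv ℝ u x (EuclideanSpace.single 1 1) 1 = 0)
  (hc : ∀ x ∈ Ω, fderiv ℝ u x (EuclideanSpace.single 0 1) 1 - fderiv ℝ u x (EuclideanSpace.single 1 1) 0 = 0)

theorem dif_of {E : Type*} [NormedAddCommGroup E] [NormedSpace ℝ E] {n : WithTop ℕ∞} {h : E2 → E} (hn : n ≠ 0) (ho : IsOpen Ω) (hu : ContDiffOn ℝ n h (closure Ω)) {x : E2} (hx : x ∈ Ω) : DifferentiableAt ℝ h x :=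
  (hu.differentiableOn hn).differentiableAt (mem_of_superset (ho.mem_nhds hx) subset_closure)

theorem cj_d {x : ℂ} (h : DifferentiableAt ℝ u (io x)) : HasFDerivAt (cj u) (((ioc : E2 ≃L[ℝ] ℂ) : E2 →L[ℝ] ℂ).comp ((fderiv ℝ u (io x)).comp ((io : ℂ ≃L[ℝ] E2) : ℂ →L[ℝ] E2))) x :=
  ((ioc : E2 ≃L[ℝ] ℂ).hasFDerivAt).comp x (h.hasFDerivAt.comp x (io : ℂ ≃L[ℝ] E2).hasFDerivAt)

include ho hu hd hc
theorem fld_of {s : ℝ} (hs : s = 1 ∨ s = -1) (hp : ∀ x ∈ Ω, u (x + transl) = u x)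
    (hi : IntegrableOn (fun x => ‖u x‖ ^ 2) (Ω ∩ {x : E2 | x 0 ∈ Icc 0 (2 * Real.pi)}))
    {a : ℝ} (ha : ∀ x : E2, a ≤ s * x 1 → x ∈ Ω) : Fld (io ⁻¹' Ω) s (cj u) := by
  have con : ContinuousOn (cj u) (closure (io ⁻¹' Ω)) := by
    rw [io_cl, cj_eq]
    exact ioc.continuous.comp_continuousOn (hu.continuousOn.comp io.continuous.continuousOn fun x hx => hx)
  refine ⟨?_, ?_, con, ?_⟩
  · intro x hx
    have h0 := cj_d (dif_of (by norm_num) ho hu hx)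
    refine (differentiableAt_complex_iff_differentiableAt_real.2 ⟨h0.differentiableAt, ?_⟩).differentiableWithinAt
    rw [h0.fderiv]
    have h1 := hd _ hx
    have h2 := hc _ hx
    rw [← io_one, ← io_I] at h1 h2
    apply Complex.ext
    · simp [ioc_ap, io_sre, io_sim]; linarith
    · simp [ioc_ap, io_sre, io_sim]; linarith
  · intro x hx
    simp only [cj]
    rw [map_add, ← io_tr, hp _ hx]
  · have sub : {x : ℂ | a ≤ s * x.im} ⊆ io ⁻¹' Ω := fun x hx => ha _ (by rw [io1]; exact hx)
    refine dec_line hs (con.mono (sub.trans subset_closure)) ?_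
    have h1 := (io.measurePreserving.integrableOn_comp_preimage io.toHomeomorph.measurableEmbedding).2 hi
    refine (h1.congr_fun (g := fun x => ‖cj u x‖ ^ 2) (fun x _ => by simp [cj]) ?_).mono_set ?_
    · refine io.continuous.measurable (ho.measurableSet.inter (?_ : MeasurableSet {x : E2 | x 0 ∈ Icc 0 (2 * Real.pi)}))
      have : Measurable fun x : E2 => x 0 := by fun_prop
      exact this measurableSet_Icc
    · rintro x ⟨h1, h2⟩
      exact ⟨sub h1, by simpa [io0] using h2⟩

theorem eu_of {P : E2 → ℝ} {ρ g : ℝ} {ut : E2} (hρ : 0 < ρ) (hP : ContDiffOn ℝ 1 P (closure Ω)) {x : ℂ} (hx : io x ∈ Ω)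
    (he : ρ • (ut + fderiv ℝ u (io x) (u (io x))) = -gradient P (io x) - (g * ρ) • e2vec) :
    ∃ L : ℂ →L[ℝ] ℝ, HasFDerivAt (fun x => -P (io x) / ρ - g * x.im - ‖cj u x‖ ^ 2 / 2) L x ∧ ∀ v, L v = (ioc ut * v).re := by
  have dP := dif_of (by norm_num) ho hP hx
  have du := dif_of (by norm_num) ho hu hx
  have h1 := dP.hasFDerivAt.comp x (io : ℂ ≃L[ℝ] E2).hasFDerivAt
  have h2 := (cj_d du).norm_sq
  have h3 := ((h1.neg.mul_const ρ⁻¹).sub ((imCLM.hasFDerivAt (x := x)).const_mul g)).sub (h2.mul_const (1 / 2))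
  refine ⟨_, h3.congr_of_eventuallyEq (Eventually.of_forall fun y => by simp [div_eq_mul_inv]), fun v => ?_⟩
  have e1 := congrArg (fun w => inner ℝ w (io v)) he
  simp only [inner_smul_left, inner_add_left, inner_sub_left, inner_neg_left, gradient, InnerProductSpace.toDual_symm_apply] at e1
  have e2 : inner ℝ (fderiv ℝ u (io x) (u (io x))) (io v) = inner ℝ (u (io x)) (fderiv ℝ u (io x) (io v)) := by
    have c := hc _ hx
    set M := fderiv ℝ u (io x)
    have hM : ∀ w : E2, M w = w 0 • M (EuclideanSpace.single 0 1) + w 1 • M (EuclideanSpace.single 1 1) := by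
      intro w
      rw [← map_smul, ← map_smul, ← map_add]
      congr 1
      exact e2_ext (by simp) (by simp)
    rw [hM (u (io x)), hM (io v)]
    simp only [io_in, inner_add_left, inner_add_right, inner_smul_left, inner_smul_right]
    simp [io_sre, io_sim, io0, io1]
    linear_combination (u (io x) 0 * v.im - u (io x) 1 * v.re) * c
  have e3 : inner ℝ (cj u x) (ioc (fderiv ℝ u (io x) (io v))) = inner ℝ (u (io x)) (fderiv ℝ u (io x) (io v)) := ioc.inner_map_map _ _
  have e4 : (ioc ut * v).re = inner ℝ ut (io v) := by rw [io_in, ioc_ap, io.symm_apply_apply]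
  have e5 : inner ℝ e2vec (io v) = v.im := by rw [io_in, io_e2]; simp
  rw [e4]
  rw [e2, e5] at e1
  rw [Complex.inner] at e3
  simp at e1 e3 ⊢
  rw [← e3] at e1
  field_simp
  linarith
end

theorem io_fr (Ω : Set E2) : frontier (io ⁻¹' Ω) = io ⁻¹' frontier Ω := (io.toHomeomorph.preimage_frontier Ω).symm

theorem dom_of {z : ℝ → E2} {Ω1 Ω2 : Set E2} (o1 : IsOpen Ω1) (o2 : IsOpen Ω2) (c1 : IsConnected Ω1) (c2 : IsConnected Ω2)
    (s1 : SimplyConnectedSpace Ω1) (s2 : SimplyConnectedSpace Ω2) (un : Ω1 ∪ Ω2 ∪ range z = univ) (d : Disjoint Ω1 Ω2)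
    (d1 : Disjoint Ω1 (range z)) (d2 : Disjoint Ω2 (range z)) (f1 : frontier Ω1 = range z) (f2 : frontier Ω2 = range z)
    {a : ℝ} (hs1 : {x : E2 | x 1 ≤ -a} ⊆ Ω1) (hs2 : {x : E2 | a ≤ x 1} ⊆ Ω2)
    (p1 : (fun x => x + transl) '' Ω1 = Ω1) (p2 : (fun x => x + transl) '' Ω2 = Ω2) :
    Dom (fun a => io.symm (z a)) (io ⁻¹' Ω1) (io ⁻¹' Ω2) := by
  have hr : range (fun a => io.symm (z a)) = io ⁻¹' range z := by
    ext x
    simp only [mem_range, mem_preimage]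
    exact exists_congr fun a => io.symm_apply_eq
  have hp : ∀ Ω : Set E2, (fun x => x + transl) '' Ω = Ω → ∀ x : ℂ, x + 2 * Real.pi ∈ io ⁻¹' Ω ↔ x ∈ io ⁻¹' Ω := by
    intro Ω h x
    rw [mem_preimage, map_add, ← io_tr]
    conv_lhs => rw [← h]
    exact (add_left_injective transl).mem_set_image
  refine ⟨o1.preimage io.continuous, o2.preimage io.continuous, (io.toHomeomorph.isPreconnected_preimage).2 c1.isPreconnected, (io.toHomeomorph.isPreconnected_preimage).2 c2.isPreconnected,
    (io.toHomeomorph.isSimplyConnected_preimage).2 s1, (io.toHomeomorph.isSimplyConnected_preimage).2 s2, ?_, d.preimage io, ?_, ?_, ?_, ?_, ⟨a, fun x hx => hs1 (by simpa [io1] using hx), fun x hx => hs2 (by simpa [io1] using hx)⟩, hp _ p1, hp _ p2⟩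
  · rw [hr, ← preimage_union, ← preimage_union, un, preimage_univ]
  · rw [hr]; exact d1.preimage io
  · rw [hr]; exact d2.preimage io
  · rw [hr, io_fr, f1]
  · rw [hr, io_fr, f2]
end

section
open Topology Complex

theorem dioc {T t : ℝ} (ht : t ∈ Ioo 0 T) (v : ℝ → E2) : deriv (fun τ => ioc (v (cl T τ))) t = ioc (deriv v t) := by
  have h1 : (fun τ => ioc (v (cl T τ))) =ᶠ[𝓝 t] fun τ => ioc (v τ) := (cl_ev ht).mono fun s hs => by simp only [hs]
  rw [h1.deriv_eq, ← fderiv_apply_one_eq_deriv, ← fderiv_apply_one_eq_deriv]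
  have h2 := ioc.comp_fderiv (f := v) (x := t)
  exact congrArg (fun L : ℝ →L[ℝ] ℂ => L 1) h2

theorem Rg.of {T A : ℝ} (hT : 0 < T) {n : ℕ} {G : ℝ × ℝ → E2} (h : ContDiffOn ℝ n G (St T))
    (hb : ∀ p ∈ St T, ∀ i : ℕ, i ≤ n → ‖iteratedFDerivWithin ℝ i G (St T) p‖ ≤ A)
    (hp : ∀ q ∈ St T, io.symm (G (q + (2 * Real.pi, 0))) = io.symm (G q)) : Rg T A n (fun p => io.symm (G p)) where
  s := (io.symm : E2 ≃L[ℝ] ℂ).contDiff.comp_contDiffOn h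
  b p hp i hi := (io.symm.norm_iteratedFDerivWithin_comp_left G (St_ud hT) hp i).le.trans (hb p hp i hi)
  p := hp

theorem in_re (w x : ℂ) : (starRingEnd ℂ w * (I * x)).re = -(starRingEnd ℂ w * x).im := by simp; ring

theorem tf_bound (ρ1 ρ2 σ g T A : ℝ) (hρ1 : 0 < ρ1) (hρ2 : 0 < ρ2) (hT : 0 < T) (hA : 1 ≤ A) :
    ∃ C : ℝ, ∀ D : TwoFluid ρ1 ρ2 σ g T A, ∀ t ∈ Icc (0:ℝ) T, ∀ α : ℝ,
        |rinner (D.u1 (D.z α t) t - D.u2 (D.z α t) t) (deriv (fun a => D.z a t) α)| ≤ C := by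
  set B := 4 * (1 + A) ^ 2 with hB
  have AB : 1 + A ≤ B := by nlinarith
  have AB2 : 4 * A ^ 2 + 2 * A ≤ B := by nlinarith
  obtain ⟨C, hC⟩ := CFlow.bound B σ g ρ1 ρ2 T (by positivity) hT hρ1 hρ2
  refine ⟨C, fun D t ht α => ?_⟩
  set n1 : ℝ × ℝ := (1, 0)
  set nt : ℝ × ℝ := (0, 1)
  have v1 : ‖n1‖ ≤ 1 := by simp [n1, Prod.norm_def]
  have vt : ‖nt‖ ≤ 1 := by simp [nt, Prod.norm_def]
  set F : ℝ × ℝ → ℂ := fun p => io.symm (D.z p.1 p.2 - p.1 • xvec) with hFd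
  set V : ℝ × ℝ → ℂ := fun p => io.symm (D.u1 (D.z p.1 p.2) p.2) with hVd
  have c := fun t => cl_mem hT t
  have hF : Rg T A 4 F := Rg.of hT D.hz_smooth D.hz_bound fun q hq => by
    have := D.hper_z q.2 hq.2 q.1
    simp only [Prod.fst_add, Prod.snd_add, add_zero, this]
    congr 1
    rw [io_tr, io_x, add_smul, show io (2 * Real.pi : ℂ) = (2 * Real.pi) • io 1 by rw [← map_smul]; simp]
    abel
  have hF1 := hF.dv hT v1
  have hF2 := hF1.dv hT v1
  have hF3 := hF2.dv hT v1
  have hFt := hF.dv hT vt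
  have hF1t := hF1.dv hT vt
  have hF2t := hF2.dv hT vt
  set z : ℝ → ℝ → ℂ := fun α t => F (α, cl T t) + α with hz
  have hzD : ∀ α t, z α t = io.symm (D.z α (cl T t)) := fun α t => by
    simp [hz, hFd, io_x]
  have hzE : ∀ α t, io (z α t) = D.z α (cl T t) := fun α t => by rw [hzD, io.apply_symm_apply]
  set z1 : ℝ → ℝ → ℂ := fun α t => Dv T n1 F (α, cl T t) + 1 with hz1
  have d0 : ∀ α t, HasDerivAt (fun a => z a t) (z1 α t) α := fun α t => by
    exact (hF.da hT α t).add (hasDerivAt_id α).ofReal_comp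
  set z2 : ℝ → ℝ → ℂ := fun α t => Dv T n1 (Dv T n1 F) (α, cl T t) with hz2
  have d1 : ∀ α t, HasDerivAt (fun a => z1 a t) (z2 α t) α := fun α t => (hF1.da hT α t).add_const 1
  have hdz : ∀ α t, deriv (fun a => D.z a (cl T t)) α = io (z1 α t) := fun α t => by
    have := (io : ℂ ≃L[ℝ] E2).hasFDerivAt.comp_hasDerivAt α (d0 α t)
    refine HasDerivAt.deriv (this.congr_of_eventuallyEq (Eventually.of_forall fun a => (hzE a t).symm))
  have hdz2 : ∀ α t, deriv (fun a => deriv (fun b => D.z b (cl T t)) a) α = io (z2 α t) := fun α t => by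
    have := (io : ℂ ≃L[ℝ] E2).hasFDerivAt.comp_hasDerivAt α (d1 α t)
    refine HasDerivAt.deriv (this.congr_of_eventuallyEq (Eventually.of_forall fun a => hdz a t))
  have lo : ∀ α t, A⁻¹ ≤ ‖z1 α t‖ := fun α t => by
    have := D.hz_lower _ (c t) α
    rwa [hdz, io.norm_map] at this
  have ne : ∀ α t, z1 α t ≠ 0 := fun α t => norm_pos_iff.1 ((by positivity : 0 < A⁻¹).trans_le (lo α t))
  have crv : ∀ t, Crv (fun a => z a t) (fun a => z1 a t) fun a => z2 a t := fun t =>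
    ⟨fun α => d0 α t, fun α => d1 α t, (hF2.cont hT).comp (by fun_prop : Continuous fun a : ℝ => (a, t)), fun α => by
      simp only [hz, hF.pe hT]; push_cast; ring, fun α => ne α t⟩
  obtain ⟨a, -, hstr⟩ := D.hStrip
  set Ω1 : ℝ → Set ℂ := fun t => io ⁻¹' D.Ω1 (cl T t) with hΩ1
  set Ω2 : ℝ → Set ℂ := fun t => io ⁻¹' D.Ω2 (cl T t) with hΩ2
  have dom : ∀ t, Dom (fun a => z a t) (Ω1 t) (Ω2 t) := fun t => by
    simp only [hzD]
    exact dom_of (D.hΩ1_open _ (c t)) (D.hΩ2_open _ (c t)) (D.hΩ1_conn _ (c t)) (D.hΩ2_conn _ (c t)) (D.hΩ1_sc _ (c t)) (D.hΩ2_sc _ (c t))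
      (D.hUnion _ (c t)) (D.hDisj12 _ (c t)) (D.hDisj1Γ _ (c t)) (D.hDisj2Γ _ (c t)) (D.hFront1 _ (c t)) (D.hFront2 _ (c t))
      (hstr _ (c t)).1 (hstr _ (c t)).2 (D.hper_Ω1 _ (c t)) (D.hper_Ω2 _ (c t))
  have inj := fun t => embed (crv t) (dom t)
  set f1 : ℂ → ℝ → ℂ := fun x t => cj (fun y => D.u1 y (cl T t)) x with hf1
  set f2 : ℂ → ℝ → ℂ := fun x t => cj (fun y => D.u2 y (cl T t)) x with hf2
  have L1 : ∀ t, Fld (Ω1 t) (-1) fun x => f1 x t := fun t =>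
    fld_of (D.hΩ1_open _ (c t)) (D.hu1_reg _ (c t)) (D.hdiv1 _ (c t)) (D.hcurl1 _ (c t)) (Or.inr rfl) (D.hper_u1 _ (c t)) (D.hL2_1 _ (c t))
      (a := a) fun x hx => (hstr _ (c t)).1 (by simp only [mem_ofPred_eq]; linarith)
  have L2 : ∀ t, Fld (Ω2 t) 1 fun x => f2 x t := fun t =>
    fld_of (D.hΩ2_open _ (c t)) (D.hu2_reg _ (c t)) (D.hdiv2 _ (c t)) (D.hcurl2 _ (c t)) (Or.inl rfl) (D.hper_u2 _ (c t)) (D.hL2_2 _ (c t))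
      (a := a) fun x hx => (hstr _ (c t)).2 (by simp only [mem_ofPred_eq]; linarith)
  have fV : ∀ α t, f1 (z α t) t = starRingEnd ℂ (V (α, cl T t)) := fun α t => by simp only [hf1, cj, hzE, hVd]
  have hV : Rg T A 3 V := Rg.of hT D.hv1_smooth D.hv1_bound fun q hq => by
    obtain ⟨c0, C, ε0, G⟩ := geo (crv q.2) (inj q.2)
    have h1 := (sides G (dom q.2)).1.fz_per (L1 q.2) q.1
    simp only [fV, cl_eq hq.2] at h1
    have h2 := congrArg (starRingEnd ℂ) h1
    simp only [conj_conj] at h2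
    rw [Prod.add_def]
    simp only [add_zero]
    exact h2
  have hVt := hV.dv hT vt
  have hVa := hV.dv hT v1
  set zt : ℝ → ℝ → ℂ := fun α t => Dv T nt F (α, cl T t) with hzt
  set zt1 : ℝ → ℝ → ℂ := fun α t => Dv T nt (Dv T n1 F) (α, cl T t) with hzt1
  set zt2 : ℝ → ℝ → ℂ := fun α t => Dv T nt (Dv T n1 (Dv T n1 F)) (α, cl T t) with hzt2
  have cF := hF.cont hT
  have cF1 := hF1.cont hT
  have cV := hV.cont hT
  have cVt := hVt.cont hT
  have cF1t := hF1t.cont hT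
  have mov : Mov T z z1 z2 zt zt1 zt2 :=
    ⟨cF.add (continuous_ofReal.comp continuous_fst), cF1.add continuous_const, hF2.cont hT, hFt.cont hT, hF1t.cont hT, hF2t.cont hT, d0, d1,
      fun α t => (hFt.da hT α t).congr_deriv (hF.sym hT _ _ ⟨mem_univ _, c t⟩), fun α t ht => (hF.dt α ht).add_const _,
      fun α t ht => (hF1.dt α ht).add_const _, fun α t ht => hF2.dt α ht, fun α t => (crv t).per α, fun α t => hFt.pe hT α t,
      fun α t => hF1t.pe hT α t, fun α t => hF2t.pe hT α t, ne, inj⟩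
  set r : ℝ → ℝ → ℝ := fun α t => 2 * (z1 α t * f1 (z α t) t).re with hr
  set r' : ℝ → ℝ → ℝ := fun α t => 2 * (zt1 α t * starRingEnd ℂ (V (α, cl T t)) + z1 α t * starRingEnd ℂ (Dv T nt V (α, cl T t))).re with hr'
  set Q1 : ℂ → ℝ → ℝ := fun x t => -D.P1 (io x) (cl T t) / ρ1 - g * x.im - ‖f1 x t‖ ^ 2 / 2 with hQ1
  set Q2 : ℂ → ℝ → ℝ := fun x t => -D.P2 (io x) (cl T t) / ρ2 - g * x.im - ‖f2 x t‖ ^ 2 / 2 with hQ2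
  have oo : ∀ {t : ℝ}, t ∈ Ioo 0 T → cl T t = t := fun ht => cl_eq ⟨ht.1.le, ht.2.le⟩
  have kn : ∀ α t (u : E2), rinner (deriv (fun s => D.z α s) (cl T t) - u) (perpv (deriv (fun a => D.z a (cl T t)) α)) = 0 →
      (starRingEnd ℂ (io.symm u) * z1 α t).im = (starRingEnd ℂ (io.symm (deriv (fun s => D.z α s) (cl T t))) * z1 α t).im := fun α t u h => by
    rw [hdz, io_perp, rinner, io_in, io.symm_apply_apply, in_re, map_sub, map_sub, sub_mul, sub_im] at h
    linarith
  have cf : CFlow T z z1 z2 zt zt1 zt2 Ω1 Ω2 f1 f2 Q1 Q2 r r' := by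
    refine ⟨mov, dom, L1, L2, fun α t => ?_, fun _ _ => rfl, ?_, ?_, fun α t => ?_, fun α t ht => ?_, fun t ht => ?_, fun t ht => ?_, fun t ht x hx => ?_, fun t ht x hx => ?_⟩
    · have k1 := kn α t _ (D.hkin1 _ (c t) α)
      have k2 := kn α t _ (D.hkin2 _ (c t) α)
      simp only [hf1, hf2, cj, hzE, sub_mul, sub_im]
      linarith
    · simp only [hr, fV]
      have := mov.cz1
      exact continuous_const.mul (continuous_re.comp (this.mul (continuous_conj.comp cV)))
    · simp only [hr']
      exact continuous_const.mul (continuous_re.comp ((mov.czt1.mul (continuous_conj.comp cV)).add (mov.cz1.mul (continuous_conj.comp cVt))))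
    · simp only [hr', hz1, hzt1, hV.pe hT, hVt.pe hT, hF1.pe hT, hF1t.pe hT]
    · simp only [hr, fV]
      exact (cre ((mov.e1 α t ht).mul (conjCLE.hasFDerivAt.comp_hasDerivAt t (hV.dt α ht)))).const_mul 2
    · refine ContinuousOn.sub (ContinuousOn.sub (ContinuousOn.div_const (ContinuousOn.neg ?_) _) (by fun_prop)) (((L1 t).con.norm.pow 2).div_const 2)
      rw [io_cl]
      exact (D.hP1_reg _ (c t)).continuousOn.comp io.continuous.continuousOn fun x hx => hx
    · refine ContinuousOn.sub (ContinuousOn.sub (ContinuousOn.div_const (ContinuousOn.neg ?_) _) (by fun_prop)) (((L2 t).con.norm.pow 2).div_const 2)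
      rw [io_cl]
      exact (D.hP2_reg _ (c t)).continuousOn.comp io.continuous.continuousOn fun x hx => hx
    · obtain ⟨L, h1, h2⟩ := eu_of (D.hΩ1_open _ (c t)) (D.hu1_reg _ (c t)) (D.hdiv1 _ (c t)) (D.hcurl1 _ (c t)) hρ1 (D.hP1_reg _ (c t)) hx (D.hEuler1 _ (c t) _ hx)
      refine ⟨L, h1, fun v => ?_⟩
      rw [h2, show (fun τ => f1 x τ) = fun τ => ioc (D.u1 (io x) (cl T τ)) from rfl, dioc ht, oo ht]
    · obtain ⟨L, h1, h2⟩ := eu_of (D.hΩ2_open _ (c t)) (D.hu2_reg _ (c t)) (D.hdiv2 _ (c t)) (D.hcurl2 _ (c t)) hρ2 (D.hP2_reg _ (c t)) hx (D.hEuler2 _ (c t) _ hx)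
      refine ⟨L, h1, fun v => ?_⟩
      rw [h2, show (fun τ => f2 x τ) = fun τ => ioc (D.u2 (io x) (cl T τ)) from rfl, dioc ht, oo ht]
  have mm : ∀ α t, (α, cl T t) ∈ St T := fun α t => ⟨mem_univ _, c t⟩
  have bz1 : ∀ α t, ‖z1 α t‖ ≤ 1 + A := fun α t => (norm_add_le _ _).trans (by have := hF1.bd (mm α t); simp; linarith)
  have bV : ∀ α t, ‖starRingEnd ℂ (V (α, cl T t))‖ ≤ A := fun α t => by rw [norm_conj]; exact hV.bd (mm α t)
  have hh := hC z z1 z2 zt zt1 zt2 Ω1 Ω2 f1 f2 Q1 Q2 r r' (fun α t => D.P1 (D.z α t) t) (fun α t => D.P2 (D.z α t) t) cf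
    (fun α t => ?_) (fun α t => (bz1 α t).trans AB) (fun α t => (hF2.bd (mm α t)).trans (by linarith)) (fun α t => (hFt.bd (mm α t)).trans (by linarith)) (fun α t => (hF1t.bd (mm α t)).trans (by linarith))
    (fun α t => (inv_anti₀ (by linarith) (by linarith)).trans (lo α t)) (fun α t ht => ⟨_, hF2.da hT α t, (hF3.bd (mm α t)).trans (by linarith)⟩)
    (fun α t ht => ?_) (fun α t => ?_) (fun α t => ?_) (fun α t ht => ?_) (fun α t ht => ?_) (fun α t ht => ?_) (fun α t ht => ?_) (fun α => ?_) t ht α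
  · rw [show rinner (D.u1 (D.z α t) t - D.u2 (D.z α t) t) (deriv (fun a => D.z a t) α) = ((f1 (z α t) t - f2 (z α t) t) * z1 α t).re from ?_]
    · exact (abs_re_le_norm _).trans hh
    · have := hdz α t
      rw [cl_eq ht] at this
      rw [this, rinner, io_in, io.symm_apply_apply]
      simp only [hf1, hf2, cj, hzE, cl_eq ht, map_sub]
  · have h1 := (abs_im_le_norm _).trans (hF.bd (mm α t))
    simp only [hz, add_im, ofReal_im, add_zero]
    linarith
  · refine ⟨_, (conjCLE.hasFDerivAt.comp_hasDerivAt α (hV.da hT α t)).congr_of_eventuallyEq (Eventually.of_forall fun a => fV a t), ?_, ?_⟩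
    · show ‖f1 (z α t) t‖ ≤ B; rw [fV]; linarith [bV α t]
    · refine le_trans (b := A) ?_ (by linarith)
      exact (norm_conj _).le.trans (hVa.bd (mm α t))
  · simp only [hr, fV]
    rw [abs_mul, abs_two]
    have h1 := (abs_re_le_norm (z1 α t * starRingEnd ℂ (V (α, cl T t)))).trans ((norm_mul _ _).le.trans (mul_le_mul (bz1 α t) (bV α t) (norm_nonneg _) (by linarith)))
    nlinarith
  · simp only [hr']
    rw [abs_mul, abs_two]
    have h1 := (norm_mul (zt1 α t) (starRingEnd ℂ (V (α, cl T t)))).le.trans (mul_le_mul (hF1t.bd (mm α t)) (bV α t) (norm_nonneg _) (by linarith))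
    have h2 := (norm_mul (z1 α t) (starRingEnd ℂ (Dv T nt V (α, cl T t)))).le.trans (mul_le_mul (bz1 α t) ((norm_conj _).le.trans (hVt.bd (mm α t))) (norm_nonneg _) (by linarith))
    have h3 := (abs_re_le_norm _).trans (norm_add_le (zt1 α t * starRingEnd ℂ (V (α, cl T t))) (z1 α t * starRingEnd ℂ (Dv T nt V (α, cl T t))))
    nlinarith
  · have h1 : ∀ a, io (z a t) ∈ closure (D.Ω2 (cl T t)) := fun a => by
      rw [hzE]
      exact frontier_subset_closure (by rw [D.hFront2 _ (c t)]; exact ⟨a, rfl⟩)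
    have h2 := ((D.hu2_reg _ (c t)).differentiableOn (by norm_num)) _ (h1 α)
    have h3 : DifferentiableAt ℝ (fun a => io (z a t)) α := (io : ℂ ≃L[ℝ] E2).differentiableAt.comp α (d0 α t).differentiableAt
    have h4 := DifferentiableWithinAt.comp α h2 h3.differentiableWithinAt (s := univ) fun a _ => h1 a
    exact (ioc : E2 ≃L[ℝ] ℂ).differentiableAt.comp α (differentiableWithinAt_univ.1 h4)
  · simp only [hQ1, hzE, oo ht]
  · simp only [hQ2, hzE, oo ht]
  · have h1 := D.hjump _ (c t) α
    rw [hdz2, hdz, oo ht] at h1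
    rw [h1, io0, io1, io0, io1]
    have e1 : (z1 α t).re ^ 2 + (z1 α t).im ^ 2 = ‖z1 α t‖ ^ 2 := by rw [← normSq_eq_norm_sq, normSq_apply]; ring
    rw [e1, ← Real.rpow_natCast, ← Real.rpow_mul (norm_nonneg _), ← Real.rpow_natCast]
    norm_num
    ring_nf
  · have h1 := D.hu2_init α
    have h0 : cl T 0 = 0 := cl_eq ⟨le_rfl, hT.le⟩
    simp only [hf2, cj, hzE, h0]
    rw [norm_conj, io.symm.norm_map]
    linarith
end

/-- **Boundedness of the boundary vorticity (Lemma 2.2).**  For solutions of the two-fluid system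
with `ρ1, ρ2 > 0`, the boundary vorticity `ω := (v¹ − v²)·∂_α z` satisfies
`sup_{(α,t) ∈ ℝ×[0,T]} |ω(α,t)| ≤ C` for a constant `C` depending only on
`A`, `T`, `σ`, `g`, `ρ¹`, `ρ²`. -/
theorem boundary_vorticity_bounded (ρ1 ρ2 σ grav T A : ℝ)
    (hρ1 : 0 < ρ1) (hρ2 : 0 < ρ2) (hσ : 0 ≤ σ) (hgrav : 0 ≤ grav) (hT : 0 < T) (hA : 1 ≤ A) :
    ∃ C : ℝ, 0 < C ∧
      ∀ D : TwoFluid ρ1 ρ2 σ grav T A, ∀ t ∈ Icc (0:ℝ) T, ∀ α : ℝ,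
        |rinner (D.u1 (D.z α t) t - D.u2 (D.z α t) t) (deriv (fun a => D.z a t) α)| ≤ C := by
  obtain ⟨C, hC⟩ := tf_bound ρ1 ρ2 σ grav T A hρ1 hρ2 hT hA
  exact ⟨max C 1, lt_max_of_lt_right one_pos, fun D t ht α => (hC D t ht α).trans (le_max_left _ _)⟩
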